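/- arXiv:1908.10724 — 3 statements merged into one kernel-verified Lean document; each statement's English description precedes it below -/
import Mathlib

section
/- A functional Z : Conv_sc(ℝ) → ℝ is a continuous and epi-translation invariant valuation, if and only if there exist a constant ζ₀ ∈ ℝ and a function ζ₁ ∈ C_c(ℝ) such that Z(u) = ζ₀ + ∫_{dom(u)} ζ₁(u'(x)) dx for every u ∈ Conv_sc(ℝ). -/
open Filter Topology MeasureTheory

noncomputable section

/-- `u : ℝ → ℝ ∪ {+∞}` (represented as an `EReal`-valued function that never
takes the value `⊥ = -∞`) is convex. -/
def IsConvexFn1 (u : ℝ → EReal) : Prop :=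
  ∀ x y : ℝ, ∀ t : ℝ, 0 < t → t < 1 →
    u (t * x + (1 - t) * y) ≤ (t : EReal) * u x + ((1 - t : ℝ) : EReal) * u y

/-- `Conv(ℝ)`: convex, lower semicontinuous, proper functions
`ℝ → ℝ ∪ {+∞}`. -/
def ConvSet1 : Set (ℝ → EReal) :=
  {u | IsConvexFn1 u ∧ LowerSemicontinuous u ∧ (∀ x, u x ≠ ⊥) ∧ (∃ x, u x ≠ ⊤)}

/-- `Conv_sc(ℝ)`: super-coercive elements of `Conv(ℝ)`. -/
def ConvSc1 : Set (ℝ → EReal) :=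
  {u | u ∈ ConvSet1 ∧
    ∀ M : ℝ, ∃ R : ℝ, ∀ x : ℝ, R ≤ |x| → ((M * |x| : ℝ) : EReal) ≤ u x}

/-- Epi-convergence of a sequence `uk` to `u`. -/
def EpiConverges1 (uk : ℕ → ℝ → EReal) (u : ℝ → EReal) : Prop :=
  ∀ x : ℝ,
    (∀ xk : ℕ → ℝ, Tendsto xk atTop (𝓝 x) →
      u x ≤ liminf (fun k => uk k (xk k)) atTop) ∧
    (∃ xk : ℕ → ℝ, Tendsto xk atTop (𝓝 x) ∧
      Tendsto (fun k => uk k (xk k)) atTop (𝓝 (u x)))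

/-- Continuity (with respect to epi-convergence) of a functional on a class `X`. -/
def ContinuousVal1 (X : Set (ℝ → EReal)) (Z : (ℝ → EReal) → ℝ) : Prop :=
  ∀ (uk : ℕ → ℝ → EReal) (u : ℝ → EReal),
    (∀ k, uk k ∈ X) → u ∈ X → EpiConverges1 uk u →
      Tendsto (fun k => Z (uk k)) atTop (𝓝 (Z u))

/-- The valuation property on a class `X`. -/
def IsValuation1 (X : Set (ℝ → EReal)) (Z : (ℝ → EReal) → ℝ) : Prop :=
  ∀ u v : ℝ → EReal, u ∈ X → v ∈ X → u ⊔ v ∈ X → u ⊓ v ∈ X →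
    Z (u ⊔ v) + Z (u ⊓ v) = Z u + Z v

/-- Epi-translation invariance: invariance under `u ↦ u(· - x₀) + c`. -/
def EpiTranslationInvariant1 (X : Set (ℝ → EReal)) (Z : (ℝ → EReal) → ℝ) : Prop :=
  ∀ u ∈ X, ∀ x₀ : ℝ, ∀ c : ℝ, Z (fun x => u (x - x₀) + (c : EReal)) = Z u


/-! ### Basic facts -/

lemma IsConvexFn1.convexOn {u : ℝ → EReal} (h : IsConvexFn1 u) (hb : ∀ x, u x ≠ ⊥) :
    ConvexOn ℝ {x | u x ≠ ⊤} (fun x => (u x).toReal) := by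
  have key : ∀ x y, u x ≠ ⊤ → u y ≠ ⊤ → ∀ a b : ℝ, 0 < a → 0 < b → a + b = 1 →
      u (a * x + b * y) ≤ ((a * (u x).toReal + b * (u y).toReal : ℝ) : EReal) := by
    intro x y hx hy a b ha hb' hab
    have hb1 : b = 1 - a := by linarith
    subst hb1
    have := h x y a ha (by linarith)
    lift u x to ℝ using ⟨hx, hb x⟩ with p hp
    lift u y to ℝ using ⟨hy, hb y⟩ with q hq
    simpa using this
  have hconv : Convex ℝ {x | u x ≠ ⊤} := by
    rw [convex_iff_forall_pos]
    intro x hx y hy a b ha hb' hab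
    have := key x y hx hy a b ha hb' hab
    simp only [smul_eq_mul]
    exact ne_top_of_le_ne_top (EReal.coe_ne_top _) this
  rw [convexOn_iff_forall_pos]
  refine ⟨hconv, ?_⟩
  intro x hx y hy a b ha hb' hab
  have := key x y hx hy a b ha hb' hab
  simp only [smul_eq_mul]
  have h2 := EReal.toReal_le_toReal this (hb _) (EReal.coe_ne_top _)
  rwa [EReal.toReal_coe] at h2

/-- `x` is a good point for `u`: either `u = ⊤` near `x`, or `u` is finite near `x` and
differentiable at `x`. -/
def GoodPt (u : ℝ → EReal) (x : ℝ) : Prop :=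
  (∀ᶠ y in 𝓝 x, u y = ⊤) ∨
    ((∀ᶠ y in 𝓝 x, u y ≠ ⊤) ∧ DifferentiableAt ℝ (fun y => (u y).toReal) x)

lemma ae_diff_of_convexOn {s : Set ℝ} {f : ℝ → ℝ} (hf : ConvexOn ℝ s f) :
    ∀ᵐ x, x ∈ interior s → DifferentiableAt ℝ f x := by
  have hl := hf.locallyLipschitzOn_interior
  rw [ae_iff]
  apply measure_null_of_locally_null
  intro x hx
  have hx' : x ∈ interior s := by
    by_contra h; exact hx (fun h' => absurd h' h)
  obtain ⟨K, t, ht, hK⟩ := hl hx'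
  have ht' : t ∈ 𝓝 x := by
    rwa [isOpen_interior.nhdsWithin_eq hx'] at ht
  refine ⟨{y | y ∈ interior t ∧ ¬ (y ∈ interior s → DifferentiableAt ℝ f y)}, ?_, ?_⟩
  · have h1 : interior t ∈ 𝓝 x := interior_mem_nhds.2 ht'
    filter_upwards [mem_nhdsWithin_of_mem_nhds h1, self_mem_nhdsWithin] with y h2 h3
    exact ⟨h2, h3⟩
  · have h1 := hK.ae_differentiableWithinAt_of_mem_real
    rw [ae_iff] at h1
    refine measure_mono_null ?_ h1
    rintro y ⟨hy1, hy2⟩ hy3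
    apply hy2
    intro _
    exact (hy3 (interior_subset hy1)).differentiableAt (mem_interior_iff_mem_nhds.1 hy1)

lemma ae_good {u : ℝ → EReal} (h : u ∈ ConvSet1) : ∀ᵐ x, GoodPt u x := by
  have hc := h.1.convexOn h.2.2.1
  have h1 := ae_diff_of_convexOn hc
  have h2 : ∀ᵐ x, x ∉ frontier {x | u x ≠ ⊤} :=
    measure_eq_zero_iff_ae_notMem.1 (hc.1.addHaar_frontier volume)
  filter_upwards [h1, h2] with x hx1 hx2
  by_cases hx : x ∈ interior {x | u x ≠ ⊤}
  · right
    exact ⟨mem_interior_iff_mem_nhds.1 hx, hx1 hx⟩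
  · left
    have : x ∉ closure {x | u x ≠ ⊤} := fun h => hx2 ⟨h, hx⟩
    rw [mem_closure_iff_frequently, not_frequently] at this
    filter_upwards [this] with y hy
    simpa using hy

/-- The integrand, extended by zero. -/
def FInt (ζ : ℝ → ℝ) (u : ℝ → EReal) (x : ℝ) : ℝ :=
  Set.indicator {x : ℝ | u x ≠ ⊤} (fun x => ζ (deriv (fun y => (u y).toReal) x)) x

lemma FInt_top {ζ : ℝ → ℝ} {u : ℝ → EReal} {x : ℝ} (h : u x = ⊤) : FInt ζ u x = 0 := by
  simp [FInt, h]

lemma FInt_fin {ζ : ℝ → ℝ} {u : ℝ → EReal} {x : ℝ} (h : u x ≠ ⊤) :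
    FInt ζ u x = ζ (deriv (fun y => (u y).toReal) x) := by
  simp [FInt, h]

lemma FInt_congr {ζ : ℝ → ℝ} {u v : ℝ → EReal} {x : ℝ} (h : u =ᶠ[𝓝 x] v) :
    FInt ζ u x = FInt ζ v x := by
  have h1 : u x = v x := h.eq_of_nhds
  by_cases hx : u x = ⊤
  · rw [FInt_top hx, FInt_top (h1 ▸ hx)]
  · rw [FInt_fin hx, FInt_fin (h1 ▸ hx)]
    congr 1
    apply Filter.EventuallyEq.deriv_eq
    filter_upwards [h] with y hy
    rw [hy]

lemma meas_dom {u : ℝ → EReal} (h : u ∈ ConvSet1) : MeasurableSet {x | u x ≠ ⊤} :=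
  (h.1.convexOn h.2.2.1).1.ordConnected.measurableSet

lemma FInt_integral {ζ : ℝ → ℝ} {u : ℝ → EReal} (h : u ∈ ConvSet1) :
    ∫ x in {x : ℝ | u x ≠ ⊤}, ζ (deriv (fun y => (u y).toReal) x) = ∫ x, FInt ζ u x := by
  rw [← integral_indicator (meas_dom h)]
  rfl

lemma FInt_measurable {ζ : ℝ → ℝ} (hζ : Continuous ζ) {u : ℝ → EReal} (h : u ∈ ConvSet1) :
    Measurable (FInt ζ u) := by
  have := (hζ.measurable.comp (measurable_deriv (fun y => (u y).toReal))).indicator (meas_dom h)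
  exact this

lemma chord {u : ℝ → EReal} (h : u ∈ ConvSet1) {x q s r C : ℝ} (hg : GoodPt u x)
    (hx : u x ≠ ⊤) (hq : u q < (C : EReal)) (hs0 : 0 ≤ s) (hs1 : s ≤ 1)
    (hr : (r : EReal) < u (s * q + (1 - s) * x)) :
    r < C + deriv (fun y => (u y).toReal) x * (s * q + (1 - s) * x - q) := by
  have hc := h.1.convexOn h.2.2.1
  have hqt : u q ≠ ⊤ := (hq.trans (EReal.coe_lt_top _)).ne
  have hd : DifferentiableAt ℝ (fun y => (u y).toReal) x := by
    rcases hg with hg | hg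
    · exact absurd hg.self_of_nhds hx
    · exact hg.2
  have h1 := hc.2 (x := q) hqt (y := x) hx hs0 (sub_nonneg.2 hs1) (by ring)
  have hmem : u (s * q + (1 - s) * x) ≠ ⊤ :=
    hc.1 (x := q) hqt (y := x) hx hs0 (sub_nonneg.2 hs1) (by ring)
  simp only [smul_eq_mul] at h1
  have hq' : (u q).toReal < C := by
    have := EReal.coe_toReal hqt (h.2.2.1 q)
    rw [← this] at hq
    exact_mod_cast hq
  have hr' : r < (u (s * q + (1 - s) * x)).toReal := by
    have := EReal.coe_toReal hmem (h.2.2.1 _)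
    rw [← this] at hr
    exact_mod_cast hr
  have ht : (u x).toReal + deriv (fun y => (u y).toReal) x * (q - x) ≤ (u q).toReal := by
    rcases lt_trichotomy x q with hlt | heq | hlt
    · have := hc.deriv_le_slope hx hqt hlt hd
      rw [slope_def_field, le_div_iff₀ (by linarith)] at this
      linarith
    · subst heq; simp
    · have := hc.slope_le_deriv hqt hx hlt hd
      rw [slope_def_field, div_le_iff₀ (by linarith)] at this
      linarith
  nlinarith

lemma EpiConverges1.ev_lt {uk : ℕ → ℝ → EReal} {u : ℝ → EReal} (h : EpiConverges1 uk u)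
    {x : ℝ} {r : EReal} (hr : r < u x) : ∀ᶠ k in atTop, r < uk k x := by
  have := (h x).1 (fun _ => x) tendsto_const_nhds
  exact eventually_lt_of_lt_liminf (hr.trans_le this)

lemma real_lt_abs {M C d L r : ℝ} (hr : C + M * |L| ≤ r) (h : r < C + d * L) :
    M < |d| := by
  have h1 : d * L ≤ |d| * |L| := by rw [← abs_mul]; exact le_abs_self _
  by_contra hcon
  push Not at hcon
  have := mul_le_mul_of_nonneg_right hcon (abs_nonneg L)
  linarith

lemma ev_zero {ζ : ℝ → ℝ} {M : ℝ} (hM : ∀ y, M ≤ |y| → ζ y = 0) (hM0 : 0 ≤ M)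
    {uk : ℕ → ℝ → EReal} {u : ℝ → EReal} (hk : ∀ k, uk k ∈ ConvSet1) (hu : u ∈ ConvSet1)
    (he : EpiConverges1 uk u) {p x₁ : ℝ} (hp : u p ≠ ⊤)
    (hx : (((u p).toReal + 1 + M * (|x₁ - p| + 1) : ℝ) : EReal) < u x₁) :
    ∃ pk : ℕ → ℝ, Tendsto pk atTop (𝓝 p) ∧ ∀ᶠ k in atTop, ∀ x s : ℝ, GoodPt (uk k) x →
      0 ≤ s → s ≤ 1 → x₁ = s * pk k + (1 - s) * x → FInt ζ (uk k) x = 0 := by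
  obtain ⟨pk, hpk, hupk⟩ := (he p).2
  refine ⟨pk, hpk, ?_⟩
  have h1 := he.ev_lt hx
  have h2 : ∀ᶠ k in atTop, uk k (pk k) < (((u p).toReal + 1 : ℝ) : EReal) := by
    apply hupk.eventually_lt_const
    conv_lhs => rw [← EReal.coe_toReal hp (hu.2.2.1 p)]
    exact_mod_cast lt_add_one _
  have h3 : ∀ᶠ k in atTop, |x₁ - pk k| < |x₁ - p| + 1 := by
    have : Tendsto (fun k => |x₁ - pk k|) atTop (𝓝 |x₁ - p|) := (tendsto_const_nhds.sub hpk).abs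
    exact this.eventually_lt_const (lt_add_one _)
  filter_upwards [h1, h2, h3] with k h1 h2 h3 x s hg hs0 hs1 hxs
  by_cases hxt : uk k x = ⊤
  · exact FInt_top hxt
  · rw [FInt_fin hxt]
    apply hM
    rw [hxs] at h1
    have := chord (hk k) hg hxt h2 hs0 hs1 h1
    rw [← hxs] at this
    refine (real_lt_abs ?_ this).le
    nlinarith

lemma dom_bound {ζ : ℝ → ℝ} {M : ℝ} (hM : ∀ y, M ≤ |y| → ζ y = 0) (hM0 : 0 ≤ M)
    {uk : ℕ → ℝ → EReal} {u : ℝ → EReal} (hk : ∀ k, uk k ∈ ConvSet1) (hu : u ∈ ConvSc1)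
    (he : EpiConverges1 uk u) :
    ∃ R : ℝ, ∀ᶠ k in atTop, ∀ x, GoodPt (uk k) x → R ≤ |x| → FInt ζ (uk k) x = 0 := by
  obtain ⟨p, hp⟩ := hu.1.2.2.2
  obtain ⟨R₀, hR₀⟩ := hu.2 (M + 1)
  set A := (u p).toReal with hA
  obtain ⟨T, hT⟩ : ∃ T, R₀ < T ∧ |p| < T ∧ A + 1 + M * |p| + M < T := by
    refine ⟨max R₀ (max |p| (A + 1 + M * |p| + M)) + 1, ?_, ?_, ?_⟩
    · exact (le_max_left _ _).trans_lt (lt_add_one _)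
    · exact ((le_max_left _ _).trans (le_max_right _ _)).trans_lt (lt_add_one _)
    · exact ((le_max_right _ _).trans (le_max_right _ _)).trans_lt (lt_add_one _)
  obtain ⟨hT1, hT2, hT3⟩ := hT
  have hT0 : 0 < T := (abs_nonneg p).trans_lt hT2
  have key : ∀ y, |y| = T → ((A + 1 + M * (|y - p| + 1) : ℝ) : EReal) < u y := by
    intro y hy
    refine lt_of_lt_of_le ?_ (hR₀ y (hy ▸ hT1.le))
    have : |y - p| ≤ T + |p| := hy ▸ abs_sub y p
    have h2 := mul_le_mul_of_nonneg_left this hM0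
    rw [hy]
    exact_mod_cast (by nlinarith)
  obtain ⟨pk, hpk, h1⟩ := ev_zero hM hM0 hk hu.1 he hp (key T (abs_of_pos hT0))
  obtain ⟨qk, hqk, h2⟩ := ev_zero hM hM0 hk hu.1 he hp (key (-T) (by rw [abs_neg, abs_of_pos hT0]))
  have h3 := hpk.eventually_lt_const (lt_of_abs_lt hT2)
  have h4 := hqk.eventually_const_lt (neg_lt_of_abs_lt hT2)
  refine ⟨T, ?_⟩
  filter_upwards [h1, h2, h3, h4] with k h1 h2 h3 h4 x hg hx
  rcases le_abs.1 hx with hx | hx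
  · have : 0 < x - pk k := by linarith
    refine h1 x ((x - T) / (x - pk k)) hg (div_nonneg (by linarith) this.le)
      ((div_le_one this).2 (by linarith)) ?_
    field_simp
    ring
  · have : 0 < qk k - x := by linarith
    refine h2 x ((-T - x) / (qk k - x)) hg (div_nonneg (by linarith) this.le)
      ((div_le_one this).2 (by linarith)) ?_
    field_simp
    ring

lemma ev_slope {uk : ℕ → ℝ → EReal} {u : ℝ → EReal} (hk : ∀ k, uk k ∈ ConvSet1)
    (hu : u ∈ ConvSet1) (he : EpiConverges1 uk u) {x z d ε : ℝ} (hx : u x ≠ ⊤) (hz : u z ≠ ⊤)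
    (hg : ∀ k, GoodPt (uk k) x)
    (h : (u z).toReal < (u x).toReal + d * (z - x) + ε * |z - x|) :
    ∃ zk : ℕ → ℝ, Tendsto zk atTop (𝓝 z) ∧ (∀ᶠ k in atTop, uk k (zk k) ≠ ⊤) ∧
      ∀ᶠ k in atTop, uk k x ≠ ⊤ →
        (deriv (fun y => (uk k y).toReal) x - d) * (zk k - x) < ε * |zk k - x| := by
  obtain ⟨zk, hzk, huzk⟩ := (he z).2
  refine ⟨zk, hzk, ?_, ?_⟩
  · filter_upwards [huzk.eventually_lt_const (lt_top_iff_ne_top.2 hz)] with k hk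
    exact hk.ne
  obtain ⟨η, hη0, hη⟩ : ∃ η : ℝ, 0 < η ∧
      (u z).toReal + η - ((u x).toReal - η) < d * (z - x) + ε * |z - x| := by
    refine ⟨((u x).toReal + d * (z - x) + ε * |z - x| - (u z).toReal) / 4, by linarith, by linarith⟩
  have h1 : ∀ᶠ k in atTop, (((u x).toReal - η : ℝ) : EReal) < uk k x := by
    apply he.ev_lt
    conv_rhs => rw [← EReal.coe_toReal hx (hu.2.2.1 x)]
    exact_mod_cast sub_lt_self _ hη0
  have h2 : ∀ᶠ k in atTop, uk k (zk k) < (((u z).toReal + η : ℝ) : EReal) := by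
    apply huzk.eventually_lt_const
    conv_lhs => rw [← EReal.coe_toReal hz (hu.2.2.1 z)]
    exact_mod_cast lt_add_of_pos_right _ hη0
  have h3 : Tendsto (fun k => d * (zk k - x) + ε * |zk k - x|) atTop
      (𝓝 (d * (z - x) + ε * |z - x|)) :=
    ((hzk.sub_const x).const_mul d).add ((hzk.sub_const x).abs.const_mul ε)
  filter_upwards [h1, h2, h3.eventually_const_lt hη] with k h1 h2 h3 hxk
  have := chord (r := (u x).toReal - η) (hk k) (hg k) hxk h2 (le_refl 0) zero_le_one
    (by rw [zero_mul, sub_zero, one_mul, zero_add]; exact h1)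
  simp only [zero_mul, zero_add, sub_zero, one_mul] at this
  nlinarith

lemma FInt_tendsto {ζ : ℝ → ℝ} (hζ : Continuous ζ) {M : ℝ} (hM : ∀ y, M ≤ |y| → ζ y = 0)
    (hM0 : 0 ≤ M)
    {uk : ℕ → ℝ → EReal} {u : ℝ → EReal} (hk : ∀ k, uk k ∈ ConvSet1) (hu : u ∈ ConvSet1)
    (he : EpiConverges1 uk u) {x : ℝ} (hg : GoodPt u x) (hgk : ∀ k, GoodPt (uk k) x) :
    Tendsto (fun k => FInt ζ (uk k) x) atTop (𝓝 (FInt ζ u x)) := by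
  rcases hg with hg | ⟨hfin, hdiff⟩
  · have hx : u x = ⊤ := hg.self_of_nhds
    obtain ⟨p, hp⟩ := hu.2.2.2
    obtain ⟨pk, hpk, h⟩ := ev_zero hM hM0 hk hu he (x₁ := x) hp
      (by rw [hx]; exact EReal.coe_lt_top _)
    rw [FInt_top hx]
    apply tendsto_const_nhds.congr'
    filter_upwards [h] with k h
    exact (h x 0 (hgk k) le_rfl zero_le_one (by ring)).symm
  · have hx : u x ≠ ⊤ := hfin.self_of_nhds
    set d := deriv (fun y => (u y).toReal) x with hd
    have hloc : ∀ ε > 0, ∀ᶠ z in 𝓝 x, u z ≠ ⊤ ∧ (z ≠ x →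
        (u z).toReal < (u x).toReal + d * (z - x) + ε * |z - x|) := by
      intro ε hε
      have h1 := (hasDerivAt_iff_isLittleO.1 hdiff.hasDerivAt).def (half_pos hε)
      filter_upwards [h1, hfin] with z h1 h2
      refine ⟨h2, fun hne => ?_⟩
      have h3 : 0 < |z - x| := abs_pos.2 (sub_ne_zero.2 hne)
      rw [Real.norm_eq_abs, Real.norm_eq_abs, smul_eq_mul] at h1
      have h4 := le_trans (le_abs_self _) h1
      rw [← hd] at h4
      nlinarith
    have hmain : ∀ ε > 0, ∀ᶠ k in atTop, uk k x ≠ ⊤ ∧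
        |deriv (fun y => (uk k y).toReal) x - d| < ε := by
      intro ε hε
      obtain ⟨z, ⟨hz1, hz2⟩, hz3 : x < z⟩ :=
        (((hloc ε hε).filter_mono nhdsWithin_le_nhds).and
          (self_mem_nhdsWithin (s := Set.Ioi x))).exists
      obtain ⟨w, ⟨hw1, hw2⟩, hw3 : w < x⟩ :=
        (((hloc ε hε).filter_mono nhdsWithin_le_nhds).and
          (self_mem_nhdsWithin (s := Set.Iio x))).exists
      obtain ⟨zk, hzk, hzf, hzs⟩ := ev_slope hk hu he hx hz1 hgk (hz2 hz3.ne')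
      obtain ⟨wk, hwk, hwf, hws⟩ := ev_slope hk hu he hx hw1 hgk (hw2 hw3.ne)
      filter_upwards [hzf, hzs, hwf, hws, hzk.eventually_const_lt hz3,
        hwk.eventually_lt_const hw3] with k h1 h2 h3 h4 h5 h6
      have hxf : uk k x ≠ ⊤ :=
        ((hk k).1.convexOn (hk k).2.2.1).1.ordConnected.out h3 h1 ⟨h6.le, h5.le⟩
      refine ⟨hxf, ?_⟩
      have h2 := h2 hxf
      have h4 := h4 hxf
      rw [abs_of_pos (by linarith)] at h2
      rw [abs_of_neg (by linarith)] at h4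
      rw [abs_lt]
      constructor <;> nlinarith
    rw [FInt_fin hx]
    have h1 : Tendsto (fun k => deriv (fun y => (uk k y).toReal) x) atTop (𝓝 d) := by
      rw [Metric.tendsto_nhds]
      intro ε hε
      filter_upwards [hmain ε hε] with k hk
      rw [Real.dist_eq]; exact hk.2
    apply ((hζ.tendsto d).comp h1).congr'
    filter_upwards [hmain 1 one_pos] with k hk
    exact (FInt_fin hk.1).symm

lemma exists_bounds {ζ : ℝ → ℝ} (hζ : Continuous ζ) (hc : HasCompactSupport ζ) :
    ∃ M B : ℝ, 0 ≤ M ∧ 0 ≤ B ∧ (∀ y, M ≤ |y| → ζ y = 0) ∧ ∀ y, |ζ y| ≤ B := by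
  obtain ⟨B, hB⟩ := hc.exists_bound_of_continuous hζ
  obtain ⟨M, hM⟩ := hc.isCompact.isBounded.exists_norm_le
  refine ⟨max M 0 + 1, B, by positivity, (norm_nonneg _).trans (hB 0), ?_, hB⟩
  intro y hy
  by_contra hne
  have := hM y (subset_tsupport _ hne)
  rw [Real.norm_eq_abs] at this
  have := le_max_left M 0
  linarith

lemma EpiConverges1.const {u : ℝ → EReal} (h : LowerSemicontinuous u) :
    EpiConverges1 (fun _ => u) u := by
  intro x
  refine ⟨fun xk hxk => ?_, fun _ => x, tendsto_const_nhds, tendsto_const_nhds⟩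
  apply le_of_forall_lt
  intro c hc
  obtain ⟨c', h1, h2⟩ := exists_between hc
  refine h1.trans_le (le_liminf_of_le (by isBoundedDefault) ?_)
  filter_upwards [hxk.eventually (h x c' h2)] with k hk
  exact hk.le

lemma FInt_abs_le {ζ : ℝ → ℝ} {B : ℝ} (hB0 : 0 ≤ B) (hB : ∀ y, |ζ y| ≤ B) (u : ℝ → EReal) (x : ℝ) :
    |FInt ζ u x| ≤ B := by
  by_cases h : u x = ⊤
  · rw [FInt_top h]; simpa
  · rw [FInt_fin h]; exact hB _

lemma FInt_dom {ζ : ℝ → ℝ} {B R : ℝ} (hB0 : 0 ≤ B) (hB : ∀ y, |ζ y| ≤ B) {u : ℝ → EReal} {x : ℝ}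
    (h : R ≤ |x| → FInt ζ u x = 0) :
    ‖FInt ζ u x‖ ≤ (Set.Icc (-R) R).indicator (fun _ => B) x := by
  by_cases hx : x ∈ Set.Icc (-R) R
  · rw [Set.indicator_of_mem hx]; exact FInt_abs_le hB0 hB u x
  · rw [Set.indicator_of_notMem hx, h, norm_zero]
    rw [Set.mem_Icc, ← abs_le] at hx
    exact (not_le.1 hx).le

lemma integrable_dom (B R : ℝ) : Integrable ((Set.Icc (-R) R).indicator (fun _ : ℝ => B)) := by
  rw [integrable_indicator_iff measurableSet_Icc]
  exact continuousOn_const.integrableOn_Icc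

lemma FInt_integrable {ζ : ℝ → ℝ} (hζ : Continuous ζ) (hc : HasCompactSupport ζ) {u : ℝ → EReal}
    (hu : u ∈ ConvSc1) : Integrable (FInt ζ u) := by
  obtain ⟨M, B, hM0, hB0, hM, hB⟩ := exists_bounds hζ hc
  obtain ⟨R, hR⟩ := dom_bound hM hM0 (fun _ => hu.1) hu (EpiConverges1.const hu.1.2.1)
  obtain ⟨_, hR⟩ := hR.exists
  refine (integrable_dom B R).mono' (FInt_measurable hζ hu.1).aestronglyMeasurable ?_
  filter_upwards [ae_good hu.1] with x hx
  exact FInt_dom hB0 hB (hR x hx)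

lemma cont_FInt {ζ : ℝ → ℝ} (hζ : Continuous ζ) (hc : HasCompactSupport ζ) :
    ContinuousVal1 ConvSc1 (fun u => ∫ x, FInt ζ u x) := by
  intro uk u hk hu he
  obtain ⟨M, B, hM0, hB0, hM, hB⟩ := exists_bounds hζ hc
  obtain ⟨R, hR⟩ := dom_bound hM hM0 (fun k => (hk k).1) hu he
  have hgk : ∀ᵐ x, ∀ k, GoodPt (uk k) x := ae_all_iff.2 (fun k => ae_good (hk k).1)
  refine tendsto_integral_filter_of_dominated_convergence
    ((Set.Icc (-R) R).indicator (fun _ : ℝ => B)) ?_ ?_ (integrable_dom B R) ?_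
  · exact Eventually.of_forall fun k => (FInt_measurable hζ (hk k).1).aestronglyMeasurable
  · filter_upwards [hR] with k hRk
    filter_upwards [hgk] with x hx
    exact FInt_dom hB0 hB (hRk x (hx k))
  · filter_upwards [ae_good hu.1, hgk] with x h1 h2
    exact FInt_tendsto hζ hM hM0 (fun k => (hk k).1) hu.1 he h1 h2

lemma inv_FInt (ζ : ℝ → ℝ) :
    EpiTranslationInvariant1 ConvSc1 (fun u => ∫ x, FInt ζ u x) := by
  intro u hu x₀ c
  have h1 : ∀ᵐ x, GoodPt u (x - x₀) :=
    (measurePreserving_sub_right volume x₀).quasiMeasurePreserving.ae (ae_good hu.1)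
  have h2 : ∀ x, u x ≠ ⊤ → (u x + (c : EReal)).toReal = (u x).toReal + c := by
    intro x hx
    rw [EReal.toReal_add hx (hu.1.2.2.1 x) (EReal.coe_ne_top _) (EReal.coe_ne_bot _),
      EReal.toReal_coe]
  calc ∫ x, FInt ζ (fun x => u (x - x₀) + (c : EReal)) x = ∫ x, FInt ζ u (x - x₀) := by
        apply integral_congr_ae
        filter_upwards [h1] with x hx
        rcases hx with hx | hx
        · have := hx.self_of_nhds
          rw [FInt_top this, FInt_top (by rw [this]; exact EReal.top_add_coe c)]
        · have hx1 := hx.1.self_of_nhds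
          rw [FInt_fin hx1, FInt_fin (by
            lift u (x - x₀) to ℝ using ⟨hx1, hu.1.2.2.1 _⟩ with p hp
            exact EReal.coe_ne_top (p + c))]
          congr 1
          have ht : Tendsto (fun y => y - x₀) (𝓝 x) (𝓝 (x - x₀)) :=
            (continuous_id.sub continuous_const).tendsto x
          have : (fun y => (u (y - x₀) + (c : EReal)).toReal) =ᶠ[𝓝 x]
              fun y => (u (y - x₀)).toReal + c := by
            filter_upwards [ht.eventually hx.1] with y hy
            exact h2 _ hy
          rw [this.deriv_eq, deriv_add_const]
          exact deriv_comp_sub_const (fun y => (u y).toReal) x₀ x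
    _ = ∫ x, FInt ζ u x := integral_sub_right_eq_self _ _

lemma GoodPt.fin {u : ℝ → EReal} {x : ℝ} (h : GoodPt u x) (hx : u x ≠ ⊤) :
    (∀ᶠ y in 𝓝 x, u y ≠ ⊤) ∧ DifferentiableAt ℝ (fun y => (u y).toReal) x := by
  rcases h with h | h
  · exact absurd h.self_of_nhds hx
  · exact h

lemma deriv_eq_of_le {f g : ℝ → ℝ} {x : ℝ} (hf : DifferentiableAt ℝ f x)
    (hg : DifferentiableAt ℝ g x) (hle : ∀ᶠ y in 𝓝 x, f y ≤ g y) (heq : f x = g x) :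
    deriv f x = deriv g x := by
  have : IsLocalMin (fun y => g y - f y) x := by
    filter_upwards [hle] with y hy
    simp only [heq, sub_self]
    linarith
  have h2 := this.deriv_eq_zero
  rw [deriv_fun_sub hg hf] at h2
  linarith

lemma val_FInt_lt (ζ : ℝ → ℝ) {u v : ℝ → EReal} {x : ℝ} (hub : ∀ x, u x ≠ ⊥) (hvb : ∀ x, v x ≠ ⊥)
    (hu : (∀ᶠ y in 𝓝 x, u y ≠ ⊤) ∧ DifferentiableAt ℝ (fun y => (u y).toReal) x)
    (hv : (∀ᶠ y in 𝓝 x, v y ≠ ⊤) ∧ DifferentiableAt ℝ (fun y => (v y).toReal) x)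
    (hlt : (u x).toReal < (v x).toReal) :
    FInt ζ (u ⊔ v) x + FInt ζ (u ⊓ v) x = FInt ζ u x + FInt ζ v x := by
  have h : ∀ᶠ y in 𝓝 x, u y ≤ v y := by
    filter_upwards [hu.1, hv.1, hu.2.continuousAt.eventually_lt hv.2.continuousAt hlt] with y h1 h2 h3
    rw [← EReal.coe_toReal h1 (hub y), ← EReal.coe_toReal h2 (hvb y)]
    exact_mod_cast h3.le
  have h1 : u ⊔ v =ᶠ[𝓝 x] v := by
    filter_upwards [h] with y hy
    exact sup_eq_right.2 hy
  have h2 : u ⊓ v =ᶠ[𝓝 x] u := by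
    filter_upwards [h] with y hy
    exact inf_eq_left.2 hy
  rw [FInt_congr h1, FInt_congr h2, add_comm]

lemma val_FInt_top (ζ : ℝ → ℝ) {u v : ℝ → EReal} {x : ℝ} (hu : ∀ᶠ y in 𝓝 x, u y = ⊤) :
    FInt ζ (u ⊔ v) x + FInt ζ (u ⊓ v) x = FInt ζ u x + FInt ζ v x := by
  have h1 : u ⊔ v =ᶠ[𝓝 x] u := by
    filter_upwards [hu] with y hy
    rw [Pi.sup_apply, hy]; exact top_sup_eq _
  have h2 : u ⊓ v =ᶠ[𝓝 x] v := by
    filter_upwards [hu] with y hy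
    rw [Pi.inf_apply, hy]; exact top_inf_eq _
  rw [FInt_congr h1, FInt_congr h2]

lemma val_FInt_pt (ζ : ℝ → ℝ) {u v : ℝ → EReal} {x : ℝ} (hub : ∀ x, u x ≠ ⊥) (hvb : ∀ x, v x ≠ ⊥)
    (hu : GoodPt u x) (hv : GoodPt v x) (hs : GoodPt (u ⊔ v) x) (hi : GoodPt (u ⊓ v) x) :
    FInt ζ (u ⊔ v) x + FInt ζ (u ⊓ v) x = FInt ζ u x + FInt ζ v x := by
  rcases hu with hu | hu
  · exact val_FInt_top ζ hu
  rcases hv with hv | hv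
  · rw [sup_comm, inf_comm, val_FInt_top ζ hv, add_comm]
  have hux := hu.1.self_of_nhds
  have hvx := hv.1.self_of_nhds
  have hsx' : ∀ y, u y ≠ ⊤ → v y ≠ ⊤ → (u ⊔ v) y ≠ ⊤ := by
    intro y h1 h2
    rw [Pi.sup_apply]
    rcases max_choice (u y) (v y) with h | h
    · rw [h]; exact h1
    · rw [h]; exact h2
  have hix' : ∀ y, u y ≠ ⊤ → (u ⊓ v) y ≠ ⊤ := by
    intro y h1
    exact ne_top_of_le_ne_top h1 inf_le_left
  have hib : ∀ y, (u ⊓ v) y ≠ ⊥ := by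
    intro y
    rw [Pi.inf_apply]
    rcases min_choice (u y) (v y) with h | h
    · rw [h]; exact hub y
    · rw [h]; exact hvb y
  have hs' := hs.fin (hsx' x hux hvx)
  have hi' := hi.fin (hix' x hux)
  rcases lt_trichotomy (u x).toReal (v x).toReal with hlt | heq | hlt
  · exact val_FInt_lt ζ hub hvb hu hv hlt
  · have hEq : u x = v x := by
      rw [← EReal.coe_toReal hux (hub x), ← EReal.coe_toReal hvx (hvb x), heq]
    rw [FInt_fin (hsx' x hux hvx), FInt_fin (hix' x hux), FInt_fin hux, FInt_fin hvx]
    have e1 : deriv (fun y => (u y).toReal) x = deriv (fun y => ((u ⊔ v) y).toReal) x := by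
      apply deriv_eq_of_le hu.2 hs'.2
      · filter_upwards [hs'.1] with y h1
        exact EReal.toReal_le_toReal le_sup_left (hub y) h1
      · rw [Pi.sup_apply, ← hEq, sup_idem]
    have e2 : deriv (fun y => ((u ⊓ v) y).toReal) x = deriv (fun y => (u y).toReal) x := by
      apply deriv_eq_of_le hi'.2 hu.2
      · filter_upwards [hu.1] with y h1
        exact EReal.toReal_le_toReal inf_le_left (hib y) h1
      · rw [Pi.inf_apply, ← hEq, inf_idem]
    have e3 : deriv (fun y => ((u ⊓ v) y).toReal) x = deriv (fun y => (v y).toReal) x := by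
      apply deriv_eq_of_le hi'.2 hv.2
      · filter_upwards [hv.1] with y h1
        exact EReal.toReal_le_toReal inf_le_right (hib y) h1
      · rw [Pi.inf_apply, ← hEq, inf_idem]
    rw [← e1, e3, add_comm, ← e3, e2]
  · have := val_FInt_lt ζ hvb hub hv hu hlt
    rw [sup_comm, inf_comm, this, add_comm]

lemma val_FInt {ζ : ℝ → ℝ} (hζ : Continuous ζ) (hc : HasCompactSupport ζ) :
    IsValuation1 ConvSc1 (fun u => ∫ x, FInt ζ u x) := by
  intro u v hu hv hs hi
  simp only
  rw [← integral_add (FInt_integrable hζ hc hs) (FInt_integrable hζ hc hi),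
    ← integral_add (FInt_integrable hζ hc hu) (FInt_integrable hζ hc hv)]
  apply integral_congr_ae
  filter_upwards [ae_good hu.1, ae_good hv.1, ae_good hs.1, ae_good hi.1] with x h1 h2 h3 h4
  exact val_FInt_pt ζ hu.1.2.2.1 hv.1.2.2.1 h1 h2 h3 h4

/-! ### Functions with compact interval domain -/

/-- The restriction of `f` to `[a, b]`, extended by `⊤`. -/
def TR (f : ℝ → ℝ) (a b : ℝ) : ℝ → EReal :=
  fun x => if a ≤ x ∧ x ≤ b then (f x : EReal) else ⊤

lemma TR_in {f : ℝ → ℝ} {a b x : ℝ} (h1 : a ≤ x) (h2 : x ≤ b) : TR f a b x = (f x : EReal) :=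
  if_pos ⟨h1, h2⟩

lemma TR_out {f : ℝ → ℝ} {a b x : ℝ} (h : ¬ (a ≤ x ∧ x ≤ b)) : TR f a b x = ⊤ := if_neg h

lemma TR_ge (f : ℝ → ℝ) (a b x : ℝ) : (f x : EReal) ≤ TR f a b x := by
  by_cases h : a ≤ x ∧ x ≤ b
  · rw [TR_in h.1 h.2]
  · rw [TR_out h]; exact le_top

lemma TR_ne_bot (f : ℝ → ℝ) (a b x : ℝ) : TR f a b x ≠ ⊥ :=
  ne_bot_of_le_ne_bot (EReal.coe_ne_bot _) (TR_ge f a b x)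

lemma ereal_top_of {x y : EReal} {t : ℝ} (ht0 : 0 < t) (ht1 : t < 1) (hx : x ≠ ⊥) (hy : y ≠ ⊥)
    (h : x = ⊤ ∨ y = ⊤) : (t : EReal) * x + ((1 - t : ℝ) : EReal) * y = ⊤ := by
  have ht2 : 0 < 1 - t := by linarith
  rcases h with rfl | rfl
  · rw [EReal.coe_mul_top_of_pos ht0]
    apply EReal.top_add_of_ne_bot
    induction y with
    | bot => exact absurd rfl hy
    | coe y => rw [← EReal.coe_mul]; exact EReal.coe_ne_bot _
    | top => rw [EReal.coe_mul_top_of_pos ht2]; exact bot_ne_top.symm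
  · rw [EReal.coe_mul_top_of_pos ht2]
    apply EReal.add_top_of_ne_bot
    induction x with
    | bot => exact absurd rfl hx
    | coe y => rw [← EReal.coe_mul]; exact EReal.coe_ne_bot _
    | top => rw [EReal.coe_mul_top_of_pos ht0]; exact bot_ne_top.symm

lemma TR_mem {f : ℝ → ℝ} (hf : ConvexOn ℝ Set.univ f) (hc : Continuous f) {a b : ℝ} (hab : a ≤ b) :
    TR f a b ∈ ConvSc1 := by
  refine ⟨⟨?_, ?_, TR_ne_bot f a b, a, ?_⟩, ?_⟩
  · intro x y t ht0 ht1
    by_cases hx : a ≤ x ∧ x ≤ b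
    · by_cases hy : a ≤ y ∧ y ≤ b
      · rw [TR_in hx.1 hx.2, TR_in hy.1 hy.2, TR_in (by nlinarith) (by nlinarith)]
        have := hf.2 (Set.mem_univ x) (Set.mem_univ y) ht0.le (sub_nonneg.2 ht1.le) (by ring)
        simp only [smul_eq_mul] at this
        exact_mod_cast this
      · rw [ereal_top_of ht0 ht1 (TR_ne_bot f a b _) (TR_ne_bot f a b _) (Or.inr (TR_out hy))]
        exact le_top
    · rw [ereal_top_of ht0 ht1 (TR_ne_bot f a b _) (TR_ne_bot f a b _) (Or.inl (TR_out hx))]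
      exact le_top
  · intro x c hcx
    by_cases hx : a ≤ x ∧ x ≤ b
    · rw [TR_in hx.1 hx.2] at hcx
      have h1 : Tendsto (fun y => (f y : EReal)) (𝓝 x) (𝓝 (f x : EReal)) :=
        (continuous_coe_real_ereal.comp hc).tendsto x
      filter_upwards [h1.eventually_const_lt hcx] with y hy
      exact hy.trans_le (TR_ge f a b y)
    · rw [TR_out hx] at hcx
      have : IsOpen (Set.Icc a b)ᶜ := isClosed_Icc.isOpen_compl
      filter_upwards [this.mem_nhds hx] with y hy
      rw [TR_out hy]; exact hcx
  · rw [TR_in le_rfl hab]; exact EReal.coe_ne_top _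
  · intro M
    refine ⟨max |a| |b| + 1, fun x hx => ?_⟩
    rw [TR_out]
    · exact le_top
    · rintro ⟨h1, h2⟩
      have := abs_le_max_abs_abs h1 h2
      linarith

lemma TR_inf {f : ℝ → ℝ} {a b c : ℝ} (h1 : a ≤ c) (h2 : c ≤ b) :
    TR f a c ⊓ TR f c b = TR f a b := by
  ext x
  rw [Pi.inf_apply]
  by_cases hx1 : a ≤ x ∧ x ≤ c
  · rw [TR_in hx1.1 hx1.2, TR_in hx1.1 (hx1.2.trans h2)]
    exact inf_eq_left.2 (TR_ge _ _ _ _)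
  · rw [TR_out hx1, top_inf_eq]
    by_cases hx2 : c ≤ x ∧ x ≤ b
    · rw [TR_in hx2.1 hx2.2, TR_in (h1.trans hx2.1) hx2.2]
    · rw [TR_out hx2, TR_out]
      rintro ⟨h3, h4⟩
      rcases le_total x c with h | h
      · exact hx1 ⟨h3, h⟩
      · exact hx2 ⟨h, h4⟩

lemma TR_sup {f : ℝ → ℝ} {a b c : ℝ} (h1 : a ≤ c) (h2 : c ≤ b) :
    TR f a c ⊔ TR f c b = TR f c c := by
  ext x
  rw [Pi.sup_apply]
  by_cases hx : x = c
  · subst hx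
    rw [TR_in h1 le_rfl, TR_in le_rfl h2, TR_in le_rfl le_rfl, sup_idem]
  · rw [TR_out (a := c) (b := c) (fun h => hx (le_antisymm h.2 h.1))]
    by_cases h : x ≤ c
    · rw [TR_out (a := c) (b := b) (fun h' => hx (le_antisymm h h'.1)), sup_top_eq]
    · rw [TR_out (a := a) (b := c) (fun h' => h h'.2), top_sup_eq]

lemma TR_congr {f g : ℝ → ℝ} {a b : ℝ} (h : ∀ x, a ≤ x → x ≤ b → f x = g x) :
    TR f a b = TR g a b := by
  ext x
  by_cases hx : a ≤ x ∧ x ≤ b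
  · rw [TR_in hx.1 hx.2, TR_in hx.1 hx.2, h x hx.1 hx.2]
  · rw [TR_out hx, TR_out hx]

/-- Affine functions. -/
def aff (α β : ℝ) : ℝ → ℝ := fun x => α * x + β

lemma aff_convex (α β : ℝ) : ConvexOn ℝ Set.univ (aff α β) := by
  refine ⟨convex_univ, fun x _ y _ a b _ _ hab => ?_⟩
  simp only [aff, smul_eq_mul]
  have : b = 1 - a := by linarith
  subst this
  apply le_of_eq; ring

lemma aff_cont (α β : ℝ) : Continuous (aff α β) := by unfold aff; fun_prop

lemma TR_aff_shift (α β a b x₀ c : ℝ) :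
    (fun x => TR (aff α β) a b (x - x₀) + (c : EReal)) =
      TR (aff α (β - α * x₀ + c)) (a + x₀) (b + x₀) := by
  ext x
  by_cases hx : a ≤ x - x₀ ∧ x - x₀ ≤ b
  · rw [TR_in hx.1 hx.2, TR_in (by linarith [hx.1]) (by linarith [hx.2])]
    rw [← EReal.coe_add]
    congr 1
    simp only [aff]; ring
  · rw [TR_out hx, TR_out (fun h => hx ⟨by linarith [h.1], by linarith [h.2]⟩)]
    exact EReal.top_add_coe c

section Vals

variable {Z : (ℝ → EReal) → ℝ}

lemma Z_shift (hinv : EpiTranslationInvariant1 ConvSc1 Z) (α β β' a b x₀ : ℝ) (hab : a ≤ b) :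
    Z (TR (aff α β') (a + x₀) (b + x₀)) = Z (TR (aff α β) a b) := by
  rw [← hinv _ (TR_mem (aff_convex α β) (aff_cont α β) hab) x₀ (β' - β + α * x₀), TR_aff_shift]
  congr 3
  ring

lemma Z_pt (hinv : EpiTranslationInvariant1 ConvSc1 Z) (f : ℝ → ℝ) (c : ℝ) :
    Z (TR f c c) = Z (TR (aff 0 0) 0 0) := by
  have : TR f c c = TR (aff 0 (f c)) (0 + c) (0 + c) := by
    rw [zero_add]
    apply TR_congr
    intro x h1 h2
    rw [le_antisymm h2 h1]; simp [aff]
  rw [this, Z_shift hinv 0 0 (f c) 0 0 c le_rfl]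

lemma pt_indep (α β : ℝ) (hinv : EpiTranslationInvariant1 ConvSc1 Z) :
    Z (TR (aff α β) 0 0) = Z (TR (aff 0 0) 0 0) := Z_pt hinv _ _

lemma Z_cut (hval : IsValuation1 ConvSc1 Z) (hinv : EpiTranslationInvariant1 ConvSc1 Z)
    {f : ℝ → ℝ} (hf : ConvexOn ℝ Set.univ f) (hc : Continuous f) {a b c : ℝ}
    (h1 : a ≤ c) (h2 : c ≤ b) :
    Z (TR f a b) + Z (TR (aff 0 0) 0 0) = Z (TR f a c) + Z (TR f c b) := by
  have := hval (TR f a c) (TR f c b) (TR_mem hf hc h1) (TR_mem hf hc h2)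
    (by rw [TR_sup h1 h2]; exact TR_mem hf hc le_rfl)
    (by rw [TR_inf h1 h2]; exact TR_mem hf hc (h1.trans h2))
  rw [TR_sup h1 h2, TR_inf h1 h2, Z_pt hinv] at this
  linarith

end Vals

lemma epi_aff {αk ℓk : ℕ → ℝ} {α ℓ : ℝ} (hα : Tendsto αk atTop (𝓝 α))
    (hℓ : Tendsto ℓk atTop (𝓝 ℓ)) (hk0 : ∀ k, 0 ≤ ℓk k) :
    EpiConverges1 (fun k => TR (aff (αk k) 0) 0 (ℓk k)) (TR (aff α 0) 0 ℓ) := by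
  intro x
  have hout : ¬ (0 ≤ x ∧ x ≤ ℓ) → ∀ xk : ℕ → ℝ, Tendsto xk atTop (𝓝 x) →
      ∀ᶠ k in atTop, TR (aff (αk k) 0) 0 (ℓk k) (xk k) = ⊤ := by
    intro hx xk hxk
    rcases not_and_or.1 hx with h | h
    · filter_upwards [hxk.eventually_lt_const (not_le.1 h)] with k hk
      exact TR_out (fun h' => absurd h'.1 (not_le.2 hk))
    · filter_upwards [hℓ.eventually_lt hxk (not_le.1 h)] with k hk
      exact TR_out (fun h' => absurd h'.2 (not_le.2 hk))
  have haff : ∀ xk : ℕ → ℝ, Tendsto xk atTop (𝓝 x) →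
      Tendsto (fun k => ((aff (αk k) 0 (xk k) : ℝ) : EReal)) atTop (𝓝 ((aff α 0 x : ℝ) : EReal)) := by
    intro xk hxk
    apply (continuous_coe_real_ereal.tendsto _).comp
    exact (hα.mul hxk).add_const 0
  constructor
  · intro xk hxk
    by_cases hx : 0 ≤ x ∧ x ≤ ℓ
    · rw [TR_in hx.1 hx.2, ← (haff xk hxk).liminf_eq]
      exact liminf_le_liminf (Eventually.of_forall fun k => TR_ge _ _ _ _)
    · have : Tendsto (fun k => TR (aff (αk k) 0) 0 (ℓk k) (xk k)) atTop (𝓝 ⊤) :=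
        tendsto_const_nhds.congr' (by filter_upwards [hout hx xk hxk] with k hk; exact hk.symm)
      rw [this.liminf_eq]
      exact le_top
  · by_cases hx : 0 ≤ x ∧ x ≤ ℓ
    · have hm : Tendsto (fun k => min x (ℓk k)) atTop (𝓝 x) := by
        have := (tendsto_const_nhds (x := x)).min hℓ
        rwa [min_eq_left hx.2] at this
      refine ⟨fun k => min x (ℓk k), hm, ?_⟩
      rw [TR_in hx.1 hx.2]
      apply (haff _ hm).congr
      intro k
      exact (TR_in (le_min hx.1 (hk0 k)) (min_le_right _ _)).symm
    · refine ⟨fun _ => x, tendsto_const_nhds, ?_⟩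
      rw [TR_out hx]
      exact tendsto_const_nhds.congr'
        (by filter_upwards [hout hx _ tendsto_const_nhds] with k hk; exact hk.symm)

lemma epi_pt {V : ℕ → ℝ → EReal} (h0 : ∀ k, V k 0 = 0)
    (hV : ∀ (k : ℕ) (x : ℝ), (((k : ℝ) * |x| : ℝ) : EReal) ≤ V k x) :
    EpiConverges1 V (TR (aff 0 0) 0 0) := by
  intro x
  by_cases hx : x = 0
  · subst hx
    have h : TR (aff 0 0) 0 0 0 = 0 := by rw [TR_in le_rfl le_rfl]; simp [aff]
    rw [h]
    refine ⟨fun xk hxk => ?_, fun _ => 0, tendsto_const_nhds, by simp [h0]⟩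
    apply le_liminf_of_le (by isBoundedDefault)
    filter_upwards with k
    refine le_trans ?_ (hV k (xk k))
    exact_mod_cast (by positivity)
  · have h : TR (aff 0 0) 0 0 x = ⊤ := TR_out (fun h => hx (le_antisymm h.2 h.1))
    have key : ∀ xk : ℕ → ℝ, Tendsto xk atTop (𝓝 x) → Tendsto (fun k => V k (xk k)) atTop (𝓝 ⊤) := by
      intro xk hxk
      have h1 : Tendsto (fun k : ℕ => (k : ℝ) * |xk k|) atTop atTop :=
        tendsto_natCast_atTop_atTop.atTop_mul_pos (abs_pos.2 hx) hxk.abs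
      have h2 : Tendsto (fun k : ℕ => (((k : ℝ) * |xk k| : ℝ) : EReal)) atTop (𝓝 ⊤) :=
        EReal.tendsto_coe_nhds_top_iff.2 h1
      exact tendsto_of_tendsto_of_tendsto_of_le_of_le h2 tendsto_const_nhds
        (fun k => hV k (xk k)) (fun k => le_top)
    rw [h]
    refine ⟨fun xk hxk => ?_, fun _ => x, tendsto_const_nhds, key _ tendsto_const_nhds⟩
    rw [(key xk hxk).liminf_eq]

lemma Z_lin {Z : (ℝ → EReal) → ℝ} (hcont : ContinuousVal1 ConvSc1 Z)
    (hval : IsValuation1 ConvSc1 Z) (hinv : EpiTranslationInvariant1 ConvSc1 Z) (α : ℝ) {ℓ : ℝ}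
    (hℓ : 0 ≤ ℓ) :
    Z (TR (aff α 0) 0 ℓ) = Z (TR (aff 0 0) 0 0) +
      ℓ * (Z (TR (aff α 0) 0 1) - Z (TR (aff 0 0) 0 0)) := by
  set g : ℝ → ℝ := fun ℓ => Z (TR (aff α 0) 0 ℓ) - Z (TR (aff 0 0) 0 0) with hg
  have gadd : ∀ a b, 0 ≤ a → 0 ≤ b → g (a + b) = g a + g b := by
    intro a b ha hb
    have h1 := Z_cut hval hinv (aff_convex α 0) (aff_cont α 0) ha (le_add_of_nonneg_right hb)
    have h2 := Z_shift hinv α 0 0 0 b a hb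
    rw [zero_add, add_comm b a] at h2
    simp only [hg]
    linarith
  have g0 : g 0 = 0 := by have := gadd 0 0 le_rfl le_rfl; rw [add_zero] at this; linarith
  have gcont : Continuous (fun x => g (max x 0)) := by
    rw [continuous_iff_seqContinuous]
    intro xk x hx
    have h1 : Tendsto (fun k => max (xk k) 0) atTop (𝓝 (max x 0)) := hx.max tendsto_const_nhds
    have := hcont _ _ (fun k => TR_mem (aff_convex α 0) (aff_cont α 0) (le_max_right (xk k) 0))
      (TR_mem (aff_convex α 0) (aff_cont α 0) (le_max_right x 0))
      (epi_aff tendsto_const_nhds h1 (fun k => le_max_right _ _))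
    exact this.sub_const _
  set h : ℝ → ℝ := fun x => g (max x 0) - g (max (-x) 0) with hh
  have hsub : ∀ p q, 0 ≤ p → 0 ≤ q → h (p - q) = g p - g q := by
    intro p q hp hq
    have h1 := gadd (max (p - q) 0) q (le_max_right _ _) hq
    have h2 := gadd (max (-(p - q)) 0) p (le_max_right _ _) hp
    have h3 : max (p - q) 0 + q = max (-(p - q)) 0 + p := by
      rcases le_total p q with h | h
      · rw [max_eq_right (by linarith), max_eq_left (by linarith)]; ring
      · rw [max_eq_left (by linarith), max_eq_right (by linarith)]; ring
    rw [h3] at h1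
    simp only [hh]
    linarith
  have hadd : ∀ x y, h (x + y) = h x + h y := by
    intro x y
    have e : ∀ x : ℝ, x = max x 0 - max (-x) 0 := by
      intro x
      rcases le_total x 0 with h | h
      · rw [max_eq_right h, max_eq_left (by linarith)]; ring
      · rw [max_eq_left h, max_eq_right (by linarith)]; ring
    have e2 : x + y = (max x 0 + max y 0) - (max (-x) 0 + max (-y) 0) := by
      have := e x; have := e y; linarith
    rw [e2, hsub _ _ (by positivity) (by positivity), gadd _ _ (le_max_right _ _) (le_max_right _ _),
      gadd _ _ (le_max_right _ _) (le_max_right _ _)]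
    simp only [hh]; ring
  have hcontH : Continuous h := gcont.sub (gcont.comp continuous_neg)
  have hlin := map_real_smul (AddMonoidHom.mk' h hadd) hcontH ℓ 1
  have hpos : ∀ x, 0 ≤ x → h x = g x := by
    intro x hx
    have := hsub x 0 hx le_rfl
    rwa [sub_zero, g0, sub_zero] at this
  simp only [smul_eq_mul, mul_one, AddMonoidHom.mk'_apply] at hlin
  rw [hpos ℓ hℓ, hpos 1 zero_le_one] at hlin
  simp only [hg] at hlin
  linarith

lemma Z_aff {Z : (ℝ → EReal) → ℝ} (hcont : ContinuousVal1 ConvSc1 Z)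
    (hval : IsValuation1 ConvSc1 Z) (hinv : EpiTranslationInvariant1 ConvSc1 Z) (α β : ℝ) {a b : ℝ}
    (hab : a ≤ b) :
    Z (TR (aff α β) a b) = Z (TR (aff 0 0) 0 0) +
      (b - a) * (Z (TR (aff α 0) 0 1) - Z (TR (aff 0 0) 0 0)) := by
  rw [← Z_lin hcont hval hinv α (sub_nonneg.2 hab)]
  have := Z_shift hinv α 0 β 0 (b - a) a (sub_nonneg.2 hab)
  rwa [zero_add, sub_add_cancel] at this

lemma zeta_cont {Z : (ℝ → EReal) → ℝ} (hcont : ContinuousVal1 ConvSc1 Z) :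
    Continuous (fun α => Z (TR (aff α 0) 0 1) - Z (TR (aff 0 0) 0 0)) := by
  rw [continuous_iff_seqContinuous]
  intro xk x hx
  have := hcont _ _ (fun k => TR_mem (aff_convex (xk k) 0) (aff_cont (xk k) 0) zero_le_one)
    (TR_mem (aff_convex x 0) (aff_cont x 0) zero_le_one)
    (epi_aff hx tendsto_const_nhds (fun k => zero_le_one))
  exact this.sub_const _

lemma zeta_supp {Z : (ℝ → EReal) → ℝ} (hcont : ContinuousVal1 ConvSc1 Z)
    (hval : IsValuation1 ConvSc1 Z) (hinv : EpiTranslationInvariant1 ConvSc1 Z) :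
    HasCompactSupport (fun α => Z (TR (aff α 0) 0 1) - Z (TR (aff 0 0) 0 0)) := by
  set ζ : ℝ → ℝ := fun α => Z (TR (aff α 0) 0 1) - Z (TR (aff 0 0) 0 0) with hζ
  have hex : ∃ n : ℕ, ∀ α, (n : ℝ) ≤ |α| → ζ α = 0 := by
    by_contra hcon
    push Not at hcon
    choose α hα hne using hcon
    have hl : ∀ k, 0 ≤ |ζ (α k)|⁻¹ := fun k => by positivity
    set V : ℕ → ℝ → EReal := fun k => if 0 ≤ α k then TR (aff (α k) 0) 0 |ζ (α k)|⁻¹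
      else TR (aff (α k) 0) (-|ζ (α k)|⁻¹) 0 with hV
    have hmem : ∀ k, V k ∈ ConvSc1 := by
      intro k
      simp only [hV]
      split_ifs
      · exact TR_mem (aff_convex _ _) (aff_cont _ _) (hl k)
      · exact TR_mem (aff_convex _ _) (aff_cont _ _) (neg_nonpos.2 (hl k))
    have hZ : ∀ k, Z (V k) - Z (TR (aff 0 0) 0 0) = |ζ (α k)|⁻¹ * ζ (α k) := by
      intro k
      simp only [hV]
      split_ifs
      · rw [Z_aff hcont hval hinv _ _ (hl k)]; ring
      · rw [Z_aff hcont hval hinv _ _ (neg_nonpos.2 (hl k))]; ring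
    have h0 : ∀ k, V k 0 = 0 := by
      intro k
      simp only [hV]
      split_ifs
      · rw [TR_in le_rfl (hl k)]; simp [aff]
      · rw [TR_in (neg_nonpos.2 (hl k)) le_rfl]; simp [aff]
    have hge : ∀ (k : ℕ) (x : ℝ), (((k : ℝ) * |x| : ℝ) : EReal) ≤ V k x := by
      intro k x
      have h1 : (k : ℝ) * |x| ≤ |α k| * |x| := mul_le_mul_of_nonneg_right (hα k) (abs_nonneg x)
      simp only [hV]
      split_ifs with hs
      · by_cases hx : 0 ≤ x ∧ x ≤ |ζ (α k)|⁻¹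
        · rw [TR_in hx.1 hx.2]
          rw [abs_of_nonneg hs, abs_of_nonneg hx.1] at h1
          rw [abs_of_nonneg hx.1]
          simp only [aff, add_zero]
          exact_mod_cast h1
        · rw [TR_out hx]; exact le_top
      · by_cases hx : -|ζ (α k)|⁻¹ ≤ x ∧ x ≤ 0
        · rw [TR_in hx.1 hx.2]
          rw [abs_of_neg (not_le.1 hs), abs_of_nonpos hx.2] at h1
          rw [abs_of_nonpos hx.2]
          simp only [aff, add_zero]
          have h2 : (k : ℝ) * -x ≤ α k * x := by linarith
          exact_mod_cast h2
        · rw [TR_out hx]; exact le_top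
    have ht := hcont V _ hmem (TR_mem (aff_convex 0 0) (aff_cont 0 0) le_rfl) (epi_pt h0 hge)
    have ht2 := (ht.sub_const (Z (TR (aff 0 0) 0 0))).abs
    rw [sub_self, abs_zero] at ht2
    have ht3 : Tendsto (fun _ : ℕ => (1 : ℝ)) atTop (𝓝 0) := by
      refine ht2.congr (fun k => ?_)
      rw [hZ k, abs_mul, abs_inv, abs_abs, inv_mul_cancel₀ (abs_ne_zero.2 (hne k))]
    exact one_ne_zero (tendsto_nhds_unique tendsto_const_nhds ht3)
  obtain ⟨n, hn⟩ := hex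
  apply HasCompactSupport.intro (isCompact_Icc (a := -(n : ℝ)) (b := n))
  intro x hx
  apply hn
  rw [Set.mem_Icc, ← abs_le] at hx
  exact (not_le.1 hx).le

lemma FInt_aff (ζ : ℝ → ℝ) (α β : ℝ) {a b : ℝ} (hab : a ≤ b) :
    ∫ x, FInt ζ (TR (aff α β) a b) x = (b - a) * ζ α := by
  have h : ∫ x, FInt ζ (TR (aff α β) a b) x = ∫ x, (Set.Icc a b).indicator (fun _ => ζ α) x := by
    apply integral_congr_ae
    have ha : ∀ᵐ x : ℝ, x ≠ a := by simp [ae_iff]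
    have hb : ∀ᵐ x : ℝ, x ≠ b := by simp [ae_iff]
    filter_upwards [ha, hb] with x ha hb
    by_cases hx : x ∈ Set.Icc a b
    · rw [Set.indicator_of_mem hx, FInt_fin (by rw [TR_in hx.1 hx.2]; exact EReal.coe_ne_top _)]
      congr 1
      have : (fun y => (TR (aff α β) a b y).toReal) =ᶠ[𝓝 x] aff α β := by
        have hx' : x ∈ Set.Ioo a b := ⟨lt_of_le_of_ne hx.1 ha.symm, lt_of_le_of_ne hx.2 hb⟩
        filter_upwards [Ioo_mem_nhds hx'.1 hx'.2] with y hy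
        rw [TR_in hy.1.le hy.2.le, EReal.toReal_coe]
      rw [this.deriv_eq]
      have : HasDerivAt (aff α β) (α * 1) x := ((hasDerivAt_id x).const_mul α).add_const β
      rw [this.deriv, mul_one]
    · rw [Set.indicator_of_notMem hx, FInt_top (TR_out hx)]
  rw [h, integral_indicator measurableSet_Icc, setIntegral_const]
  simp [hab]

/-! ### Maxima of affine functions -/

lemma D_max {D : (ℝ → EReal) → ℝ} (hval : IsValuation1 ConvSc1 D)
    (hinv : EpiTranslationInvariant1 ConvSc1 D)
    (haff : ∀ α β a b, a ≤ b → D (TR (aff α β) a b) = 0)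
    {f : ℝ → ℝ} (hf : ConvexOn ℝ Set.univ f) (hfc : Continuous f)
    (hD : ∀ a b, a ≤ b → D (TR f a b) = 0) (α β : ℝ) (a b : ℝ) (hab : a ≤ b) :
    D (TR (f ⊔ aff α β) a b) = 0 := by
  have hgx : ConvexOn ℝ Set.univ (f ⊔ aff α β) := hf.sup (aff_convex α β)
  have hgc : Continuous (f ⊔ aff α β) := hfc.sup (aff_cont α β)
  have hpt : D (TR (aff 0 0) 0 0) = 0 := haff 0 0 0 0 le_rfl
  set C : Set ℝ := {x | x ∈ Set.Icc a b ∧ f x ≤ aff α β x} with hC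
  have hCc : IsCompact C :=
    isCompact_Icc.inter_right (isClosed_le hfc (aff_cont α β))
  -- pieces where `f` dominates
  have hp1 : ∀ c d, c ≤ d → (∀ x, c ≤ x → x ≤ d → aff α β x ≤ f x) →
      D (TR (f ⊔ aff α β) c d) = 0 := by
    intro c d hcd h
    rw [TR_congr (g := f) (fun x h1 h2 => by rw [Pi.sup_apply]; exact sup_eq_left.2 (h x h1 h2))]
    exact hD c d hcd
  have hp2 : ∀ c d, c ≤ d → (∀ x, c ≤ x → x ≤ d → f x ≤ aff α β x) →
      D (TR (f ⊔ aff α β) c d) = 0 := by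
    intro c d hcd h
    rw [TR_congr (g := aff α β)
      (fun x h1 h2 => by rw [Pi.sup_apply]; exact sup_eq_right.2 (h x h1 h2))]
    exact haff α β c d hcd
  rcases C.eq_empty_or_nonempty with hE | hne
  · apply hp1 a b hab
    intro x h1 h2
    by_contra hcon
    have : x ∈ C := ⟨⟨h1, h2⟩, (not_le.1 hcon).le⟩
    rw [hE] at this
    exact this
  obtain ⟨c, hcC, hcmin⟩ := hCc.exists_isLeast hne
  obtain ⟨d, hdC, hdmax⟩ := hCc.exists_isGreatest hne
  have hcd : c ≤ d := hcmin hdC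
  have hlc : ∀ x, a ≤ x → x < c → aff α β x < f x := by
    intro x h1 h2
    by_contra hcon
    exact absurd (hcmin (show x ∈ C from ⟨⟨h1, h2.le.trans hcC.1.2⟩, not_lt.1 hcon⟩)) (not_le.2 h2)
  have hrd : ∀ x, d < x → x ≤ b → aff α β x < f x := by
    intro x h1 h2
    by_contra hcon
    exact absurd (hdmax (show x ∈ C from ⟨⟨hdC.1.1.trans h1.le, h2⟩, not_lt.1 hcon⟩)) (not_le.2 h1)
  have hclosed : IsClosed {x | aff α β x ≤ f x} := isClosed_le (aff_cont α β) hfc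
  have hL : D (TR (f ⊔ aff α β) a c) = 0 := by
    rcases hcC.1.1.eq_or_lt with h | h
    · rw [← h, Z_pt hinv]; exact hpt
    · apply hp1 a c h.le
      have : Set.Icc a c ⊆ {x | aff α β x ≤ f x} := by
        rw [← closure_Ico h.ne]
        exact hclosed.closure_subset_iff.2 (fun x hx => (hlc x hx.1 hx.2).le)
      exact fun x h1 h2 => this ⟨h1, h2⟩
  have hR : D (TR (f ⊔ aff α β) d b) = 0 := by
    rcases hdC.1.2.eq_or_lt with h | h
    · rw [← h, Z_pt hinv]; exact hpt
    · apply hp1 d b h.le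
      have : Set.Icc d b ⊆ {x | aff α β x ≤ f x} := by
        rw [← closure_Ioc h.ne]
        exact hclosed.closure_subset_iff.2 (fun x hx => (hrd x hx.1 hx.2).le)
      exact fun x h1 h2 => this ⟨h1, h2⟩
  have hMid : D (TR (f ⊔ aff α β) c d) = 0 := by
    apply hp2 c d hcd
    intro x h1 h2
    rcases hcd.eq_or_lt with h | h
    · have : x = c := le_antisymm (h ▸ h2) h1
      rw [this]; exact hcC.2
    · have hdc : 0 < d - c := sub_pos.2 h
      have := hf.2 (Set.mem_univ c) (Set.mem_univ d)
        (div_nonneg (sub_nonneg.2 h2) hdc.le) (div_nonneg (sub_nonneg.2 h1) hdc.le)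
        (by field_simp; ring)
      simp only [smul_eq_mul] at this
      have hx : (d - x) / (d - c) * c + (x - c) / (d - c) * d = x := by field_simp; ring
      rw [hx] at this
      refine this.trans ?_
      have e1 := mul_le_mul_of_nonneg_left hcC.2 (div_nonneg (sub_nonneg.2 h2) hdc.le)
      have e2 := mul_le_mul_of_nonneg_left hdC.2 (div_nonneg (sub_nonneg.2 h1) hdc.le)
      refine (add_le_add e1 e2).trans (le_of_eq ?_)
      simp only [aff]
      field_simp
      ring
  have k1 := Z_cut hval hinv hgx hgc hcC.1.1 hcC.1.2
  have k2 := Z_cut hval hinv hgx hgc hcd hdC.1.2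
  linarith

/-- Running maximum. -/
def runMax (α β : ℕ → ℝ) : ℕ → ℝ → ℝ
  | 0 => aff (α 0) (β 0)
  | n + 1 => runMax α β n ⊔ aff (α (n + 1)) (β (n + 1))

lemma runMax_convex (α β : ℕ → ℝ) (n : ℕ) :
    ConvexOn ℝ Set.univ (runMax α β n) ∧ Continuous (runMax α β n) := by
  induction n with
  | zero => exact ⟨aff_convex _ _, aff_cont _ _⟩
  | succ n ih => exact ⟨ih.1.sup (aff_convex _ _), ih.2.sup (aff_cont _ _)⟩

lemma D_runMax {D : (ℝ → EReal) → ℝ} (hval : IsValuation1 ConvSc1 D)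
    (hinv : EpiTranslationInvariant1 ConvSc1 D)
    (haff : ∀ α β a b, a ≤ b → D (TR (aff α β) a b) = 0) (α β : ℕ → ℝ) (n : ℕ) :
    ∀ a b, a ≤ b → D (TR (runMax α β n) a b) = 0 := by
  induction n with
  | zero => exact fun a b hab => haff _ _ a b hab
  | succ n ih =>
    intro a b hab
    exact D_max hval hinv haff (runMax_convex α β n).1 (runMax_convex α β n).2 ih _ _ a b hab

lemma runMax_ge (α β : ℕ → ℝ) {i n : ℕ} (h : i ≤ n) (x : ℝ) :
    aff (α i) (β i) x ≤ runMax α β n x := by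
  induction n with
  | zero => rw [Nat.le_zero.1 h]; exact le_rfl
  | succ n ih =>
    rcases Nat.le_succ_iff.1 h with h | h
    · exact (ih h).trans le_sup_left
    · rw [h]; exact le_sup_right

lemma runMax_le {α β : ℕ → ℝ} {u : ℝ → EReal} (h : ∀ i x, (aff (α i) (β i) x : EReal) ≤ u x)
    (n : ℕ) (x : ℝ) : (runMax α β n x : EReal) ≤ u x := by
  induction n with
  | zero => exact h 0 x
  | succ n ih =>
    have : runMax α β (n + 1) x = max (runMax α β n x) (aff (α (n + 1)) (β (n + 1)) x) := rfl
    rcases max_choice (runMax α β n x) (aff (α (n + 1)) (β (n + 1)) x) with h' | h'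
    · rw [this, h']; exact ih
    · rw [this, h']; exact h _ x

lemma epi_runMax {α β : ℕ → ℝ} {u : ℝ → EReal} (h : ∀ i x, (aff (α i) (β i) x : EReal) ≤ u x)
    (hsup : ∀ x (r : ℝ), (r : EReal) < u x → ∃ i, r < aff (α i) (β i) x) :
    EpiConverges1 (fun n => TR (runMax α β n) (-(n : ℝ)) n) u := by
  intro x
  have key : ∀ xk : ℕ → ℝ, Tendsto xk atTop (𝓝 x) → ∀ c < u x, ∀ᶠ k in atTop,
      c < TR (runMax α β k) (-(k : ℝ)) k (xk k) := by
    intro xk hxk c hc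
    obtain ⟨r, h1, h2⟩ := EReal.lt_iff_exists_real_btwn.1 hc
    obtain ⟨i, hi⟩ := hsup x r h2
    have h3 : Tendsto (fun k => aff (α i) (β i) (xk k)) atTop (𝓝 (aff (α i) (β i) x)) :=
      ((aff_cont _ _).tendsto x).comp hxk
    filter_upwards [h3.eventually_const_lt hi, eventually_ge_atTop i] with k hk hik
    refine h1.trans (lt_of_lt_of_le ?_ (TR_ge _ _ _ _))
    exact_mod_cast hk.trans_le (runMax_ge α β hik _)
  constructor
  · intro xk hxk
    apply le_of_forall_lt
    intro c hc
    obtain ⟨c', h1, h2⟩ := exists_between hc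
    refine h1.trans_le (le_liminf_of_le (by isBoundedDefault) ?_)
    filter_upwards [key xk hxk c' h2] with k hk
    exact hk.le
  · refine ⟨fun _ => x, tendsto_const_nhds, ?_⟩
    rw [tendsto_order]
    refine ⟨fun c hc => key _ tendsto_const_nhds c hc, fun c hc => ?_⟩
    obtain ⟨N, hN⟩ := exists_nat_ge |x|
    filter_upwards [eventually_ge_atTop N] with k hk
    have h1 : |x| ≤ k := hN.trans (by exact_mod_cast hk)
    rw [abs_le] at h1
    rw [TR_in h1.1 h1.2]
    exact (runMax_le h k x).trans_lt hc

/-! ### Affine minorants -/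

lemma bdd_below {u : ℝ → EReal} (hu : u ∈ ConvSc1) : ∃ m : ℝ, ∀ x, (m : EReal) ≤ u x := by
  obtain ⟨R, hR⟩ := hu.2 0
  obtain ⟨z, -, hz⟩ := (hu.1.2.1.lowerSemicontinuousOn (Set.Icc (-|R|) |R|)).exists_isMinOn
    ⟨0, by simp⟩ isCompact_Icc
  refine ⟨min 0 (u z).toReal, fun x => ?_⟩
  by_cases hx : x ∈ Set.Icc (-|R|) |R|
  · refine le_trans ?_ (hz hx)
    refine le_trans ?_ (EReal.coe_toReal_le (hu.1.2.2.1 z))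
    exact_mod_cast min_le_right _ _
  · rw [Set.mem_Icc, ← abs_le, not_le] at hx
    refine le_trans ?_ (hR x ((le_abs_self R).trans hx.le))
    rw [zero_mul]
    exact_mod_cast min_le_left _ _

lemma exists_minorant {u : ℝ → EReal} (hu : u ∈ ConvSc1) {x r : ℝ} (hr : (r : EReal) < u x) :
    ∃ a : ℝ, ∀ y, ((r + a * (y - x) : ℝ) : EReal) ≤ u y := by
  obtain ⟨m, hm⟩ := bdd_below hu
  have hc := hu.1.1.convexOn hu.1.2.2.1
  obtain ⟨δ, hδ, hδr⟩ := Metric.eventually_nhds_iff.1 (hu.1.2.1 x r hr)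
  have hreal : ∀ (s : ℝ) (y : ℝ), u y ≠ ⊤ → (s : EReal) ≤ u y → s ≤ (u y).toReal := by
    intro s y hy h
    rw [← EReal.coe_toReal hy (hu.1.2.2.1 y)] at h
    exact_mod_cast h
  set K := |r - m| / δ with hK
  have hK0 : 0 ≤ K := by positivity
  have hKb : ∀ y, u y ≠ ⊤ → r - (u y).toReal ≤ K * |x - y| := by
    intro y hy
    by_cases h : dist y x < δ
    · have := hreal r y hy (hδr h).le
      have : 0 ≤ K * |x - y| := by positivity
      linarith
    · rw [Real.dist_eq, abs_sub_comm, not_lt] at h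
      have h1 := hreal m y hy (hm y)
      have h2 : |r - m| ≤ K * |x - y| := by
        have := mul_le_mul_of_nonneg_left h hK0
        rw [hK, div_mul_cancel₀ _ hδ.ne'] at this
        exact this
      have := le_abs_self (r - m)
      linarith
  set S : Set ℝ := insert (-K) {t | ∃ y, y < x ∧ u y ≠ ⊤ ∧ t = (r - (u y).toReal) / (x - y)} with hS
  have hbd : BddAbove S := by
    refine ⟨K, ?_⟩
    rintro t (rfl | ⟨y, hy, hyt, rfl⟩)
    · linarith
    · rw [div_le_iff₀ (by linarith)]
      have := hKb y hyt
      rwa [abs_of_pos (by linarith)] at this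
  refine ⟨sSup S, fun y => ?_⟩
  by_cases hy : u y = ⊤
  · rw [hy]; exact le_top
  rw [← EReal.coe_toReal hy (hu.1.2.2.1 y)]
  norm_cast
  rcases lt_trichotomy y x with hlt | heq | hlt
  · have h1 : (r - (u y).toReal) / (x - y) ≤ sSup S :=
      le_csSup hbd (Or.inr ⟨y, hlt, hy, rfl⟩)
    rw [div_le_iff₀ (by linarith)] at h1
    linarith
  · subst heq
    simpa using hreal r y hy hr.le
  · have h1 : sSup S ≤ ((u y).toReal - r) / (y - x) := by
      apply csSup_le ⟨-K, Or.inl rfl⟩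
      rintro t (rfl | ⟨z, hz, hzt, rfl⟩)
      · rw [le_div_iff₀ (by linarith)]
        have := hKb y hy
        rw [abs_of_neg (by linarith)] at this
        linarith
      · have hxt : u x ≠ ⊤ := hc.1.ordConnected.out hzt hy ⟨hz.le, hlt.le⟩
        have h2 := hreal r x hxt hr.le
        have hyz : 0 < y - z := by linarith
        have h3 := hc.2 (x := z) hzt (y := y) hy
          (div_nonneg (sub_nonneg.2 hlt.le) hyz.le) (div_nonneg (sub_nonneg.2 hz.le) hyz.le)
          (by field_simp; ring)
        have hx : ((y - x) / (y - z)) • z + ((x - z) / (y - z)) • y = x := by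
          simp only [smul_eq_mul]; field_simp; ring
        rw [hx] at h3
        simp only [smul_eq_mul] at h3
        have h4 : (u x).toReal * (y - z) ≤ (y - x) * (u z).toReal + (x - z) * (u y).toReal := by
          have := mul_le_mul_of_nonneg_right h3 hyz.le
          refine this.trans (le_of_eq ?_)
          field_simp
        rw [div_le_div_iff₀ (by linarith) (by linarith)]
        nlinarith
    rw [le_div_iff₀ (by linarith)] at h1
    linarith

lemma exists_rat_minorant {u : ℝ → EReal} (hu : u ∈ ConvSc1) {x s : ℝ} (hs : (s : EReal) < u x) :
    ∃ q b : ℚ, (∀ y, ((aff q b y : ℝ) : EReal) ≤ u y) ∧ s < aff q b x := by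
  obtain ⟨r', h1, h2⟩ := EReal.lt_iff_exists_real_btwn.1 hs
  have hsr : s < r' := by exact_mod_cast h1
  obtain ⟨a, ha⟩ := exists_minorant hu h2
  obtain ⟨R₀, hR₀⟩ := hu.2 (|a| + 2)
  set R := max (max R₀ (r' - a * x)) 0 with hR
  have hRa : R₀ ≤ R := (le_max_left _ _).trans (le_max_left _ _)
  have hRb : r' - a * x ≤ R := (le_max_right _ _).trans (le_max_left _ _)
  have hRc : 0 ≤ R := le_max_right _ _
  have hden : 0 < |x| + R + 1 := by positivity
  set η := min 1 ((r' - s) / (|x| + R + 1)) with hη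
  have hη0 : 0 < η := lt_min one_pos (div_pos (by linarith) hden)
  have hη1 : η ≤ 1 := min_le_left _ _
  have hη2 : η * (|x| + R + 1) ≤ r' - s := by
    rw [← le_div_iff₀ hden]; exact min_le_right _ _
  obtain ⟨q, hq1, hq2⟩ := exists_rat_btwn (show a < a + η by linarith)
  have hqa : |(q : ℝ) - a| ≤ η := by rw [abs_le]; constructor <;> linarith
  have hqx : |((q : ℝ) - a) * x| ≤ η * |x| := by
    rw [abs_mul]; exact mul_le_mul_of_nonneg_right hqa (abs_nonneg x)
  obtain ⟨b, hb1, hb2⟩ := exists_rat_btwn (show s - q * x < r' - a * x - η * R by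
    have := neg_abs_le (((q : ℝ) - a) * x)
    nlinarith)
  refine ⟨q, b, fun y => ?_, ?_⟩
  · by_cases hy : |y| ≤ R
    · refine le_trans ?_ (ha y)
      have h3 : ((q : ℝ) - a) * y ≤ η * R := by
        refine (le_abs_self _).trans ?_
        rw [abs_mul]
        exact mul_le_mul hqa hy (abs_nonneg y) hη0.le
      simp only [aff]
      exact_mod_cast (by nlinarith : (q : ℝ) * y + b ≤ r' + a * (y - x))
    · rw [not_le] at hy
      refine le_trans ?_ (hR₀ y (hRa.trans hy.le))
      have h3 : (q : ℝ) * y ≤ (|a| + 1) * |y| := by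
        refine (le_abs_self _).trans ?_
        rw [abs_mul]
        apply mul_le_mul_of_nonneg_right _ (abs_nonneg y)
        have := abs_sub_abs_le_abs_sub (q : ℝ) a
        linarith
      have h4 : (b : ℝ) ≤ |y| := by
        have : 0 ≤ η * R := by positivity
        linarith
      simp only [aff]
      exact_mod_cast (by linarith : (q : ℝ) * y + b ≤ (|a| + 2) * |y|)
  · simp only [aff]; linarith

lemma exists_aff_seq {u : ℝ → EReal} (hu : u ∈ ConvSc1) :
    ∃ α β : ℕ → ℝ, (∀ i x, (aff (α i) (β i) x : EReal) ≤ u x) ∧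
      ∀ x (r : ℝ), (r : EReal) < u x → ∃ i, r < aff (α i) (β i) x := by
  set S : Set (ℚ × ℚ) := {p | ∀ y, ((aff p.1 p.2 y : ℝ) : EReal) ≤ u y} with hS
  have hne : S.Nonempty := by
    obtain ⟨s, -, hs⟩ := EReal.lt_iff_exists_real_btwn.1 (bot_lt_iff_ne_bot.2 (hu.1.2.2.1 0))
    obtain ⟨q, b, h, -⟩ := exists_rat_minorant hu hs
    exact ⟨(q, b), h⟩
  obtain ⟨e, he⟩ := S.to_countable.exists_eq_range hne
  refine ⟨fun i => ((e i).1 : ℝ), fun i => ((e i).2 : ℝ), fun i x => ?_, fun x r hr => ?_⟩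
  · have : e i ∈ S := by rw [he]; exact ⟨i, rfl⟩
    exact this x
  · obtain ⟨q, b, h1, h2⟩ := exists_rat_minorant hu hr
    have : (q, b) ∈ S := h1
    rw [he] at this
    obtain ⟨i, hi⟩ := this
    refine ⟨i, ?_⟩
    simp only [hi]
    exact h2

lemma D_zero {D : (ℝ → EReal) → ℝ} (hcont : ContinuousVal1 ConvSc1 D)
    (hval : IsValuation1 ConvSc1 D) (hinv : EpiTranslationInvariant1 ConvSc1 D)
    (haff : ∀ α β a b, a ≤ b → D (TR (aff α β) a b) = 0) {u : ℝ → EReal} (hu : u ∈ ConvSc1) :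
    D u = 0 := by
  obtain ⟨α, β, h1, h2⟩ := exists_aff_seq hu
  have hle : ∀ n : ℕ, -(n : ℝ) ≤ n := fun n => by
    have : (0 : ℝ) ≤ n := Nat.cast_nonneg n
    linarith
  have := hcont _ u (fun n => TR_mem (runMax_convex α β n).1 (runMax_convex α β n).2 (hle n)) hu
    (epi_runMax h1 h2)
  simp only [D_runMax hval hinv haff α β _ _ _ (hle _)] at this
  exact tendsto_nhds_unique this tendsto_const_nhds

lemma shift_mem {u : ℝ → EReal} (hu : u ∈ ConvSc1) (x₀ c : ℝ) :
    (fun x => u (x - x₀) + (c : EReal)) ∈ ConvSc1 := by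
  have hb : ∀ x, u (x - x₀) + (c : EReal) ≠ ⊥ := fun x =>
    EReal.add_ne_bot_iff.2 ⟨hu.1.2.2.1 _, EReal.coe_ne_bot _⟩
  refine ⟨⟨?_, ?_, hb, ?_⟩, ?_⟩
  · intro x y t ht0 ht1
    by_cases h : u (x - x₀) = ⊤ ∨ u (y - x₀) = ⊤
    · rw [ereal_top_of ht0 ht1 (hb x) (hb y) ?_]
      · exact le_top
      · rcases h with h | h
        · left; rw [h]; exact EReal.top_add_coe c
        · right; rw [h]; exact EReal.top_add_coe c
    · push Not at h
      have h0 := hu.1.1 (x - x₀) (y - x₀) t ht0 ht1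
      have he : t * (x - x₀) + (1 - t) * (y - x₀) = t * x + (1 - t) * y - x₀ := by ring
      rw [he] at h0
      have h1 := add_le_add_left h0 (c : EReal)
      show u (t * x + (1 - t) * y - x₀) + (c : EReal) ≤ (t : EReal) * (u (x - x₀) + (c : EReal)) +
        ((1 - t : ℝ) : EReal) * (u (y - x₀) + (c : EReal))
      refine h1.trans (le_of_eq ?_)
      rw [← EReal.coe_toReal h.1 (hu.1.2.2.1 _), ← EReal.coe_toReal h.2 (hu.1.2.2.1 _)]
      norm_cast
      ring
  · exact LowerSemicontinuous.add' (hu.1.2.1.comp (continuous_id.sub continuous_const))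
      lowerSemicontinuous_const
      (fun x => EReal.continuousAt_add (Or.inr (EReal.coe_ne_bot _)) (Or.inr (EReal.coe_ne_top _)))
  · obtain ⟨x, hx⟩ := hu.1.2.2.2
    refine ⟨x + x₀, ?_⟩
    show u (x + x₀ - x₀) + (c : EReal) ≠ ⊤
    rw [add_sub_cancel_right]
    exact EReal.add_ne_top hx (EReal.coe_ne_top _)
  · intro M
    obtain ⟨R, hR⟩ := hu.2 (|M| + 1)
    refine ⟨max (R + |x₀|) ((|M| + 1) * |x₀| + |c|), fun x hx => ?_⟩
    have hx1 := (le_max_left _ _).trans hx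
    have hx2 := (le_max_right _ _).trans hx
    have h1 : |x| - |x₀| ≤ |x - x₀| := abs_sub_abs_le_abs_sub x x₀
    have h2 := hR (x - x₀) (by linarith)
    refine le_trans ?_ (add_le_add_left h2 (c : EReal))
    have h3 : M * |x| ≤ |M| * |x| := mul_le_mul_of_nonneg_right (le_abs_self M) (abs_nonneg x)
    have h4 : (|M| + 1) * (|x| - |x₀|) ≤ (|M| + 1) * |x - x₀| :=
      mul_le_mul_of_nonneg_left h1 (by positivity)
    have h5 := neg_abs_le c
    have h6 : M * |x| ≤ (|M| + 1) * |x - x₀| + c := by nlinarith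
    exact_mod_cast h6

lemma backward {Z : (ℝ → EReal) → ℝ} {ζ₀ : ℝ} {ζ : ℝ → ℝ} (hζ : Continuous ζ)
    (hc : HasCompactSupport ζ) (h : ∀ u ∈ ConvSc1, Z u = ζ₀ + ∫ x, FInt ζ u x) :
    ContinuousVal1 ConvSc1 Z ∧ IsValuation1 ConvSc1 Z ∧ EpiTranslationInvariant1 ConvSc1 Z := by
  refine ⟨?_, ?_, ?_⟩
  · intro uk u hk hu he
    rw [h u hu]
    simp only [fun k => h (uk k) (hk k)]
    exact (cont_FInt hζ hc uk u hk hu he).const_add ζ₀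
  · intro u v hu hv hs hi
    have := val_FInt hζ hc u v hu hv hs hi
    rw [h _ hu, h _ hv, h _ hs, h _ hi]
    simp only at this
    linarith
  · intro u hu x₀ c
    rw [h _ hu, h _ (shift_mem hu x₀ c)]
    exact congrArg (ζ₀ + ·) (inv_FInt ζ u hu x₀ c)

/-- **Complete classification in dimension one** (Corollary 1):
`Z : Conv_sc(ℝ) → ℝ` is a continuous and epi-translation invariant valuation
if and only if there are `ζ₀ ∈ ℝ` and `ζ₁ ∈ C_c(ℝ)` with
`Z(u) = ζ₀ + ∫_{dom u} ζ₁(u'(x)) dx` for all `u ∈ Conv_sc(ℝ)`.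
(The derivative of `u` is expressed through the derivative of the real-valued
function `x ↦ (u x).toReal`, which agrees with `u'` a.e. on `dom u`.) -/
theorem classification_dim_one (Z : (ℝ → EReal) → ℝ) :
    (ContinuousVal1 ConvSc1 Z ∧ IsValuation1 ConvSc1 Z ∧
      EpiTranslationInvariant1 ConvSc1 Z) ↔
    (∃ (ζ₀ : ℝ) (ζ₁ : ℝ → ℝ), Continuous ζ₁ ∧ HasCompactSupport ζ₁ ∧
      ∀ u ∈ ConvSc1,
        Z u = ζ₀ + ∫ x in {x : ℝ | u x ≠ ⊤},
          ζ₁ (deriv (fun y => (u y).toReal) x)) := by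
  constructor
  · rintro ⟨hcont, hval, hinv⟩
    have hzc := zeta_cont hcont
    have hzs := zeta_supp hcont hval hinv
    refine ⟨Z (TR (aff 0 0) 0 0), fun α => Z (TR (aff α 0) 0 1) - Z (TR (aff 0 0) 0 0),
      hzc, hzs, fun u hu => ?_⟩
    rw [FInt_integral (ζ := fun α => Z (TR (aff α 0) 0 1) - Z (TR (aff 0 0) 0 0)) hu.1]
    have hza : ∀ α β a b, a ≤ b → Z (TR (aff α β) a b) = Z (TR (aff 0 0) 0 0) +
        (b - a) * (Z (TR (aff α 0) 0 1) - Z (TR (aff 0 0) 0 0)) :=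
      fun α β a b hab => Z_aff hcont hval hinv α β hab
    generalize Z (TR (aff 0 0) 0 0) = ζ₀ at *
    generalize hζ : (fun α => Z (TR (aff α 0) 0 1) - ζ₀) = ζ at *
    have hD := D_zero (D := fun u => Z u - (ζ₀ + ∫ x, FInt ζ u x)) ?_ ?_ ?_ ?_ hu
    · linarith
    · intro uk v hk hv he
      exact (hcont uk v hk hv he).sub ((cont_FInt hzc hzs uk v hk hv he).const_add ζ₀)
    · intro v w hv hw hs hi
      have h1 := val_FInt hzc hzs v w hv hw hs hi
      have h2 := hval v w hv hw hs hi
      simp only at h1 ⊢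
      linarith
    · intro v hv x₀ c
      have h1 := inv_FInt ζ v hv x₀ c
      have h2 := hinv v hv x₀ c
      simp only at h1 ⊢
      linarith
    · intro α β a b hab
      rw [FInt_aff ζ α β hab, hza α β a b hab, ← hζ]
      ring
  · rintro ⟨ζ₀, ζ₁, hc, hs, h⟩
    refine backward hc hs (ζ₀ := ζ₀) fun u hu => ?_
    rw [h u hu, FInt_integral hu.1]
end
end

section
/- If Z : Conv(ℝⁿ;ℝ) → ℝ is a continuous and dually epi-translation invariant valuation, then there exist continuous and dually epi-translation invariant valuations Z₀, Z₁, …, Z_n : Conv(ℝⁿ;ℝ) → ℝ such that Z_i is homogeneous of degree i for each i ∈ {0,…,n} and Z = Z₀ + Z₁ + ⋯ + Z_n. -/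
open Filter Topology MeasureTheory

noncomputable section

/-- Euclidean space `ℝⁿ`. -/
abbrev Vn (n : ℕ) := EuclideanSpace ℝ (Fin n)

/-- `Conv(ℝⁿ;ℝ)`: finite-valued convex functions on `ℝⁿ`. -/
def ConvFin (n : ℕ) : Set (Vn n → ℝ) := {v | ConvexOn ℝ Set.univ v}

/-- Epi-convergence of a sequence of real-valued functions
(the lower bound condition is stated in `EReal` so that the `liminf` is the
honest extended-real lower limit). -/
def EpiConvergesR {n : ℕ} (vk : ℕ → Vn n → ℝ) (v : Vn n → ℝ) : Prop :=
  ∀ x : Vn n,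
    (∀ xk : ℕ → Vn n, Tendsto xk atTop (𝓝 x) →
      (v x : EReal) ≤ liminf (fun k => ((vk k (xk k) : ℝ) : EReal)) atTop) ∧
    (∃ xk : ℕ → Vn n, Tendsto xk atTop (𝓝 x) ∧
      Tendsto (fun k => vk k (xk k)) atTop (𝓝 (v x)))

/-- Continuity (with respect to epi-convergence) of a functional on a class `X`. -/
def ContinuousValR {n : ℕ} (X : Set (Vn n → ℝ)) (Z : (Vn n → ℝ) → ℝ) : Prop :=
  ∀ (vk : ℕ → Vn n → ℝ) (v : Vn n → ℝ),
    (∀ k, vk k ∈ X) → v ∈ X → EpiConvergesR vk v →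
      Tendsto (fun k => Z (vk k)) atTop (𝓝 (Z v))

/-- The valuation property on a class `X` (here `⊔`, `⊓` are the pointwise
maximum and minimum). -/
def IsValuationR {n : ℕ} (X : Set (Vn n → ℝ)) (Z : (Vn n → ℝ) → ℝ) : Prop :=
  ∀ u v : Vn n → ℝ, u ∈ X → v ∈ X → u ⊔ v ∈ X → u ⊓ v ∈ X →
    Z (u ⊔ v) + Z (u ⊓ v) = Z u + Z v

/-- Dual epi-translation invariance: invariance under addition of affine
functions `v ↦ v + ℓ + c`. -/
def DuallyEpiTranslationInvariant {n : ℕ} (X : Set (Vn n → ℝ)) (Z : (Vn n → ℝ) → ℝ) : Prop :=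
  ∀ v ∈ X, ∀ ℓ : Vn n →ₗ[ℝ] ℝ, ∀ c : ℝ, Z (fun x => v x + ℓ x + c) = Z v

/-- Dual translation invariance: invariance under addition of linear
functions `v ↦ v + ℓ`. -/
def DuallyTranslationInvariant {n : ℕ} (X : Set (Vn n → ℝ)) (Z : (Vn n → ℝ) → ℝ) : Prop :=
  ∀ v ∈ X, ∀ ℓ : Vn n →ₗ[ℝ] ℝ, Z (fun x => v x + ℓ x) = Z v

/-- `Z` is homogeneous of degree `α`: `Z(λ v) = λ^α Z(v)` for `λ > 0`. -/
def HomogeneousR {n : ℕ} (X : Set (Vn n → ℝ)) (Z : (Vn n → ℝ) → ℝ) (α : ℝ) : Prop :=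
  ∀ v ∈ X, ∀ l : ℝ, 0 < l → Z (fun x => l * v x) = l ^ α * Z v

/-! ### Cutting convex functions -/

/-- Infimal translate of `u` over a set `B` of shifts. -/
def infB {E : Type*} [AddCommGroup E] (B : Set E) (u : E → ℝ) (x : E) : ℝ :=
  ⨅ s : B, u (x + s)

theorem infB_le {E : Type*} [AddCommGroup E] {B : Set E} {u : E → ℝ} {x : E}
    (hb : BddBelow (Set.range fun s : B => u (x + s))) {s : E} (hs : s ∈ B) :
    infB B u x ≤ u (x + s) :=
  ciInf_le hb (⟨s, hs⟩ : B)

theorem le_infB {E : Type*} [AddCommGroup E] {B : Set E} {u : E → ℝ} {x : E} {c : ℝ}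
    (hB : B.Nonempty) (h : ∀ s ∈ B, c ≤ u (x + s)) : c ≤ infB B u x := by
  have := hB.to_subtype
  exact le_ciInf fun s => h s s.2

theorem exists_lt_of_infB_lt {E : Type*} [AddCommGroup E] {B : Set E} {u : E → ℝ} {x : E} {c : ℝ}
    (hB : B.Nonempty) (h : infB B u x < c) : ∃ s ∈ B, u (x + s) < c := by
  have := hB.to_subtype
  obtain ⟨s, hs⟩ := exists_lt_of_ciInf_lt h
  exact ⟨s, s.2, hs⟩

theorem infB_convexOn {E : Type*} [AddCommGroup E] [Module ℝ E] {B : Set E} {u : E → ℝ}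
    (hu : ConvexOn ℝ Set.univ u) (hBc : Convex ℝ B) (hB : B.Nonempty)
    (hb : ∀ x, BddBelow (Set.range fun s : B => u (x + s))) :
    ConvexOn ℝ Set.univ (infB B u) := by
  refine ⟨convex_univ, fun x _ y _ a b ha hb' hab => ?_⟩
  refine le_of_forall_pos_le_add fun ε hε => ?_
  obtain ⟨s, hs, hs'⟩ := exists_lt_of_infB_lt hB (show infB B u x < infB B u x + ε by linarith)
  obtain ⟨t, ht, ht'⟩ := exists_lt_of_infB_lt hB (show infB B u y < infB B u y + ε by linarith)
  have h1 := infB_le (hb (a • x + b • y)) (hBc hs ht ha hb' hab)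
  have h2 := hu.2 (Set.mem_univ (x + s)) (Set.mem_univ (y + t)) ha hb' hab
  have h3 : a • x + b • y + (a • s + b • t) = a • (x + s) + b • (y + t) := by
    simp only [smul_add]; abel
  rw [h3] at h1
  simp only [smul_eq_mul] at h2 ⊢
  have : a * u (x + s) + b * u (y + t) ≤ a * (infB B u x + ε) + b * (infB B u y + ε) := by
    gcongr
  have e : a * (infB B u x + ε) + b * (infB B u y + ε)
      = a * infB B u x + b * infB B u y + (a + b) * ε := by ring
  rw [hab] at e
  linarith

/-- The basic cutting relation. -/
theorem cut_relation {E : Type*} [AddCommGroup E] [Module ℝ E] {Z : (E → ℝ) → ℝ}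
    (hZ : ∀ u v : E → ℝ, ConvexOn ℝ Set.univ u → ConvexOn ℝ Set.univ v →
      ConvexOn ℝ Set.univ (u ⊔ v) → ConvexOn ℝ Set.univ (u ⊓ v) →
      Z (u ⊔ v) + Z (u ⊓ v) = Z u + Z v)
    {u : E → ℝ} (hu : ConvexOn ℝ Set.univ u) {BI BN BP BO : Set E}
    (hO : BO = BN ∪ BP) (hIN : BI ⊆ BN) (hIP : BI ⊆ BP) (hne : BI.Nonempty)
    (hcI : Convex ℝ BI) (hcN : Convex ℝ BN) (hcP : Convex ℝ BP) (hcO : Convex ℝ BO)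
    (hseg : ∀ s ∈ BN, ∀ t ∈ BP, ∃ a b : ℝ, 0 ≤ a ∧ 0 ≤ b ∧ a + b = 1 ∧ a • s + b • t ∈ BI)
    (hb : ∀ x, BddBelow (Set.range fun s : BO => u (x + s))) :
    Z (infB BI u) + Z (infB BO u) = Z (infB BN u) + Z (infB BP u) := by
  have mono : ∀ {B : Set E}, B ⊆ BO → ∀ x, BddBelow (Set.range fun s : B => u (x + s)) := by
    intro B hB x
    refine (hb x).mono ?_
    rintro _ ⟨s, rfl⟩
    exact ⟨⟨s, hB s.2⟩, rfl⟩
  have hNO : BN ⊆ BO := hO ▸ Set.subset_union_left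
  have hPO : BP ⊆ BO := hO ▸ Set.subset_union_right
  have bI := mono (hIN.trans hNO)
  have bN := mono hNO
  have bP := mono hPO
  have neN := hne.mono hIN
  have neP := hne.mono hIP
  have neO := neN.mono hNO
  have e1 : infB BI u = infB BN u ⊔ infB BP u := by
    ext x
    refine le_antisymm ?_ (sup_le ?_ ?_)
    · by_contra hcon
      have hcon := not_le.1 hcon
      obtain ⟨h1, h2⟩ := sup_lt_iff.1 hcon
      obtain ⟨s, hs, hs'⟩ := exists_lt_of_infB_lt neN h1
      obtain ⟨t, ht, ht'⟩ := exists_lt_of_infB_lt neP h2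
      obtain ⟨a, b, ha, hb', hab, hmem⟩ := hseg s hs t ht
      have h3 := infB_le (bI x) hmem
      have h4 := hu.2 (Set.mem_univ (x + s)) (Set.mem_univ (x + t)) ha hb' hab
      have h5 : x + (a • s + b • t) = a • (x + s) + b • (x + t) := by
        have : x = a • x + b • x := by rw [← add_smul, hab, one_smul]
        nth_rewrite 1 [this]
        simp only [smul_add]; abel
      rw [h5] at h3
      simp only [smul_eq_mul] at h4
      have h6 : a * u (x + s) + b * u (x + t) < infB BI u x := by
        have : infB BI u x = a * infB BI u x + b * infB BI u x := by rw [← add_mul, hab, one_mul]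
        rw [this]
        rcases ha.lt_or_eq with h | h
        · have := mul_lt_mul_of_pos_left hs' h
          have := mul_le_mul_of_nonneg_left ht'.le hb'
          linarith
        · have : 0 < b := by linarith
          have := mul_lt_mul_of_pos_left ht' this
          have := mul_le_mul_of_nonneg_left hs'.le ha
          linarith
      linarith
    · exact le_infB hne fun s hs => infB_le (bN x) (hIN hs)
    · exact le_infB hne fun s hs => infB_le (bP x) (hIP hs)
  have e2 : infB BO u = infB BN u ⊓ infB BP u := by
    ext x
    refine le_antisymm (le_inf ?_ ?_) ?_
    · exact le_infB neN fun s hs => infB_le (hb x) (hNO hs)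
    · exact le_infB neP fun s hs => infB_le (hb x) (hPO hs)
    · refine le_infB neO fun s hs => ?_
      rw [hO] at hs
      rcases hs with hs | hs
      · exact inf_le_left.trans (infB_le (bN x) hs)
      · exact inf_le_right.trans (infB_le (bP x) hs)
  have c1 := infB_convexOn hu hcI hne bI
  have c2 := infB_convexOn hu hcO neO hb
  rw [e1] at c1 ⊢
  rw [e2] at c2 ⊢
  exact hZ _ _ (infB_convexOn hu hcN neN bN) (infB_convexOn hu hcP neP bP) c1 c2

/-! ### Combinatorics of alternating sums -/

/-- Types of cuts. -/
inductive CutT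
  | I | P | N | O

/-- Iterated difference in the symbols `a`, `b`. -/
def altD {T : Type} (a b : T) : (d : ℕ) → ((Fin d → T) → ℝ) → ℝ
  | 0, F => F (fun i => i.elim0)
  | d + 1, F => altD a b d (fun c => F (Fin.cons a c) - F (Fin.cons b c))

/-- Iterated backward difference. -/
def nab : (d : ℕ) → (ℕ → ℝ) → ℝ
  | 0, g => g 0
  | d + 1, g => nab d (fun k => g k - g (k + 1))

theorem altD_congr {T : Type} (a b : T) (d : ℕ) (F G : (Fin d → T) → ℝ)
    (h : ∀ c, (∀ i, c i = a ∨ c i = b) → F c = G c) : altD a b d F = altD a b d G := by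
  induction d with
  | zero => exact h _ (fun i => i.elim0)
  | succ d ih =>
    refine ih _ _ fun c hc => ?_
    rw [h (Fin.cons a c) (Fin.cases (by simp) (by simpa using hc)),
      h (Fin.cons b c) (Fin.cases (by simp) (by simpa using hc))]

theorem altD_swap (d : ℕ) (F : (Fin d → CutT) → ℝ)
    (h : ∀ c i, F (Function.update c i CutT.I) + F (Function.update c i CutT.O)
      = F (Function.update c i CutT.N) + F (Function.update c i CutT.P)) :
    altD CutT.I CutT.P d F = altD CutT.N CutT.O d F := by
  induction d with
  | zero => rfl
  | succ d ih =>
    have e : (fun c : Fin d → CutT => F (Fin.cons CutT.N c) - F (Fin.cons CutT.O c))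
        = fun c => F (Fin.cons CutT.I c) - F (Fin.cons CutT.P c) := by
      funext c
      have := h (Fin.cons CutT.I c) 0
      simp only [Fin.update_cons_zero] at this
      linarith
    simp only [altD]
    rw [e]
    refine ih _ fun c i => ?_
    have h1 := h (Fin.cons CutT.I c) i.succ
    have h2 := h (Fin.cons CutT.P c) i.succ
    simp only [← Fin.cons_update] at h1 h2
    linarith

theorem altD_count (d : ℕ) (F : (Fin d → CutT) → ℝ) (g : ℕ → ℝ)
    (h : ∀ p : Finset (Fin d), ∀ c : Fin d → CutT, (∀ i ∈ p, c i = CutT.P) →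
      (∀ i ∉ p, c i = CutT.I) → F c = g p.card) :
    altD CutT.I CutT.P d F = nab d g := by
  induction d generalizing g with
  | zero => 
    have := h ∅ (fun i => i.elim0) (fun i => i.elim0) (fun i => i.elim0)
    simpa [altD, nab] using this
  | succ d ih =>
    refine ih _ _ fun p c hp hp' => ?_
    have h1 := h (p.map (Fin.succEmb d)) (Fin.cons CutT.I c) ?_ ?_
    have h2 := h (insert 0 (p.map (Fin.succEmb d))) (Fin.cons CutT.P c) ?_ ?_
    · rw [h1, h2, Finset.card_insert_of_notMem (by simp [Fin.succ_ne_zero])]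
      simp
    · intro i
      refine Fin.cases (by simp) (fun j => ?_) i
      simpa [Fin.succ_ne_zero] using hp j
    · intro i
      refine Fin.cases (by simp) (fun j => ?_) i
      simpa [Fin.succ_ne_zero] using hp' j
    · intro i
      refine Fin.cases (by simp [Fin.succ_ne_zero]) (fun j => ?_) i
      simpa using hp j
    · intro i
      refine Fin.cases (by simp) (fun j => ?_) i
      simpa using hp' j

theorem nab_fwdDiff (d : ℕ) (g : ℝ → ℝ) (r : ℝ) :
    nab d (fun k => g (r - k)) = (fwdDiff (1 : ℝ))^[d] g (r - d) := by
  induction d generalizing g r with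
  | zero => simp [nab]
  | succ d ih =>
    have : (fun k : ℕ => g (r - k) - g (r - ((k + 1 : ℕ) : ℝ)))
        = fun k : ℕ => fwdDiff (1 : ℝ) g ((r - 1) - k) := by
      funext k
      simp only [fwdDiff]
      push_cast
      congr 2 <;> ring
    simp only [nab]
    rw [this, ih, Function.iterate_succ_apply]
    push_cast
    ring_nf

/-! ### The simplex -/

/-- The set of shifts attached to a cut type. -/
def cutS : CutT → Set ℝ
  | CutT.I => {0}
  | CutT.P => Set.Ici 0
  | CutT.N => Set.Iic 0
  | CutT.O => Set.univ

/-- The set of shifts attached to a multi-cut. -/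
def cutB {d : ℕ} (c : Fin d → CutT) : Set (Fin d → ℝ) := {s | ∀ i, s i ∈ cutS (c i)}

theorem cutS_convex (c : CutT) : Convex ℝ (cutS c) := by
  cases c
  · exact convex_singleton 0
  · exact convex_Ici 0
  · exact convex_Iic 0
  · exact convex_univ

theorem zero_mem_cutS (c : CutT) : (0 : ℝ) ∈ cutS c := by
  cases c <;> simp [cutS]

theorem cutB_convex {d : ℕ} (c : Fin d → CutT) : Convex ℝ (cutB c) := by
  intro s hs t ht a b ha hb hab i
  exact cutS_convex (c i) (hs i) (ht i) ha hb hab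

theorem zero_mem_cutB {d : ℕ} (c : Fin d → CutT) : (0 : Fin d → ℝ) ∈ cutB c :=
  fun i => zero_mem_cutS (c i)

theorem mem_cutB_update {d : ℕ} (c : Fin d → CutT) (i : Fin d) (X : CutT) (s : Fin d → ℝ) :
    s ∈ cutB (Function.update c i X) ↔ s i ∈ cutS X ∧ ∀ j, j ≠ i → s j ∈ cutS (c j) := by
  constructor
  · intro h
    refine ⟨by simpa using h i, fun j hj => by simpa [hj] using h j⟩
  · rintro ⟨h1, h2⟩ j
    by_cases hj : j = i
    · subst hj; simpa using h1
    · simpa [hj] using h2 j hj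

theorem cutB_relation {d : ℕ} {Z : ((Fin d → ℝ) → ℝ) → ℝ}
    (hZ : ∀ u v : (Fin d → ℝ) → ℝ, ConvexOn ℝ Set.univ u → ConvexOn ℝ Set.univ v →
      ConvexOn ℝ Set.univ (u ⊔ v) → ConvexOn ℝ Set.univ (u ⊓ v) →
      Z (u ⊔ v) + Z (u ⊓ v) = Z u + Z v)
    {u : (Fin d → ℝ) → ℝ} (hu : ConvexOn ℝ Set.univ u) (h0 : ∀ x, 0 ≤ u x)
    (c : Fin d → CutT) (i : Fin d) :
    Z (infB (cutB (Function.update c i CutT.I)) u) + Z (infB (cutB (Function.update c i CutT.O)) u)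
    = Z (infB (cutB (Function.update c i CutT.N)) u)
      + Z (infB (cutB (Function.update c i CutT.P)) u) := by
  refine cut_relation hZ hu ?_ ?_ ?_ ⟨0, zero_mem_cutB _⟩ (cutB_convex _) (cutB_convex _)
    (cutB_convex _) (cutB_convex _) ?_ ?_
  · ext s
    simp only [Set.mem_union, mem_cutB_update, cutS, Set.mem_univ, Set.mem_Iic, Set.mem_Ici]
    have := le_total (s i) 0
    tauto
  · intro s
    simp only [mem_cutB_update, cutS, Set.mem_singleton_iff, Set.mem_Iic]
    exact fun h => ⟨h.1.le, h.2⟩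
  · intro s
    simp only [mem_cutB_update, cutS, Set.mem_singleton_iff, Set.mem_Ici]
    exact fun h => ⟨h.1.ge, h.2⟩
  · intro s hs t ht
    rw [mem_cutB_update] at hs ht
    simp only [cutS, Set.mem_Iic, Set.mem_Ici] at hs ht
    have key : ∃ a b : ℝ, 0 ≤ a ∧ 0 ≤ b ∧ a + b = 1 ∧ a * s i + b * t i = 0 := by
      rcases hs.1.lt_or_eq with h | h
      · have hp : 0 < t i - s i := by linarith [ht.1]
        refine ⟨t i / (t i - s i), -s i / (t i - s i), div_nonneg ht.1 hp.le,
          div_nonneg (by linarith) hp.le, ?_, ?_⟩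
        · field_simp
          ring
        · field_simp
          ring
      · exact ⟨1, 0, by norm_num, le_rfl, by norm_num, by simp [h]⟩
    obtain ⟨a, b, ha, hb, hab, he⟩ := key
    refine ⟨a, b, ha, hb, hab, ?_⟩
    rw [mem_cutB_update]
    refine ⟨by simpa [cutS] using he, fun j hj => ?_⟩
    exact cutS_convex (c j) (hs.2 j hj) (ht.2 j hj) ha hb hab
  · intro x
    refine ⟨0, ?_⟩
    rintro _ ⟨s, rfl⟩
    exact h0 _

/-- `σ y = max (0, y₁, …, y_d)`, characterized by its universal property. -/
structure IsCornerMax {d : ℕ} (σ : (Fin d → ℝ) → ℝ) : Prop where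
  nonneg : ∀ y, 0 ≤ σ y
  le : ∀ y i, y i ≤ σ y
  least : ∀ y c, 0 ≤ c → (∀ i, y i ≤ c) → σ y ≤ c

theorem IsCornerMax.convexOn {d : ℕ} {σ : (Fin d → ℝ) → ℝ} (h : IsCornerMax σ) :
    ConvexOn ℝ Set.univ σ := by
  refine ⟨convex_univ, fun x _ y _ a b ha hb _ => ?_⟩
  simp only [smul_eq_mul]
  have := h.nonneg x
  have := h.nonneg y
  refine h.least _ _ (by positivity) fun i => ?_
  have h1 := h.le x i
  have h2 := h.le y i
  simp only [Pi.add_apply, Pi.smul_apply, smul_eq_mul]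
  gcongr

theorem IsCornerMax.mono {d : ℕ} {σ : (Fin d → ℝ) → ℝ} (h : IsCornerMax σ) {x y : Fin d → ℝ}
    (hxy : ∀ i, x i ≤ y i) : σ x ≤ σ y :=
  h.least _ _ (h.nonneg y) fun i => (hxy i).trans (h.le y i)

theorem IsCornerMax.sum_le {d : ℕ} {σ : (Fin d → ℝ) → ℝ} (h : IsCornerMax σ) (y : Fin d → ℝ) :
    ∑ i, max (y i) 0 ≤ d * σ y := by
  calc ∑ i, max (y i) 0 ≤ ∑ _i : Fin d, σ y :=
        Finset.sum_le_sum fun i _ => max_le (h.le y i) (h.nonneg y)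
    _ = d * σ y := by simp

theorem simplex_NO {d : ℕ} {σ : (Fin d → ℝ) → ℝ} (h : IsCornerMax σ) {r r' : ℝ} (hr : (d : ℝ) ≤ r)
    (hr' : (d : ℝ) ≤ r') (c : Fin d → CutT) (hc : ∀ i, c i = CutT.N ∨ c i = CutT.O) 
    (x : Fin d → ℝ) :
    infB (cutB c) (fun y => r' * σ y - ∑ i, y i) x ≤ infB (cutB c) (fun y => r * σ y - ∑ i, y i) x := by
  refine le_infB ⟨0, zero_mem_cutB _⟩ fun s hs => ?_
  have hb : BddBelow (Set.range fun s : cutB c => 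
      (fun y : Fin d → ℝ => r' * σ y - ∑ i, y i) (x + s)) := by
    refine ⟨0, ?_⟩
    rintro _ ⟨s, rfl⟩
    have h1 := h.sum_le (x + s)
    have h2 : ∑ i, (x + s.1) i ≤ ∑ i, max ((x + s.1) i) 0 :=
      Finset.sum_le_sum fun i _ => le_max_left _ _
    have h3 := mul_le_mul_of_nonneg_right hr' (h.nonneg (x + s))
    simp only
    linarith
  have hmem : (fun i => min (s i) (-x i)) ∈ cutB c := by
    intro i
    have := hs i
    rcases hc i with h' | h' <;> rw [h'] at this ⊢ <;> simp only [cutS, Set.mem_Iic, Set.mem_univ] at this ⊢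
    exact (min_le_left _ _).trans this
  refine (infB_le hb hmem).trans ?_
  have e1 : σ (x + fun i => min (s i) (-x i)) ≤ 0 := by
    refine h.least _ _ le_rfl fun i => ?_
    have := min_le_right (s i) (-x i)
    simp only [Pi.add_apply]; linarith
  have e2 := le_antisymm e1 (h.nonneg _)
  have h1 := h.sum_le (x + s)
  have h3 := mul_le_mul_of_nonneg_right hr (h.nonneg (x + s))
  have e3 : ∑ i, (x + s) i = ∑ i, (x + fun i => min (s i) (-x i)) i + ∑ i, max ((x + s) i) 0 := by
    rw [← Finset.sum_add_distrib]
    refine Finset.sum_congr rfl fun i _ => ?_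
    simp only [Pi.add_apply]
    rcases le_total (s i) (-x i) with h | h
    · rw [min_eq_left h, max_eq_right (by linarith)]; ring
    · rw [min_eq_right h, max_eq_left (by linarith)]; ring
  rw [e2, e3]
  linarith

theorem simplex_IP {d : ℕ} {σ : (Fin d → ℝ) → ℝ} (h : IsCornerMax σ) {r : ℝ} (hr : (d : ℝ) ≤ r)
    (p : Finset (Fin d)) (c : Fin d → CutT) (hp : ∀ i ∈ p, c i = CutT.P)
    (hI : ∀ i ∉ p, c i = CutT.I) (x : Fin d → ℝ) :
    infB (cutB c) (fun y => r * σ y - ∑ i, y i) x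
      = (r - p.card) * σ x + ∑ i ∈ p, x i - ∑ i, x i := by
  classical
  have hlow : ∀ s ∈ cutB c, (r - p.card) * σ x + ∑ i ∈ p, x i - ∑ i, x i ≤
      r * σ (x + s) - ∑ i, (x + s) i := by
    intro s hs
    have hs0 : ∀ i ∉ p, s i = 0 := fun i hi => by simpa [hI i hi, cutS] using hs i
    have hs1 : ∀ i ∈ p, 0 ≤ s i := fun i hi => by simpa [hp i hi, cutS] using hs i
    have hm : σ x ≤ σ (x + s) := h.mono fun i => by
      by_cases hi : i ∈ p
      · simpa using hs1 i hi
      · simp [hs0 i hi]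
    have hsum : ∑ i, (x + s) i = ∑ i, x i + ∑ i ∈ p, s i := by
      simp only [Pi.add_apply, Finset.sum_add_distrib]
      congr 1
      symm
      exact Finset.sum_subset (Finset.subset_univ p) fun i _ hi => hs0 i hi
    have hpp : ∑ i ∈ p, x i + ∑ i ∈ p, s i ≤ p.card * σ (x + s) := by
      rw [← Finset.sum_add_distrib]
      calc _ ≤ ∑ i ∈ p, σ (x + s) := Finset.sum_le_sum fun i _ => h.le (x + s) i
        _ = _ := by simp
    have hcard : (p.card : ℝ) ≤ r := by
      refine le_trans ?_ hr
      exact_mod_cast (Finset.card_le_univ p).trans (by simp)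
    have := mul_le_mul_of_nonneg_left hm (sub_nonneg.2 hcard)
    rw [hsum]
    linarith
  refine le_antisymm ?_ (le_infB ⟨0, zero_mem_cutB _⟩ hlow)
  have hb : BddBelow (Set.range fun s : cutB c => 
      (fun y : Fin d → ℝ => r * σ y - ∑ i, y i) (x + s)) :=
    ⟨_, by rintro _ ⟨s, rfl⟩; exact hlow s s.2⟩
  have hmem : (fun i => if i ∈ p then σ x - x i else 0) ∈ cutB c := by
    intro i
    by_cases hi : i ∈ p
    · simpa [hi, hp i hi, cutS] using h.le x i
    · simp [hi, hI i hi, cutS]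
  refine (infB_le hb hmem).trans ?_
  have e1 : σ (x + fun i => if i ∈ p then σ x - x i else 0) ≤ σ x := by
    refine h.least _ _ (h.nonneg x) fun i => ?_
    by_cases hi : i ∈ p
    · simp [hi]
    · simpa [hi] using h.le x i
  have hr0 : 0 ≤ r := le_trans (by positivity) hr
  have := mul_le_mul_of_nonneg_left e1 hr0
  have e2 : ∑ i, (x + fun i => if i ∈ p then σ x - x i else 0) i
      = ∑ i, x i + (p.card * σ x - ∑ i ∈ p, x i) := by
    simp [Finset.sum_add_distrib, Finset.sum_ite_mem]
  rw [e2]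
  linarith

theorem simplex_diff {d : ℕ} {Z : ((Fin d → ℝ) → ℝ) → ℝ}
    (hZ : ∀ u v : (Fin d → ℝ) → ℝ, ConvexOn ℝ Set.univ u → ConvexOn ℝ Set.univ v →
      ConvexOn ℝ Set.univ (u ⊔ v) → ConvexOn ℝ Set.univ (u ⊓ v) →
      Z (u ⊔ v) + Z (u ⊓ v) = Z u + Z v)
    (hinv : ∀ u, ConvexOn ℝ Set.univ u → ∀ l : (Fin d → ℝ) →ₗ[ℝ] ℝ, Z (fun x => u x + l x) = Z u)
    {σ : (Fin d → ℝ) → ℝ} (h : IsCornerMax σ) {t t' : ℝ} (ht : 0 ≤ t) (ht' : 0 ≤ t') :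
    (fwdDiff (1 : ℝ))^[d] (fun r => Z (fun y => r * σ y)) t
      = (fwdDiff (1 : ℝ))^[d] (fun r => Z (fun y => r * σ y)) t' := by
  have main : ∀ r : ℝ, (d : ℝ) ≤ r →
      altD CutT.N CutT.O d (fun c => Z (infB (cutB c) (fun y => r * σ y - ∑ i, y i)))
      = (fwdDiff (1 : ℝ))^[d] (fun r => Z (fun y => r * σ y)) (r - d) := by
    intro r hr
    have hr0 : 0 ≤ r := le_trans (by positivity) hr
    rw [← altD_swap, ← nab_fwdDiff]
    · refine altD_count d _ _ fun p c hp hI => ?_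
      have e : infB (cutB c) (fun y => r * σ y - ∑ i, y i) = fun x => (r - p.card) * σ x +
          (∑ i ∈ p, LinearMap.proj i - ∑ i, LinearMap.proj i : (Fin d → ℝ) →ₗ[ℝ] ℝ) x := by
        funext x
        rw [simplex_IP h hr p c hp hI x]
        simp
        ring
      rw [e]
      refine hinv (fun x => (r - p.card) * σ x) ?_ _
      have hcard : (p.card : ℝ) ≤ r := by
        refine le_trans ?_ hr
        exact_mod_cast (Finset.card_le_univ p).trans (by simp)
      exact h.convexOn.smul (sub_nonneg.2 hcard)
    · intro c i
      refine cutB_relation hZ ?_ ?_ c i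
      · refine (h.convexOn.smul hr0).sub ?_
        have := (∑ i, LinearMap.proj i : (Fin d → ℝ) →ₗ[ℝ] ℝ).concaveOn convex_univ
        have e : (fun y : Fin d → ℝ => ∑ i, y i)
            = ⇑(∑ i, LinearMap.proj i : (Fin d → ℝ) →ₗ[ℝ] ℝ) := by
          funext x; simp
        rw [e]; exact this
      · intro y
        have h1 := h.sum_le y
        have h2 : ∑ i, y i ≤ ∑ i, max (y i) 0 :=
          Finset.sum_le_sum fun i _ => le_max_left _ _
        have h3 := mul_le_mul_of_nonneg_right hr (h.nonneg y)
        linarith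
  have m1 := main (t + d) (by linarith)
  have m2 := main (t' + d) (by linarith)
  rw [add_sub_cancel_right] at m1 m2
  rw [← m1, ← m2]
  refine altD_congr _ _ _ _ _ fun c hc => ?_
  congr 1
  funext x
  exact le_antisymm (simplex_NO h (by linarith) (by linarith) c hc x)
    (simplex_NO h (by linarith) (by linarith) c hc x)

/-! ### Polynomials -/

theorem fwdDiff_iter_zero_of_zero {g : ℝ → ℝ} (h0 : ∀ t, 0 ≤ t → g t = 0) (j : ℕ) :
    ∀ t, 0 ≤ t → (fwdDiff (1 : ℝ))^[j] g t = 0 := by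
  induction j with
  | zero => simpa using h0
  | succ j ih =>
    intro t ht
    rw [Function.iterate_succ_apply']
    simp only [fwdDiff]
    rw [ih _ (by linarith), ih _ ht, sub_zero]

theorem choose_poly (k : ℕ) : ∃ P : Polynomial ℝ, ∀ m : ℕ, P.eval (m : ℝ) = (m.choose k : ℝ) := by
  refine ⟨Polynomial.C ((k.factorial : ℝ)⁻¹) * descPochhammer ℝ k, fun m => ?_⟩
  rw [Polynomial.eval_mul, Polynomial.eval_C, descPochhammer_eval_eq_descFactorial,
    Nat.descFactorial_eq_factorial_mul_choose]
  have : (k.factorial : ℝ) ≠ 0 := by positivity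
  push_cast
  field_simp

theorem poly_of_diff (d : ℕ) (g : ℝ → ℝ)
    (h : ∀ t t' : ℝ, 0 ≤ t → 0 ≤ t' → (fwdDiff (1 : ℝ))^[d] g t = (fwdDiff (1 : ℝ))^[d] g t') :
    ∃ P : Polynomial ℝ, ∀ m : ℕ, g m = P.eval (m : ℝ) := by
  have hz : ∀ k, d < k → (fwdDiff (1 : ℝ))^[k] g 0 = 0 := by
    intro k hk
    obtain ⟨j, rfl⟩ := Nat.exists_eq_add_of_lt hk
    have h1 : ∀ t, 0 ≤ t → (fwdDiff (1 : ℝ))^[d + 1] g t = 0 := by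
      intro t ht
      rw [Function.iterate_succ_apply']
      simp only [fwdDiff]
      rw [h (t + 1) t (by linarith) ht, sub_self]
    have := fwdDiff_iter_zero_of_zero h1 j 0 le_rfl
    rw [← Function.iterate_add_apply] at this
    rwa [show d + j + 1 = j + (d + 1) by ring]
  choose Q hQ using choose_poly
  refine ⟨∑ k ∈ Finset.range (d + 1), Polynomial.C ((fwdDiff (1 : ℝ))^[k] g 0) * Q k, fun m => ?_⟩
  have := shift_eq_sum_fwdDiff_iter (1 : ℝ) g m 0
  rw [zero_add, nsmul_eq_mul, mul_one] at this
  rw [this, Polynomial.eval_finsetSum]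
  simp only [Polynomial.eval_mul, Polynomial.eval_C, hQ, nsmul_eq_mul]
  have e1 : ∑ k ∈ Finset.range (m + 1), (m.choose k : ℝ) * (fwdDiff (1 : ℝ))^[k] g 0
      = ∑ k ∈ Finset.range (m + 1 + (d + 1)), (m.choose k : ℝ) * (fwdDiff (1 : ℝ))^[k] g 0 := by
    refine Finset.sum_subset (Finset.range_mono (by omega)) fun k _ hk => ?_
    rw [Nat.choose_eq_zero_of_lt (by simpa using hk)]
    simp
  have e2 : ∑ k ∈ Finset.range (d + 1), (m.choose k : ℝ) * (fwdDiff (1 : ℝ))^[k] g 0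
      = ∑ k ∈ Finset.range (m + 1 + (d + 1)), (m.choose k : ℝ) * (fwdDiff (1 : ℝ))^[k] g 0 := by
    refine Finset.sum_subset (Finset.range_mono (by omega)) fun k _ hk => ?_
    rw [hz k (by simpa using hk)]
    simp
  rw [e1, ← e2]
  exact Finset.sum_congr rfl fun k _ => mul_comm _ _

theorem poly_eq_of_nat {P Q : Polynomial ℝ} (h : ∀ k : ℕ, P.eval (k : ℝ) = Q.eval (k : ℝ)) :
    P = Q := by
  refine Polynomial.eq_of_infinite_eval_eq _ _ ?_
  refine Set.Infinite.mono ?_ (Set.infinite_range_of_injective (Nat.cast_injective (R := ℝ)))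
  rintro _ ⟨k, rfl⟩
  exact h k

theorem poly_of_scales (n : ℕ) (f : ℝ → ℝ) (hf : ContinuousOn f (Set.Ioi 0))
    (hP : ∀ h : ℝ, 0 < h → ∃ P : Polynomial ℝ, ∀ k : ℕ, f (h * k) = P.eval (k : ℝ))
    (C : ℝ) (hC : ∀ k : ℕ, 1 ≤ k → |f k| ≤ C * (k : ℝ) ^ n) :
    ∃ P : Polynomial ℝ, P.natDegree ≤ n ∧ ∀ t, 0 < t → f t = P.eval t := by
  obtain ⟨P, hP1⟩ := hP 1 one_pos
  simp only [one_mul] at hP1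
  refine ⟨P, ?_, ?_⟩
  · by_contra hn
    have hn := not_le.1 hn
    have hd : (Polynomial.X ^ n : Polynomial ℝ).degree < P.degree := by
      rw [Polynomial.degree_X_pow]
      rw [Polynomial.degree_eq_natDegree (by rintro rfl; simp at hn)]
      exact_mod_cast hn
    have h1 := Polynomial.abs_div_tendsto_atTop_atTop_of_degree_gt P (Polynomial.X ^ n) hd
      (pow_ne_zero _ Polynomial.X_ne_zero)
    have h2 := h1.comp (tendsto_natCast_atTop_atTop (R := ℝ))
    have h3 := (h2.eventually (eventually_gt_atTop C)).and (eventually_ge_atTop 1)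
    obtain ⟨k, hk, hk1⟩ := h3.exists
    have hk0 : (0 : ℝ) < k := by exact_mod_cast hk1
    simp only [Function.comp, Polynomial.eval_pow, Polynomial.eval_X, abs_div] at hk
    rw [abs_of_pos (pow_pos hk0 n), lt_div_iff₀ (pow_pos hk0 n), ← hP1] at hk
    exact absurd (hC k hk1) (not_le.2 hk)
  · have hrat : ∀ q k : ℕ, 0 < q → f ((k : ℝ) / q) = P.eval ((k : ℝ) / q) := by
      intro q k hq
      have hq' : (q : ℝ) ≠ 0 := by positivity
      obtain ⟨R, hR⟩ := hP (1 / q) (by positivity)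
      have e : R.comp (Polynomial.C (q : ℝ) * Polynomial.X) = P := by
        refine poly_eq_of_nat fun j => ?_
        rw [← hP1]
        simp only [Polynomial.eval_comp, Polynomial.eval_mul, Polynomial.eval_C, Polynomial.eval_X]
        have := hR (q * j)
        push_cast at this
        rw [← this]
        congr 1
        field_simp
      rw [← e]
      simp only [Polynomial.eval_comp, Polynomial.eval_mul, Polynomial.eval_C, Polynomial.eval_X]
      rw [mul_div_cancel₀ _ hq', ← hR]
      congr 1
      ring
    have hE : Set.EqOn f (fun t => P.eval t)
        (Set.Ioi 0 ∩ Set.range (fun r : ℚ => (r : ℝ))) := by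
      rintro _ ⟨hr, r, rfl⟩
      have hr' : 0 < r := by simpa using hr
      have hn : 0 ≤ r.num := (Rat.num_pos.2 hr').le
      have e : (r : ℝ) = ((r.num.toNat : ℕ) : ℝ) / (r.den : ℝ) := by
        rw [← Int.cast_natCast (R := ℝ) r.num.toNat, Int.toNat_of_nonneg hn]
        exact Rat.cast_def r
      simp only
      rw [e]
      exact hrat _ _ r.den_pos
    exact hE.of_subset_closure hf P.continuous.continuousOn Set.inter_subset_left
      (Dense.open_subset_closure_inter Rat.denseRange_cast isOpen_Ioi)

/-! ### Epi-convergence -/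

theorem le_liminf_coe {a : ℝ} {w : ℕ → ℝ} (h : ∀ b < a, ∀ᶠ k in atTop, b < w k) :
    (a : EReal) ≤ liminf (fun k => ((w k : ℝ) : EReal)) atTop := by
  rw [le_liminf_iff]
  intro y hy
  obtain ⟨b, hb1, hb2⟩ := EReal.lt_iff_exists_real_btwn.1 hy
  filter_upwards [h b (by exact_mod_cast hb2)] with k hk
  exact hb1.trans (by exact_mod_cast hk)

theorem liminf_coe_le {a : ℝ} {w : ℕ → ℝ}
    (h : (a : EReal) ≤ liminf (fun k => ((w k : ℝ) : EReal)) atTop) :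
    ∀ b < a, ∀ᶠ k in atTop, b < w k := by
  rw [le_liminf_iff] at h
  intro b hb
  filter_upwards [h b (by exact_mod_cast hb)] with k hk
  exact_mod_cast hk

theorem epi_of_tendsto {n : ℕ} {vk : ℕ → Vn n → ℝ} {v : Vn n → ℝ}
    (h : ∀ (x : Vn n) (xk : ℕ → Vn n), Tendsto xk atTop (𝓝 x) →
      Tendsto (fun k => vk k (xk k)) atTop (𝓝 (v x))) : EpiConvergesR vk v := by
  intro x
  refine ⟨fun xk hx => le_liminf_coe fun b hb => (h x xk hx).eventually (lt_mem_nhds hb), ?_⟩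
  exact ⟨fun _ => x, tendsto_const_nhds, h x _ tendsto_const_nhds⟩

theorem epi_of_mono {n : ℕ} {vk : ℕ → Vn n → ℝ} {v : Vn n → ℝ}
    (hc : ∀ k, Continuous (vk k)) (hm : Monotone vk)
    (h : ∀ x, Tendsto (fun k => vk k x) atTop (𝓝 (v x))) : EpiConvergesR vk v := by
  intro x
  refine ⟨fun xk hx => le_liminf_coe fun b hb => ?_, fun _ => x, tendsto_const_nhds, h x⟩
  obtain ⟨j, hj⟩ := ((h x).eventually (lt_mem_nhds hb)).exists
  have h1 : Tendsto (fun k => vk j (xk k)) atTop (𝓝 (vk j x)) := ((hc j).tendsto x).comp hx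
  filter_upwards [h1.eventually (lt_mem_nhds hj), eventually_ge_atTop j] with k hk hjk
  exact hk.trans_le (hm hjk (xk k))

theorem epi_smul {n : ℕ} {vk : ℕ → Vn n → ℝ} {v : Vn n → ℝ} {c : ℝ} (hc : 0 < c)
    (h : EpiConvergesR vk v) : EpiConvergesR (fun k x => c * vk k x) (fun x => c * v x) := by
  intro x
  obtain ⟨h1, xk, h2, h3⟩ := h x
  refine ⟨fun yk hy => le_liminf_coe fun b hb => ?_, xk, h2, h3.const_mul c⟩
  have := liminf_coe_le (h1 yk hy) (b / c) (by rw [div_lt_iff₀ hc]; linarith)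
  filter_upwards [this] with k hk
  rw [div_lt_iff₀ hc] at hk
  linarith

theorem ConvFin_continuous {n : ℕ} {v : Vn n → ℝ} (hv : v ∈ ConvFin n) : Continuous v := by
  have : ConvexOn ℝ Set.univ v := hv
  exact continuousOn_univ.1 (this.continuousOn isOpen_univ)

theorem ConvFin_smul {n : ℕ} {v : Vn n → ℝ} (hv : v ∈ ConvFin n) {c : ℝ} (hc : 0 ≤ c) :
    (fun x => c * v x) ∈ ConvFin n := by
  have : ConvexOn ℝ Set.univ v := hv
  exact this.smul hc

theorem ConvFin_affine {n : ℕ} {v : Vn n → ℝ} (hv : v ∈ ConvFin n) (l : Vn n →ₗ[ℝ] ℝ) (c : ℝ) :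
    (fun x => v x + l x + c) ∈ ConvFin n := by
  have h : ConvexOn ℝ Set.univ v := hv
  exact (h.add (l.convexOn convex_univ)).add_const c

theorem continuousOn_scale {n : ℕ} {Z : (Vn n → ℝ) → ℝ} (hcont : ContinuousValR (ConvFin n) Z)
    {v : Vn n → ℝ} (hv : v ∈ ConvFin n) :
    ContinuousOn (fun t : ℝ => Z (fun x => t * v x)) (Set.Ioi 0) := by
  rw [continuousOn_iff_continuous_domRestrict, continuous_iff_seqContinuous]
  intro tk t ht
  refine hcont _ _ (fun k => ConvFin_smul hv (tk k).2.le) (ConvFin_smul hv t.2.le) ?_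
  refine epi_of_tendsto fun x xk hx => ?_
  exact ((continuous_subtype_val.tendsto t).comp ht).mul
    (((ConvFin_continuous hv).tendsto x).comp hx)

/-! ### Growth -/

/-- Convex functions whose slope in the `i`-th coordinate lies in `[0, p i]`. -/
def Box {n : ℕ} (p : Fin n → ℝ) : Set (Vn n → ℝ) :=
  {v | v ∈ ConvFin n ∧ ∀ i x s, 0 ≤ s →
    v x ≤ v (x + s • EuclideanSpace.single i (1 : ℝ)) ∧
    v (x + s • EuclideanSpace.single i (1 : ℝ)) ≤ v x + p i * s}

theorem Box_lip {n : ℕ} {v : Vn n → ℝ} (hv : v ∈ Box (fun _ => 1)) (x y : Vn n) :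
    |v y - v x| ≤ n * ‖y - x‖ := by
  have step : ∀ i x (s : ℝ), |v (x + s • EuclideanSpace.single i (1 : ℝ)) - v x| ≤ |s| := by
    intro i x s
    rcases le_total 0 s with hs | hs
    · have := hv.2 i x s hs
      rw [abs_of_nonneg hs, abs_le]
      constructor <;> linarith
    · have := hv.2 i (x + s • EuclideanSpace.single i (1 : ℝ)) (-s) (by linarith)
      rw [neg_smul, add_neg_cancel_right] at this
      rw [abs_of_nonpos hs, abs_le]
      constructor <;> linarith
  have tele : ∀ T : Finset (Fin n), |v (x + ∑ i ∈ T, (y - x) i • EuclideanSpace.single i (1 : ℝ))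
      - v x| ≤ ∑ i ∈ T, |(y - x) i| := by
    intro T
    induction T using Finset.induction_on with
    | empty => simp
    | insert i T hi ih =>
      rw [Finset.sum_insert hi, Finset.sum_insert hi]
      have := step i (x + ∑ i ∈ T, (y - x) i • EuclideanSpace.single i (1 : ℝ)) ((y - x) i)
      rw [add_assoc, add_comm (∑ i ∈ T, _)] at this
      calc _ ≤ _ := abs_sub_le _ (v (x + ∑ i ∈ T, (y - x) i • EuclideanSpace.single i (1 : ℝ))) _
        _ ≤ _ := add_le_add this ih
  have h1 := tele Finset.univ
  have e : ∑ i, (y - x) i • EuclideanSpace.single i (1 : ℝ) = y - x := by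
    ext j
    simp [Pi.single_apply]
  rw [e, add_sub_cancel] at h1
  refine h1.trans ?_
  calc ∑ i, |(y - x) i| ≤ ∑ _i : Fin n, ‖y - x‖ :=
        Finset.sum_le_sum fun i _ => by
          rw [← Real.norm_eq_abs]; exact PiLp.norm_apply_le (y - x) i
    _ = n * ‖y - x‖ := by simp

theorem Box_one_bound {n : ℕ} {Z : (Vn n → ℝ) → ℝ} (hcont : ContinuousValR (ConvFin n) Z)
    (hinv : DuallyEpiTranslationInvariant (ConvFin n) Z) :
    ∃ C : ℝ, 0 ≤ C ∧ ∀ v ∈ Box (n := n) (fun _ => 1), |Z v| ≤ C := by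
  by_contra hcon
  push Not at hcon
  have h1 : ∀ k : ℕ, ∃ v ∈ Box (n := n) (fun _ => 1), v 0 = 0 ∧ (k : ℝ) < |Z v| := by
    intro k
    obtain ⟨v, hv, hk⟩ := hcon k (by positivity)
    refine ⟨fun x => v x + (0 : Vn n →ₗ[ℝ] ℝ) x + (- v 0), ⟨ConvFin_affine hv.1 _ _, ?_⟩, by simp, ?_⟩
    · intro i x s hs
      have := hv.2 i x s hs
      simp only [LinearMap.zero_apply]
      constructor <;> linarith
    · rw [hinv v hv.1]; exact hk
  choose w hw hw0 hwZ using h1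
  -- dense sequence
  let q : ℕ → Vn n := TopologicalSpace.denseSeq (Vn n)
  let K : Set (ℕ → ℝ) := Set.univ.pi fun j => Set.Icc (-(n * ‖q j‖)) (n * ‖q j‖)
  have hK : IsCompact K := isCompact_univ_pi fun j => isCompact_Icc
  obtain ⟨L, -, φ, hφ, hL⟩ := hK.tendsto_subseq (x := fun k j => w k (q j)) (by
    intro k j _
    have := Box_lip (hw k) 0 (q j)
    rw [hw0, sub_zero, sub_zero] at this
    exact abs_le.1 this)
  rw [tendsto_pi_nhds] at hL
  have hcau : ∀ x, CauchySeq (fun k => w (φ k) x) := by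
    intro x
    rw [Metric.cauchySeq_iff']
    intro ε hε
    have hδ : 0 < ε / (4 * (n + 1)) := by positivity
    obtain ⟨j, hj⟩ := (TopologicalSpace.denseRange_denseSeq (Vn n)).exists_dist_lt x hδ
    obtain ⟨N, hN⟩ := Metric.cauchySeq_iff'.1 (hL j).cauchySeq (ε / 4) (by positivity)
    refine ⟨N, fun k hk => ?_⟩
    have a1 := hN k hk
    have a2 : ∀ k, |w (φ k) x - w (φ k) (q j)| ≤ ε / 4 := by
      intro k
      refine (Box_lip (hw (φ k)) (q j) x).trans ?_
      rw [dist_eq_norm] at hj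
      have hn : (n : ℝ) * ‖x - q j‖ ≤ (n + 1) * (ε / (4 * (n + 1))) := by
        apply mul_le_mul _ hj.le (norm_nonneg _) (by positivity)
        linarith
      refine hn.trans (le_of_eq ?_)
      field_simp
    have a3 := a2 k
    have a4 := a2 N
    simp only [Function.comp, Real.dist_eq] at a1 ⊢
    rw [abs_le] at a3 a4
    rw [abs_lt] at a1 ⊢
    constructor <;> linarith
  choose v hv using fun x => cauchySeq_tendsto_of_complete (hcau x)
  have hvc : v ∈ ConvFin n := by
    refine ⟨convex_univ, fun x _ y _ a b ha hb hab => ?_⟩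
    refine le_of_tendsto_of_tendsto' (hv _) (((hv x).const_mul a).add ((hv y).const_mul b)) ?_
    intro k
    exact (hw (φ k)).1.2 (Set.mem_univ x) (Set.mem_univ y) ha hb hab
  have hepi : EpiConvergesR (fun k => w (φ k)) v := by
    refine epi_of_tendsto fun x xk hx => ?_
    have : Tendsto (fun k => w (φ k) (xk k) - w (φ k) x) atTop (𝓝 0) := by
      have hx0 : Tendsto (fun k => (n : ℝ) * ‖xk k - x‖) atTop (𝓝 0) := by
        have := (tendsto_iff_norm_sub_tendsto_zero.1 hx).const_mul (n : ℝ)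
        simpa using this
      exact squeeze_zero_norm (fun k => Box_lip (hw (φ k)) x (xk k)) hx0
    simpa using this.add (hv x)
  have hZ := hcont _ v (fun k => (hw (φ k)).1) hvc hepi
  obtain ⟨k, hk1, hk2⟩ := ((hZ.abs.eventually (gt_mem_nhds (lt_add_one |Z v|))).and
    ((tendsto_natCast_atTop_atTop (R := ℝ)).eventually (eventually_ge_atTop (|Z v| + 1)))).exists
  have h3 := hwZ (φ k)
  have h4 : (k : ℝ) ≤ φ k := by exact_mod_cast hφ.le_apply
  linarith

theorem descend_of_unbdd {n : ℕ} {u : Vn n → ℝ} (hu : u ∈ ConvFin n) (e x₀ : Vn n)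
    (hb : ¬ BddBelow ((fun s : ℝ => u (x₀ + s • e)) '' Set.Ici 0)) (x : Vn n) (s : ℝ)
    (hs : 0 ≤ s) : u (x + s • e) ≤ u x := by
  have hc := ConvFin_continuous hu
  have hex : ∀ m : ℕ, ∃ T : ℝ, (m : ℝ) < T ∧ u (x₀ + T • e) < u x₀ := by
    intro m
    have hcomp : BddBelow ((fun s : ℝ => u (x₀ + s • e)) '' Set.Icc 0 m) :=
      (isCompact_Icc.image (by fun_prop)).bddBelow
    obtain ⟨b, hb'⟩ := hcomp
    rw [not_bddBelow_iff] at hb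
    obtain ⟨_, ⟨T, hT, rfl⟩, hlt⟩ := hb (min b (u x₀))
    refine ⟨T, ?_, hlt.trans_le (min_le_right _ _)⟩
    by_contra hcon
    have := hb' ⟨T, ⟨hT, not_lt.1 hcon⟩, rfl⟩
    exact absurd (this.trans_lt hlt) (not_lt.2 (min_le_left _ _))
  choose T hT hTu using hex
  have hTt : Tendsto T atTop atTop :=
    tendsto_atTop_mono (fun m => (hT m).le) tendsto_natCast_atTop_atTop
  have hl : Tendsto (fun m => s / T m) atTop (𝓝 0) := hTt.const_div_atTop s
  have h1 : Tendsto (fun m => u (x + s • e + (s / T m) • (x₀ - x))) atTop (𝓝 (u (x + s • e))) := by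
    have : Tendsto (fun m => x + s • e + (s / T m) • (x₀ - x)) atTop
        (𝓝 (x + s • e + (0 : ℝ) • (x₀ - x))) := tendsto_const_nhds.add (hl.smul_const _)
    rw [zero_smul, add_zero] at this
    exact (hc.tendsto _).comp this
  have h2 : Tendsto (fun m => (1 - s / T m) * u x + (s / T m) * u x₀) atTop (𝓝 (u x)) := by
    have := ((tendsto_const_nhds (x := (1 : ℝ))).sub hl).mul_const (u x)
    have := this.add (hl.mul_const (u x₀))
    simpa using this
  refine le_of_tendsto_of_tendsto h1 h2 ?_
  filter_upwards [eventually_ge_atTop (Nat.ceil s + 1)] with m hm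
  have hmT := hT m
  have hms : s + 1 ≤ m := by
    have : s ≤ Nat.ceil s := Nat.le_ceil s
    have : ((Nat.ceil s + 1 : ℕ) : ℝ) ≤ m := by exact_mod_cast hm
    push_cast at this
    linarith
  have hT0 : 0 < T m := by linarith
  have hle : s / T m ≤ 1 := by rw [div_le_one hT0]; linarith
  have h0 : 0 ≤ s / T m := by positivity
  have := hu.2 (Set.mem_univ x) (Set.mem_univ (x₀ + T m • e)) (sub_nonneg.2 hle) h0 (by ring)
  have e1 : (1 - s / T m) • x + (s / T m) • (x₀ + T m • e)
      = x + s • e + (s / T m) • (x₀ - x) := by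
    have : s • e = (s / T m) • (T m • e) := by rw [smul_smul, div_mul_cancel₀ _ hT0.ne']
    rw [this]
    module
  rw [e1] at this
  refine this.trans ?_
  simp only [smul_eq_mul]
  have := mul_le_mul_of_nonneg_left (hTu m).le h0
  linarith

theorem infB_slope {E : Type*} [AddCommGroup E] {B : Set E} {u : E → ℝ} {h : E} {a : ℝ}
    (hB : B.Nonempty) (hb : ∀ x, BddBelow (Set.range fun s : B => u (x + s)))
    (hu : ∀ x, u x + a ≤ u (x + h)) (x : E) : infB B u x + a ≤ infB B u (x + h) := by
  refine le_infB hB fun s hs => ?_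
  have h1 := infB_le (hb x) hs
  have h2 := hu (x + s)
  rw [add_right_comm] at h2
  linarith

/-- The set of multiples of `e` with coefficient in `X`. -/
def rayS {E : Type*} [AddCommGroup E] [Module ℝ E] (e : E) (X : Set ℝ) : Set E :=
  (fun s : ℝ => s • e) '' X

theorem rayS_convex {E : Type*} [AddCommGroup E] [Module ℝ E] (e : E) {X : Set ℝ}
    (hX : Convex ℝ X) : Convex ℝ (rayS e X) := by
  rintro _ ⟨s, hs, rfl⟩ _ ⟨t, ht, rfl⟩ a b ha hb hab
  refine ⟨a • s + b • t, hX hs ht ha hb hab, ?_⟩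
  simp only [smul_eq_mul]
  module

theorem Box_step {n : ℕ} {Z : (Vn n → ℝ) → ℝ} (hval : IsValuationR (ConvFin n) Z)
    (hinv : DuallyEpiTranslationInvariant (ConvFin n) Z)
    (p : Fin n → ℝ) (i : Fin n) (q C₁ C₂ : ℝ) (hC₁ : 0 ≤ C₁) (hC₂ : 0 ≤ C₂)
    (b₁ : ∀ v ∈ Box (Function.update p i 1), |Z v| ≤ C₁)
    (b₂ : ∀ v ∈ Box (Function.update p i q), |Z v| ≤ C₂) :
    ∀ v ∈ Box (Function.update p i (q + 1)), |Z v| ≤ C₂ + 2 * C₁ := by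
  classical
  intro v hv
  set e : Vn n := EuclideanSpace.single i (1 : ℝ) with he
  let π : Vn n →ₗ[ℝ] ℝ := (EuclideanSpace.proj (𝕜 := ℝ) i : Vn n →L[ℝ] ℝ).toLinearMap
  have hπe : ∀ (x : Vn n) (s : ℝ), π (x + s • e) = π x + s := by
    intro x s
    simp [π, he]
  have hπj : ∀ (x : Vn n) (s : ℝ) (j : Fin n), j ≠ i →
      π (x + s • EuclideanSpace.single j (1 : ℝ)) = π x := by
    intro x s j hj
    simp [π, hj.symm]
  -- membership helper
  have hbox : ∀ (r : ℝ) (w : Vn n → ℝ), w ∈ ConvFin n →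
      (∀ j, j ≠ i → ∀ x s, 0 ≤ s → w x ≤ w (x + s • EuclideanSpace.single j (1 : ℝ)) ∧
        w (x + s • EuclideanSpace.single j (1 : ℝ)) ≤ w x + p j * s) →
      (∀ x s, 0 ≤ s → w x ≤ w (x + s • e) ∧ w (x + s • e) ≤ w x + r * s) →
      w ∈ Box (Function.update p i r) := by
    intro r w hw hj hi
    refine ⟨hw, fun j x s hs => ?_⟩
    by_cases h : j = i
    · subst h; simpa using hi x s hs
    · simpa [h] using hj j h x s hs
  let u : Vn n → ℝ := fun x => v x + (-π) x + 0
  have huc : u ∈ ConvFin n := ConvFin_affine hv.1 _ _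
  have hZu : Z u = Z v := hinv v hv.1 _ _
  have huj : ∀ j, j ≠ i → ∀ x s, 0 ≤ s → u x ≤ u (x + s • EuclideanSpace.single j (1 : ℝ)) ∧
        u (x + s • EuclideanSpace.single j (1 : ℝ)) ≤ u x + p j * s := by
    intro j hj x s hs
    have := hv.2 j x s hs
    rw [Function.update_of_ne hj] at this
    simp only [u, LinearMap.neg_apply, hπj x s j hj]
    constructor <;> linarith
  have hui : ∀ x s, 0 ≤ s → u x + (-s) ≤ u (x + s • e) ∧ u (x + s • e) ≤ u x + q * s := by
    intro x s hs
    have := hv.2 i x s hs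
    rw [Function.update_self] at this
    simp only [u, LinearMap.neg_apply, hπe]
    constructor <;> linarith
  -- adding `π` back
  have hback : ∀ w : Vn n → ℝ, w ∈ ConvFin n → 
      (∀ j, j ≠ i → ∀ x s, 0 ≤ s → w x ≤ w (x + s • EuclideanSpace.single j (1 : ℝ)) ∧
        w (x + s • EuclideanSpace.single j (1 : ℝ)) ≤ w x + p j * s) →
      (∀ x s, 0 ≤ s → w x + (-s) ≤ w (x + s • e) ∧ w (x + s • e) ≤ w x) → |Z w| ≤ C₁ := by
    intro w hw hj hi
    rw [← hinv w hw π 0]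
    refine b₁ _ (hbox 1 _ (ConvFin_affine hw _ _) ?_ ?_)
    · intro j hji x s hs
      have := hj j hji x s hs
      simp only [hπj x s j hji]
      constructor <;> linarith
    · intro x s hs
      have := hi x s hs
      simp only [hπe]
      constructor <;> linarith
  by_cases hbP : ∃ x₀, ¬ BddBelow ((fun s : ℝ => u (x₀ + s • e)) '' Set.Ici 0)
  · obtain ⟨x₀, hx₀⟩ := hbP
    have hd := descend_of_unbdd huc e x₀ hx₀
    rw [← hZu]
    have := hback u huc huj fun x s hs => ⟨(hui x s hs).1, hd x s hs⟩
    linarith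
  by_cases hbN : ∃ x₀, ¬ BddBelow ((fun s : ℝ => u (x₀ + s • (-e))) '' Set.Ici 0)
  · obtain ⟨x₀, hx₀⟩ := hbN
    have hd := descend_of_unbdd huc (-e) x₀ hx₀
    rw [← hZu]
    have := b₂ u (hbox q u huc huj fun x s hs => ⟨?_, (hui x s hs).2⟩)
    · linarith
    · have := hd (x + s • e) s hs
      rwa [smul_neg, add_neg_cancel_right] at this
  push Not at hbP hbN
  have hO : rayS e Set.univ = rayS e (Set.Iic 0) ∪ rayS e (Set.Ici 0) := by
    simp only [rayS]
    rw [← Set.image_union, Set.Iic_union_Ici]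
  have hb : ∀ x, BddBelow (Set.range fun s : rayS e Set.univ => u (x + s)) := by
    intro x
    refine ((hbP x).union (hbN x)).mono ?_
    rintro _ ⟨⟨_, s, -, rfl⟩, rfl⟩
    rcases le_total 0 s with h | h
    · exact Or.inl ⟨s, h, rfl⟩
    · exact Or.inr ⟨-s, by simpa using h, by simp⟩
  have hbX : ∀ X : Set ℝ, ∀ x, BddBelow (Set.range fun s : rayS e X => u (x + s)) := by
    intro X x
    refine (hb x).mono ?_
    rintro _ ⟨⟨_, s, hs, rfl⟩, rfl⟩
    exact ⟨⟨s • e, s, trivial, rfl⟩, rfl⟩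
  have hne : ∀ X : Set ℝ, (0 : ℝ) ∈ X → (rayS e X).Nonempty := fun X h => ⟨_, 0, h, rfl⟩
  have key := cut_relation (Z := Z) (fun u v => hval u v) (u := u) huc (BI := {0}) hO
    (by rw [Set.singleton_subset_iff]; exact ⟨0, by simp, by simp⟩)
    (by rw [Set.singleton_subset_iff]; exact ⟨0, by simp, by simp⟩)
    (Set.singleton_nonempty 0) (convex_singleton 0)
    (rayS_convex e (convex_Iic 0)) (rayS_convex e (convex_Ici 0)) (rayS_convex e convex_univ)
    (by
      rintro _ ⟨s, hs, rfl⟩ _ ⟨t, ht, rfl⟩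
      have hs : s ≤ 0 := hs
      have ht : 0 ≤ t := ht
      rcases hs.lt_or_eq with h | h
      · have hp : 0 < t - s := by linarith
        refine ⟨t / (t - s), -s / (t - s), div_nonneg ht hp.le, div_nonneg (by linarith) hp.le, 
          ?_, ?_⟩
        · field_simp
          ring
        · simp only [Set.mem_singleton_iff, smul_smul, ← add_smul]
          have : t / (t - s) * s + -s / (t - s) * t = 0 := by field_simp; ring
          rw [this, zero_smul]
      · exact ⟨1, 0, by norm_num, le_rfl, by norm_num, by simp [h]⟩)
    hb
  have hI : infB {0} u = u := by
    funext x
    simp [infB]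
  rw [hI, hZu] at key
  have hconv : ∀ X : Set ℝ, Convex ℝ X → (0 : ℝ) ∈ X → infB (rayS e X) u ∈ ConvFin n :=
    fun X hX h0 => infB_convexOn huc (rayS_convex e hX) (hne X h0) (hbX X)
  have hupper : ∀ X : Set ℝ, (0 : ℝ) ∈ X → ∀ (h : Vn n) (a : ℝ), (∀ x, u (x + h) ≤ u x + a) →
      ∀ x, infB (rayS e X) u (x + h) ≤ infB (rayS e X) u x + a := by
    intro X h0 h a hu x
    have := infB_slope (h := -h) (a := -a) (hne X h0) (hbX X) (fun x => by
      have := hu (x + -h)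
      rw [neg_add_cancel_right] at this
      linarith) (x + h)
    rw [add_neg_cancel_right] at this
    linarith
  have hj : ∀ X : Set ℝ, (0 : ℝ) ∈ X → ∀ j, j ≠ i → ∀ x s, 0 ≤ s →
      infB (rayS e X) u x ≤ infB (rayS e X) u (x + s • EuclideanSpace.single j (1 : ℝ)) ∧
      infB (rayS e X) u (x + s • EuclideanSpace.single j (1 : ℝ))
        ≤ infB (rayS e X) u x + p j * s := by
    intro X h0 j hji x s hs
    constructor
    · have := infB_slope (a := 0) (hne X h0) (hbX X) 
        (fun x => by have := (huj j hji x s hs).1; rwa [add_zero]) x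
      rwa [add_zero] at this
    · exact hupper X h0 _ _ (fun x => (huj j hji x s hs).2) x
  have hup : ∀ X : Set ℝ, (0 : ℝ) ∈ X → (∀ a ∈ X, ∀ s : ℝ, 0 ≤ s → a + s ∈ X) →
      ∀ (x : Vn n) (s : ℝ), 0 ≤ s → infB (rayS e X) u x ≤ infB (rayS e X) u (x + s • e) := by
    intro X h0 hX x s hs
    refine le_infB (hne X h0) ?_
    rintro _ ⟨a, ha, rfl⟩
    have := infB_le (hbX X x) (s := (a + s) • e) ⟨_, hX a ha s hs, rfl⟩
    rwa [show x + (a + s) • e = x + s • e + a • e by module] at this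
  have hdown : ∀ X : Set ℝ, (0 : ℝ) ∈ X → (∀ a ∈ X, ∀ s : ℝ, 0 ≤ s → a - s ∈ X) →
      ∀ (x : Vn n) (s : ℝ), 0 ≤ s → infB (rayS e X) u (x + s • e) ≤ infB (rayS e X) u x := by
    intro X h0 hX x s hs
    refine le_infB (hne X h0) ?_
    rintro _ ⟨a, ha, rfl⟩
    have := infB_le (hbX X (x + s • e)) (s := (a - s) • e) ⟨_, hX a ha s hs, rfl⟩
    rwa [show x + s • e + (a - s) • e = x + a • e by module] at this
  have B1 : |Z (infB (rayS e (Set.Iic 0)) u)| ≤ C₁ := by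
    refine hback _ (hconv _ (convex_Iic 0) (by simp)) (hj (Set.Iic 0) (by simp)) fun x s hs => ⟨?_, ?_⟩
    · exact infB_slope (hne _ (by simp)) (hbX _) (fun x => (hui x s hs).1) x
    · refine hdown _ (by simp) ?_ x s hs
      intro a ha s hs
      simp only [Set.mem_Iic] at ha ⊢
      linarith
  have B2 : |Z (infB (rayS e (Set.Ici 0)) u)| ≤ C₂ := by
    refine b₂ _ (hbox q _ (hconv _ (convex_Ici 0) (by simp)) (hj (Set.Ici 0) (by simp))
      fun x s hs => ⟨?_, ?_⟩)
    · refine hup _ (by simp) ?_ x s hs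
      intro a ha s hs
      simp only [Set.mem_Ici] at ha ⊢
      linarith
    · exact hupper _ (by simp) _ _ (fun x => (hui x s hs).2) x
  have B3 : |Z (infB (rayS e Set.univ) u)| ≤ C₁ := by
    refine hback _ (hconv _ convex_univ (by simp)) (hj Set.univ (by simp)) fun x s hs => ⟨?_, ?_⟩
    · exact infB_slope (hne _ (by simp)) (hbX _) (fun x => (hui x s hs).1) x
    · exact hdown Set.univ (by simp) (fun _ _ _ _ => trivial) x s hs
  have : Z v = Z (infB (rayS e (Set.Iic 0)) u) + Z (infB (rayS e (Set.Ici 0)) u)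
      - Z (infB (rayS e Set.univ) u) := by linarith
  rw [this]
  rw [abs_le] at B1 B2 B3 ⊢
  constructor <;> linarith

theorem Box_mult {n : ℕ} {Z : (Vn n → ℝ) → ℝ} (hval : IsValuationR (ConvFin n) Z)
    (hinv : DuallyEpiTranslationInvariant (ConvFin n) Z)
    (p : Fin n → ℝ) (i : Fin n) (C : ℝ) (hC : 0 ≤ C)
    (b : ∀ v ∈ Box (Function.update p i 1), |Z v| ≤ C) (q : ℕ) (hq : 1 ≤ q) :
    ∀ v ∈ Box (Function.update p i (q : ℝ)), |Z v| ≤ 2 * q * C := by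
  induction q, hq using Nat.le_induction with
  | base =>
    intro v hv
    have := b v (by simpa using hv)
    push_cast
    linarith
  | succ q hq ih =>
    intro v hv
    push_cast at hv ⊢
    have := Box_step hval hinv p i q C (2 * q * C) hC (by positivity) b ih v hv
    linarith

theorem Box_all {n : ℕ} {Z : (Vn n → ℝ) → ℝ} (hval : IsValuationR (ConvFin n) Z)
    (hinv : DuallyEpiTranslationInvariant (ConvFin n) Z) (C : ℝ) (hC : 0 ≤ C)
    (b : ∀ v ∈ Box (n := n) (fun _ => 1), |Z v| ≤ C) (q : ℕ) (hq : 1 ≤ q) :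
    ∀ v ∈ Box (n := n) (fun _ => (q : ℝ)), |Z v| ≤ (2 * q) ^ n * C := by
  have main : ∀ T : Finset (Fin n), ∀ v ∈ Box (n := n) (fun j => if j ∈ T then (q : ℝ) else 1),
      |Z v| ≤ (2 * q) ^ T.card * C := by
    intro T
    induction T using Finset.induction_on with
    | empty => simpa using b
    | insert i T hi ih =>
      rw [Finset.card_insert_of_notMem hi]
      have e1 : Function.update (fun j => if j ∈ T then (q : ℝ) else 1) i 1
          = fun j => if j ∈ T then (q : ℝ) else 1 := by
        rw [Function.update_eq_self_iff]; simp [hi]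
      have e2 : Function.update (fun j => if j ∈ T then (q : ℝ) else 1) i (q : ℝ)
          = fun j => if j ∈ insert i T then (q : ℝ) else 1 := by
        funext j
        by_cases h : j = i
        · subst h; simp
        · simp [h]
      have := Box_mult hval hinv (fun j => if j ∈ T then (q : ℝ) else 1) i ((2 * q) ^ T.card * C)
        (by positivity) (by rw [e1]; exact ih) q hq
      rw [e2] at this
      intro v hv
      refine (this v hv).trans (le_of_eq ?_)
      ring
  have := main Finset.univ
  simpa using this

/-- The function `y ↦ max(0, y_1, …, y_d)`. -/
def cornerMax {d : ℕ} (y : Fin d → ℝ) : ℝ := Finset.univ.fold max 0 y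

theorem cornerMax_is (d : ℕ) : IsCornerMax (cornerMax (d := d)) where
  nonneg y := (Finset.le_fold_max _).2 (Or.inl le_rfl)
  le y i := (Finset.le_fold_max _).2 (Or.inr ⟨i, Finset.mem_univ i, le_rfl⟩)
  least y c hc h := (Finset.fold_max_le _).2 ⟨hc, fun i _ => h i⟩

theorem convexOn_comp_aff {n d : ℕ} (l : Fin d → Vn n →ₗ[ℝ] ℝ) (c : Fin d → ℝ)
    {w : (Fin d → ℝ) → ℝ} (hw : ConvexOn ℝ Set.univ w) :
    (fun x => w (fun i => l i x + c i)) ∈ ConvFin n := by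
  refine ⟨convex_univ, fun x _ y _ a b ha hb hab => ?_⟩
  have := hw.2 (Set.mem_univ (fun i => l i x + c i)) (Set.mem_univ (fun i => l i y + c i)) ha hb hab
  refine le_trans (le_of_eq ?_) this
  refine congrArg w ?_
  funext i
  simp only [map_add, map_smul, smul_eq_mul, Pi.add_apply, Pi.smul_apply]
  have : c i = (a + b) * c i := by rw [hab, one_mul]
  linear_combination this

theorem scale_poly_corner {n d : ℕ} {Z : (Vn n → ℝ) → ℝ}
    (hval : IsValuationR (ConvFin n) Z)
    (hinv : DuallyEpiTranslationInvariant (ConvFin n) Z)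
    (l : Fin d → Vn n →ₗ[ℝ] ℝ) (c : Fin d → ℝ) (h : ℝ) (hh : 0 < h) :
    ∃ P : Polynomial ℝ, ∀ k : ℕ,
      Z (fun x => h * k * cornerMax (fun i => l i x + c i)) = P.eval (k : ℝ) := by
  let Z' : ((Fin d → ℝ) → ℝ) → ℝ := fun w => Z (fun x => h * w (fun i => l i x + c i))
  have hmem : ∀ w : (Fin d → ℝ) → ℝ, ConvexOn ℝ Set.univ w →
      (fun x => h * w (fun i => l i x + c i)) ∈ ConvFin n := fun w hw =>
    ConvFin_smul (convexOn_comp_aff l c hw) hh.le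
  have h1 : ∀ u v : (Fin d → ℝ) → ℝ, ConvexOn ℝ Set.univ u → ConvexOn ℝ Set.univ v →
      ConvexOn ℝ Set.univ (u ⊔ v) → ConvexOn ℝ Set.univ (u ⊓ v) →
      Z' (u ⊔ v) + Z' (u ⊓ v) = Z' u + Z' v := by
    intro u v hu hv hs hi
    have e1 : (fun x => h * (u ⊔ v) (fun i => l i x + c i))
      = (fun x => h * u (fun i => l i x + c i)) ⊔ (fun x => h * v (fun i => l i x + c i)) := by
      funext x
      simp only [Pi.sup_apply]
      exact mul_max_of_nonneg _ _ hh.le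
    have e2 : (fun x => h * (u ⊓ v) (fun i => l i x + c i))
      = (fun x => h * u (fun i => l i x + c i)) ⊓ (fun x => h * v (fun i => l i x + c i)) := by
      funext x
      simp only [Pi.inf_apply]
      exact mul_min_of_nonneg _ _ hh.le
    have := hval _ _ (hmem u hu) (hmem v hv) (e1 ▸ hmem _ hs) (e2 ▸ hmem _ hi)
    rw [← e1, ← e2] at this
    exact this
  have h2 : ∀ u, ConvexOn ℝ Set.univ u → ∀ L : (Fin d → ℝ) →ₗ[ℝ] ℝ,
      Z' (fun x => u x + L x) = Z' u := by
    intro u hu L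
    have := hinv _ (hmem u hu) (h • (L ∘ₗ LinearMap.pi l)) (h * L c)
    refine Eq.trans ?_ this
    show Z _ = Z _
    congr 1
    funext x
    have e : (fun i => l i x + c i) = LinearMap.pi l x + c := by
      funext i; simp
    rw [e]
    simp only [map_add, LinearMap.smul_apply, smul_eq_mul, LinearMap.comp_apply]
    ring
  obtain ⟨P, hP⟩ := poly_of_diff d (fun r => Z' (fun y => r * cornerMax y))
    (fun t t' ht ht' => simplex_diff h1 h2 (cornerMax_is d) ht ht')
  refine ⟨P, fun k => ?_⟩
  rw [← hP k]
  show Z _ = Z _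
  congr 1
  funext x
  ring

theorem growth_corner {n d : ℕ} {Z : (Vn n → ℝ) → ℝ}
    (hcont : ContinuousValR (ConvFin n) Z)
    (hval : IsValuationR (ConvFin n) Z)
    (hinv : DuallyEpiTranslationInvariant (ConvFin n) Z)
    (l : Fin d → Vn n →ₗ[ℝ] ℝ) (c : Fin d → ℝ) :
    ∃ C : ℝ, ∀ k : ℕ, 1 ≤ k →
      |Z (fun x => k * cornerMax (fun i => l i x + c i))| ≤ C * k ^ n := by
  classical
  obtain ⟨C, hC, hb⟩ := Box_one_bound hcont hinv
  obtain ⟨N, hN⟩ := exists_nat_ge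
    (∑ i : Fin d, ∑ j : Fin n, |l i (EuclideanSpace.single j (1 : ℝ))|)
  have hlN : ∀ i j, |l i (EuclideanSpace.single j (1 : ℝ))| ≤ ((N + 1 : ℕ) : ℝ) := by
    intro i j
    have h1 := Finset.single_le_sum (f := fun i => ∑ j : Fin n,
      |l i (EuclideanSpace.single j (1 : ℝ))|) (fun i _ => Finset.sum_nonneg fun j _ => abs_nonneg _)
      (Finset.mem_univ i)
    have h2 := Finset.single_le_sum (f := fun j => 
      |l i (EuclideanSpace.single j (1 : ℝ))|) (fun j _ => abs_nonneg _)
      (Finset.mem_univ j)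
    push_cast
    linarith
  set M := N + 1 with hM
  have hM0 : (0 : ℝ) ≤ M := by positivity
  let σ : (Fin d → ℝ) → ℝ := cornerMax
  have hσ : IsCornerMax σ := cornerMax_is d
  let v : Vn n → ℝ := fun x => σ (fun i => l i x + c i)
  have hvc : v ∈ ConvFin n := convexOn_comp_aff l c hσ.convexOn
  have hv1 : ∀ x j (s : ℝ), 0 ≤ s →
      v (x + s • EuclideanSpace.single j (1 : ℝ)) ≤ v x + M * s := by
    intro x j s hs
    refine hσ.least _ _ (add_nonneg (hσ.nonneg _) (by positivity)) fun i => ?_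
    have h1 := hσ.le (fun i => l i x + c i) i
    have h2 := mul_le_mul_of_nonneg_right ((abs_le.1 (hlN i j)).2) hs
    simp only [map_add, map_smul, smul_eq_mul]
    show _ ≤ σ (fun i => l i x + c i) + _
    linarith
  have hv2 : ∀ x j (s : ℝ), 0 ≤ s →
      v x ≤ v (x + s • EuclideanSpace.single j (1 : ℝ)) + M * s := by
    intro x j s hs
    refine hσ.least _ _ (add_nonneg (hσ.nonneg _) (by positivity)) fun i => ?_
    have h1 := hσ.le (fun i => l i (x + s • EuclideanSpace.single j (1 : ℝ)) + c i) i
    have h2 := mul_le_mul_of_nonneg_right ((abs_le.1 (hlN i j)).1) hs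
    simp only [map_add, map_smul, smul_eq_mul] at h1
    show _ ≤ σ (fun i => l i (x + s • EuclideanSpace.single j (1 : ℝ)) + c i) + _
    simp only [map_add, map_smul, smul_eq_mul]
    linarith
  let π : Vn n →ₗ[ℝ] ℝ := ∑ i, (EuclideanSpace.proj (𝕜 := ℝ) i : Vn n →L[ℝ] ℝ).toLinearMap
  have hπ : ∀ x j (s : ℝ), π (x + s • EuclideanSpace.single j (1 : ℝ)) = π x + s := by
    intro x j s
    rw [map_add, map_smul]
    simp [π, Pi.single_apply]
  refine ⟨(4 * M) ^ n * C, fun k hk => ?_⟩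
  have hkv : (fun x => (k : ℝ) * v x) ∈ ConvFin n := ConvFin_smul hvc (by positivity)
  have e := hinv _ hkv (((k : ℝ) * M) • π) 0
  have hbox : (fun x => (k : ℝ) * v x + (((k : ℝ) * M) • π) x + 0)
      ∈ Box (n := n) (fun _ => ((2 * M * k : ℕ) : ℝ)) := by
    refine ⟨ConvFin_affine hkv _ _, fun j x s hs => ?_⟩
    simp only [LinearMap.smul_apply, smul_eq_mul, hπ]
    have hk0 : (0 : ℝ) ≤ k := by positivity
    have h1 := mul_le_mul_of_nonneg_left (hv1 x j s hs) hk0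
    have h2 := mul_le_mul_of_nonneg_left (hv2 x j s hs) hk0
    push_cast
    constructor <;> nlinarith
  have := Box_all hval hinv C hC hb (2 * M * k) (by
    have : 0 < 2 * M * k := by positivity
    omega) _ hbox
  rw [e] at this
  refine this.trans (le_of_eq ?_)
  push_cast
  ring

theorem poly_corner {n d : ℕ} {Z : (Vn n → ℝ) → ℝ}
    (hcont : ContinuousValR (ConvFin n) Z)
    (hval : IsValuationR (ConvFin n) Z)
    (hinv : DuallyEpiTranslationInvariant (ConvFin n) Z)
    (l : Fin d → Vn n →ₗ[ℝ] ℝ) (c : Fin d → ℝ) :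
    ∃ P : Polynomial ℝ, P.natDegree ≤ n ∧ ∀ t > 0,
      Z (fun x => t * cornerMax (fun i => l i x + c i)) = P.eval t := by
  obtain ⟨C, hC⟩ := growth_corner hcont hval hinv l c
  exact poly_of_scales n (fun t => Z (fun x => t * cornerMax (fun i => l i x + c i)))
    (continuousOn_scale hcont (convexOn_comp_aff l c (cornerMax_is d).convexOn))
    (fun h hh => scale_poly_corner hval hinv l c h hh) C hC

/-- The Lagrange basis polynomials for the nodes `1, …, n+1`. -/
def LB (n j : ℕ) : Polynomial ℝ :=
  Lagrange.basis (Finset.range (n + 1)) (fun j : ℕ => (j : ℝ) + 1) j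

theorem LB_inj (n : ℕ) : Set.InjOn (fun j : ℕ => (j : ℝ) + 1) (Finset.range (n + 1)) := by
  intro a _ b _ h
  simpa using h

theorem LB_degree (n j : ℕ) (hj : j ∈ Finset.range (n + 1)) : (LB n j).natDegree < n + 1 := by
  have := Lagrange.natDegree_basis (LB_inj n) hj
  rw [LB, this]
  simp

theorem LB_eval (n : ℕ) (P : Polynomial ℝ) (hP : P.natDegree ≤ n) (t : ℝ) :
    P.eval t = ∑ j ∈ Finset.range (n + 1), P.eval ((j : ℝ) + 1) * (LB n j).eval t := by
  have hdeg : P.degree < (Finset.range (n + 1)).card := by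
    rw [Finset.card_range]
    refine lt_of_le_of_lt Polynomial.degree_le_natDegree ?_
    exact_mod_cast Nat.lt_succ_of_le hP
  have := Lagrange.eq_interpolate (LB_inj n) hdeg
  conv_lhs => rw [this]
  rw [Lagrange.interpolate_apply, Polynomial.eval_finset_sum]
  simp [LB]

theorem scale_lagrange {n : ℕ} {Z : (Vn n → ℝ) → ℝ}
    (hcont : ContinuousValR (ConvFin n) Z)
    (hval : IsValuationR (ConvFin n) Z)
    (hinv : DuallyEpiTranslationInvariant (ConvFin n) Z)
    {v : Vn n → ℝ} (hv : v ∈ ConvFin n) (t : ℝ) (ht : 0 < t) :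
    Z (fun x => t * v x) = ∑ j ∈ Finset.range (n + 1),
      Z (fun x => ((j : ℝ) + 1) * v x) * (LB n j).eval t := by
  have hvc : ConvexOn ℝ Set.univ v := hv
  obtain ⟨l, c, hle, hsup⟩ := ConvexOn.real_univ_sSup_of_nat_affine_eq
    (ConvFin_continuous hv).lowerSemicontinuous hvc
  have hle' : ∀ i x, l i x + c i ≤ v x := fun i x => hle i x
  have hlt : ∀ x b, b < v x → ∃ i, b < l i x + c i := by
    intro x b hb
    rw [← hsup, iSup_apply] at hb
    exact exists_lt_of_lt_ciSup hb
  let g : ℕ → Vn n → ℝ := fun k x =>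
    cornerMax (fun i : Fin k => (l i - l 0 : Vn n →L[ℝ] ℝ).toLinearMap x + (c i - c 0))
  let w : ℕ → Vn n → ℝ := fun k x => g k x + (l 0).toLinearMap x + c 0
  have hgc : ∀ k, g k ∈ ConvFin n := fun k => convexOn_comp_aff _ _ (cornerMax_is k).convexOn
  have hwc : ∀ k, w k ∈ ConvFin n := fun k => ConvFin_affine (hgc k) _ _
  have hwle : ∀ k x b, l 0 x + c 0 ≤ b → (∀ i : Fin k, l i x + c i ≤ b) → w k x ≤ b := by
    intro k x b h0 hi
    have : g k x ≤ b - (l 0 x + c 0) := by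
      refine (cornerMax_is k).least _ _ (by linarith) fun i => ?_
      have := hi i
      simp
      linarith
    show g k x + l 0 x + c 0 ≤ b
    linarith
  have hw0 : ∀ k x, l 0 x + c 0 ≤ w k x := by
    intro k x
    have : 0 ≤ g k x := (cornerMax_is k).nonneg _
    show _ ≤ g k x + l 0 x + c 0
    linarith
  have hwi : ∀ k x (i : ℕ), i < k → l i x + c i ≤ w k x := by
    intro k x i hi
    have : _ ≤ g k x := (cornerMax_is k).le _ ⟨i, hi⟩
    simp at this
    show _ ≤ g k x + l 0 x + c 0
    linarith
  have hmono : Monotone w := by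
    intro k m hkm x
    exact hwle _ _ _ (hw0 m x) fun i => hwi m x i (i.2.trans_le hkm)
  have hlim : ∀ x, Tendsto (fun k => w k x) atTop (𝓝 (v x)) := by
    intro x
    refine tendsto_order.2 ⟨fun b hb => ?_, fun b hb => Eventually.of_forall fun k => ?_⟩
    · obtain ⟨i, hi⟩ := hlt x b hb
      filter_upwards [eventually_gt_atTop i] with k hk
      exact hi.trans_le (hwi k x i hk)
    · exact (hwle k x _ (hle' 0 x) fun i => hle' i x).trans_lt hb
  have hepi : EpiConvergesR w v := epi_of_mono (fun k => ConvFin_continuous (hwc k)) hmono hlim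
  have hZt : ∀ s : ℝ, 0 < s →
      Tendsto (fun k => Z (fun x => s * w k x)) atTop (𝓝 (Z (fun x => s * v x))) := fun s hs =>
    hcont _ _ (fun k => ConvFin_smul (hwc k) hs.le) (ConvFin_smul hv hs.le) (epi_smul hs hepi)
  have hZw : ∀ k (s : ℝ), 0 < s → Z (fun x => s * w k x) = Z (fun x => s * g k x) := by
    intro k s hs
    rw [← hinv _ (ConvFin_smul (hgc k) hs.le) (s • (l 0).toLinearMap) (s * c 0)]
    congr 1
    funext x
    simp only [w, LinearMap.smul_apply, smul_eq_mul]
    ring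
  have hid : ∀ k, Z (fun x => t * w k x) = ∑ j ∈ Finset.range (n + 1),
      Z (fun x => ((j : ℝ) + 1) * w k x) * (LB n j).eval t := by
    intro k
    obtain ⟨P, hPd, hP⟩ := poly_corner hcont hval hinv
      (fun i : Fin k => (l i - l 0 : Vn n →L[ℝ] ℝ).toLinearMap) (fun i : Fin k => c i - c 0)
    rw [hZw k t ht, hP t ht, LB_eval n P hPd t]
    refine Finset.sum_congr rfl fun j _ => ?_
    have hj : (0 : ℝ) < (j : ℝ) + 1 := by positivity
    rw [hZw k _ hj, hP _ hj]
  refine tendsto_nhds_unique (hZt t ht) ?_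
  simp only [hid]
  exact tendsto_finset_sum _ fun j _ => (hZt _ (by positivity)).mul_const _

/-- The homogeneous components. -/
def comp {n : ℕ} (Z : (Vn n → ℝ) → ℝ) (i : ℕ) (v : Vn n → ℝ) : ℝ :=
  ∑ j ∈ Finset.range (n + 1), Z (fun x => ((j : ℝ) + 1) * v x) * (LB n j).coeff i

theorem scale_comp {n : ℕ} {Z : (Vn n → ℝ) → ℝ}
    (hcont : ContinuousValR (ConvFin n) Z)
    (hval : IsValuationR (ConvFin n) Z)
    (hinv : DuallyEpiTranslationInvariant (ConvFin n) Z)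
    {v : Vn n → ℝ} (hv : v ∈ ConvFin n) (t : ℝ) (ht : 0 < t) :
    Z (fun x => t * v x) = ∑ i ∈ Finset.range (n + 1), comp Z i v * t ^ i := by
  rw [scale_lagrange hcont hval hinv hv t ht]
  simp only [comp, Finset.sum_mul]
  rw [Finset.sum_comm]
  refine Finset.sum_congr rfl fun j hj => ?_
  rw [Polynomial.eval_eq_sum_range' (LB_degree n j hj), Finset.mul_sum]
  exact Finset.sum_congr rfl fun i _ => by ring

theorem comp_homog {n : ℕ} {Z : (Vn n → ℝ) → ℝ}
    (hcont : ContinuousValR (ConvFin n) Z)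
    (hval : IsValuationR (ConvFin n) Z)
    (hinv : DuallyEpiTranslationInvariant (ConvFin n) Z)
    {v : Vn n → ℝ} (hv : v ∈ ConvFin n) (r : ℝ) (hr : 0 < r) (i : ℕ)
    (hi : i ∈ Finset.range (n + 1)) :
    comp Z i (fun x => r * v x) = r ^ i * comp Z i v := by
  let P : Polynomial ℝ := ∑ i ∈ Finset.range (n + 1),
    Polynomial.monomial i (comp Z i (fun x => r * v x))
  let Q : Polynomial ℝ := ∑ i ∈ Finset.range (n + 1),
    Polynomial.monomial i (r ^ i * comp Z i v)
  have hPQ : P = Q := by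
    refine Polynomial.eq_of_infinite_eval_eq P Q ((Set.Ioi_infinite (0 : ℝ)).mono fun t ht => ?_)
    have ht : 0 < t := ht
    have h1 := scale_comp hcont hval hinv (ConvFin_smul hv hr.le) t ht
    have h2 := scale_comp hcont hval hinv hv (t * r) (by positivity)
    have e : (fun x => t * (r * v x)) = fun x => t * r * v x := by funext x; ring
    rw [e, h2] at h1
    simp only [Set.mem_setOf_eq, P, Q, Polynomial.eval_finset_sum, Polynomial.eval_monomial]
    rw [← h1]
    exact Finset.sum_congr rfl fun i _ => by ring
  have := congrArg (fun p => p.coeff i) hPQ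
  simp only [P, Q, Polynomial.finset_sum_coeff, Polynomial.coeff_monomial] at this
  simpa [Finset.mem_range.1 hi] using this

/-- **Homogeneous decomposition on `Conv(ℝⁿ;ℝ)`** (Theorem 4): every
continuous and dually epi-translation invariant valuation on `Conv(ℝⁿ;ℝ)` is
the sum of continuous and dually epi-translation invariant valuations
`Z₀, …, Z_n` with `Z_i` homogeneous of degree `i`. -/
theorem homogeneous_decomposition_finite (n : ℕ) (Z : (Vn n → ℝ) → ℝ)
    (hcont : ContinuousValR (ConvFin n) Z)
    (hval : IsValuationR (ConvFin n) Z)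
    (hinv : DuallyEpiTranslationInvariant (ConvFin n) Z) :
    ∃ Zs : Fin (n + 1) → (Vn n → ℝ) → ℝ,
      (∀ i : Fin (n + 1),
        ContinuousValR (ConvFin n) (Zs i) ∧
        IsValuationR (ConvFin n) (Zs i) ∧
        DuallyEpiTranslationInvariant (ConvFin n) (Zs i) ∧
        HomogeneousR (ConvFin n) (Zs i) ((i : ℕ) : ℝ)) ∧
      ∀ v ∈ ConvFin n, Z v = ∑ i : Fin (n + 1), Zs i v := by
  refine ⟨fun i v => comp Z i v, fun i => ⟨?_, ?_, ?_, ?_⟩, ?_⟩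
  · intro vk v hvk hv hepi
    refine tendsto_finset_sum _ fun j _ => Tendsto.mul_const _ ?_
    have hj : (0 : ℝ) < (j : ℝ) + 1 := by positivity
    exact hcont _ _ (fun k => ConvFin_smul (hvk k) hj.le) (ConvFin_smul hv hj.le)
      (epi_smul hj hepi)
  · intro u v hu hv hs hi
    simp only [comp, ← Finset.sum_add_distrib]
    refine Finset.sum_congr rfl fun j _ => ?_
    have hj : (0 : ℝ) < (j : ℝ) + 1 := by positivity
    have e1 : (fun x => ((j : ℝ) + 1) * (u ⊔ v) x)
        = (fun x => ((j : ℝ) + 1) * u x) ⊔ (fun x => ((j : ℝ) + 1) * v x) := by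
      funext x
      exact mul_max_of_nonneg _ _ hj.le
    have e2 : (fun x => ((j : ℝ) + 1) * (u ⊓ v) x)
        = (fun x => ((j : ℝ) + 1) * u x) ⊓ (fun x => ((j : ℝ) + 1) * v x) := by
      funext x
      exact mul_min_of_nonneg _ _ hj.le
    have := hval _ _ (ConvFin_smul hu hj.le) (ConvFin_smul hv hj.le)
      (e1 ▸ ConvFin_smul hs hj.le) (e2 ▸ ConvFin_smul hi hj.le)
    rw [← e1, ← e2] at this
    rw [← add_mul, ← add_mul, this]
  · intro v hv l c
    refine Finset.sum_congr rfl fun j _ => ?_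
    have hj : (0 : ℝ) < (j : ℝ) + 1 := by positivity
    congr 1
    rw [← hinv _ (ConvFin_smul hv hj.le) (((j : ℝ) + 1) • l) (((j : ℝ) + 1) * c)]
    congr 1
    funext x
    simp only [LinearMap.smul_apply, smul_eq_mul]
    ring
  · intro v hv r hr
    rw [Real.rpow_natCast]
    exact comp_homog hcont hval hinv hv r hr i (Finset.mem_range.2 i.2)
  · intro v hv
    have := scale_comp hcont hval hinv hv 1 one_pos
    simp only [one_mul, one_pow, mul_one] at this
    rw [this, Finset.sum_range]
end
end

section
/- Let Z : Conv_sc(ℝⁿ) → ℝ be a continuous valuation. If Z(w + I_P) = 0 for every affine function w : ℝⁿ → ℝ and every polytope P ⊂ ℝⁿ, then Z(u) = 0 for every u ∈ Conv_sc(ℝⁿ). -/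
open Filter Topology MeasureTheory

noncomputable section

/-- `u : ℝⁿ → ℝ ∪ {+∞}` (represented as an `EReal`-valued function that never
takes the value `⊥ = -∞`) is convex. -/
def IsConvexFn {n : ℕ} (u : Vn n → EReal) : Prop :=
  ∀ x y : Vn n, ∀ t : ℝ, 0 < t → t < 1 →
    u (t • x + (1 - t) • y) ≤ (t : EReal) * u x + ((1 - t : ℝ) : EReal) * u y

/-- `Conv(ℝⁿ)`: convex, lower semicontinuous, proper functions
`ℝⁿ → ℝ ∪ {+∞}`. -/
def ConvSet (n : ℕ) : Set (Vn n → EReal) :=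
  {u | IsConvexFn u ∧ LowerSemicontinuous u ∧ (∀ x, u x ≠ ⊥) ∧ (∃ x, u x ≠ ⊤)}

/-- `Conv_sc(ℝⁿ)`: super-coercive elements of `Conv(ℝⁿ)`, i.e.
`u(x)/|x| → +∞` as `|x| → +∞`. -/
def ConvSc (n : ℕ) : Set (Vn n → EReal) :=
  {u | u ∈ ConvSet n ∧
    ∀ M : ℝ, ∃ R : ℝ, ∀ x : Vn n, R ≤ ‖x‖ → ((M * ‖x‖ : ℝ) : EReal) ≤ u x}

/-- Epi-convergence of a sequence `uk` to `u`. -/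
def EpiConverges {n : ℕ} (uk : ℕ → Vn n → EReal) (u : Vn n → EReal) : Prop :=
  ∀ x : Vn n,
    (∀ xk : ℕ → Vn n, Tendsto xk atTop (𝓝 x) →
      u x ≤ liminf (fun k => uk k (xk k)) atTop) ∧
    (∃ xk : ℕ → Vn n, Tendsto xk atTop (𝓝 x) ∧
      Tendsto (fun k => uk k (xk k)) atTop (𝓝 (u x)))

/-- Continuity (with respect to epi-convergence) of a functional on a class `X`. -/
def ContinuousVal {n : ℕ} (X : Set (Vn n → EReal)) (Z : (Vn n → EReal) → ℝ) : Prop :=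
  ∀ (uk : ℕ → Vn n → EReal) (u : Vn n → EReal),
    (∀ k, uk k ∈ X) → u ∈ X → EpiConverges uk u →
      Tendsto (fun k => Z (uk k)) atTop (𝓝 (Z u))

/-- The valuation property on a class `X` (here `⊔`, `⊓` are the pointwise
maximum and minimum). -/
def IsValuation {n : ℕ} (X : Set (Vn n → EReal)) (Z : (Vn n → EReal) → ℝ) : Prop :=
  ∀ u v : Vn n → EReal, u ∈ X → v ∈ X → u ⊔ v ∈ X → u ⊓ v ∈ X →
    Z (u ⊔ v) + Z (u ⊓ v) = Z u + Z v

/-- Epi-translation invariance: invariance under `u ↦ u(· - x₀) + c`. -/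
def EpiTranslationInvariant {n : ℕ} (X : Set (Vn n → EReal)) (Z : (Vn n → EReal) → ℝ) : Prop :=
  ∀ u ∈ X, ∀ x₀ : Vn n, ∀ c : ℝ, Z (fun x => u (x - x₀) + (c : EReal)) = Z u

-- Epi-multiplication `λ ⊡ u`; for `λ = 0` it is the indicator of `{0}`.
open Classical in
def epiMul {n : ℕ} (l : ℝ) (u : Vn n → EReal) : Vn n → EReal :=
  if l = 0 then (fun x => if x = 0 then (0 : EReal) else ⊤)
  else fun x => (l : EReal) * u (l⁻¹ • x)

/-- `Z` is epi-homogeneous of degree `α`: `Z(λ ⊡ u) = λ^α Z(u)` for `λ > 0`. -/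
def EpiHomogeneous {n : ℕ} (X : Set (Vn n → EReal)) (Z : (Vn n → EReal) → ℝ) (α : ℝ) : Prop :=
  ∀ u ∈ X, ∀ l : ℝ, 0 < l → Z (epiMul l u) = l ^ α * Z u

/-- A polytope: the convex hull of a nonempty finite set of points. -/
def IsPolytope {n : ℕ} (P : Set (Vn n)) : Prop :=
  ∃ s : Finset (Vn n), s.Nonempty ∧ P = convexHull ℝ (s : Set (Vn n))

-- The (convex) indicator function `I_A`: `0` on `A` and `+∞` off `A`.
open Classical in
def indE {n : ℕ} (A : Set (Vn n)) : Vn n → EReal :=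
  fun x => if x ∈ A then (0 : EReal) else ⊤

open Classical in
/-- `f + I_K` for a real-valued `f`. -/
def GK {n : ℕ} (f : Vn n → ℝ) (K : Set (Vn n)) : Vn n → EReal :=
  fun x => if x ∈ K then ((f x : ℝ) : EReal) else ⊤

lemma GK_mem {n : ℕ} {f : Vn n → ℝ} {K : Set (Vn n)} {x : Vn n} (h : x ∈ K) :
    GK f K x = (f x : EReal) := by simp [GK, h]

lemma GK_not_mem {n : ℕ} {f : Vn n → ℝ} {K : Set (Vn n)} {x : Vn n} (h : x ∉ K) :
    GK f K x = ⊤ := by simp [GK, h]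

lemma le_GK {n : ℕ} (f : Vn n → ℝ) (K : Set (Vn n)) (x : Vn n) :
    (f x : EReal) ≤ GK f K x := by
  by_cases h : x ∈ K
  · rw [GK_mem h]
  · rw [GK_not_mem h]; exact le_top

lemma GK_congr {n : ℕ} {f g : Vn n → ℝ} {K : Set (Vn n)} (h : ∀ x ∈ K, f x = g x) :
    GK f K = GK g K := by
  funext x
  by_cases hx : x ∈ K
  · rw [GK_mem hx, GK_mem hx, h x hx]
  · rw [GK_not_mem hx, GK_not_mem hx]

lemma GK_mem_ConvSc {n : ℕ} {f : Vn n → ℝ} {K : Set (Vn n)} (hf : Continuous f)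
    (hc : ConvexOn ℝ Set.univ f) (hK : IsCompact K) (hKc : Convex ℝ K) (hne : K.Nonempty) :
    GK f K ∈ ConvSc n := by
  have hbot : ∀ x, GK f K x ≠ ⊥ := by
    intro x h
    have := le_GK f K x
    rw [h] at this
    exact EReal.coe_ne_bot _ (le_bot_iff.mp this)
  have hmulbot : ∀ (t : ℝ), 0 < t → ∀ x, (t : EReal) * GK f K x ≠ ⊥ := by
    intro t ht x
    by_cases h : x ∈ K
    · rw [GK_mem h, ← EReal.coe_mul]; exact EReal.coe_ne_bot _
    · rw [GK_not_mem h, EReal.coe_mul_top_of_pos ht]; simp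
  refine ⟨⟨?_, ?_, hbot, ?_⟩, ?_⟩
  · intro x y t ht0 ht1
    have ht1' : 0 < 1 - t := by linarith
    by_cases hx : x ∈ K
    · by_cases hy : y ∈ K
      · have hm : t • x + (1 - t) • y ∈ K := hKc hx hy ht0.le ht1'.le (by ring)
        rw [GK_mem hx, GK_mem hy, GK_mem hm, ← EReal.coe_mul, ← EReal.coe_mul, ← EReal.coe_add]
        have := hc.2 (Set.mem_univ x) (Set.mem_univ y) ht0.le ht1'.le (by ring)
        exact_mod_cast this
      · rw [GK_not_mem hy, EReal.coe_mul_top_of_pos ht1', EReal.add_top_of_ne_bot (hmulbot t ht0 x)]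
        exact le_top
    · rw [GK_not_mem hx, EReal.coe_mul_top_of_pos ht0,
        EReal.top_add_of_ne_bot (hmulbot _ ht1' y)]
      exact le_top
  · intro x y hy
    by_cases hx : x ∈ K
    · rw [GK_mem hx] at hy
      have : Continuous (fun x => (f x : EReal)) := continuous_coe_real_ereal.comp hf
      filter_upwards [this.continuousAt.eventually (lt_mem_nhds hy)] with z hz
      exact lt_of_lt_of_le hz (le_GK f K z)
    · rw [GK_not_mem hx] at hy
      filter_upwards [hK.isClosed.isOpen_compl.mem_nhds hx] with z hz
      rw [GK_not_mem hz]; exact hy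
  · obtain ⟨x, hx⟩ := hne
    exact ⟨x, by rw [GK_mem hx]; exact EReal.coe_ne_top _⟩
  · intro M
    obtain ⟨R, hR⟩ := hK.isBounded.exists_norm_le
    refine ⟨R + 1, fun x hx => ?_⟩
    rw [GK_not_mem (fun h => by have := hR x h; linarith)]
    exact le_top

lemma compact_vanish {n : ℕ} (Z : (Vn n → EReal) → ℝ)
    (hcont : ContinuousVal (ConvSc n) Z)
    (h0 : ∀ (w : Vn n →ᵃ[ℝ] ℝ) (P : Set (Vn n)), IsPolytope P →
      Z (fun x => (w x : EReal) + indE P x) = 0)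
    (w : Vn n →ᵃ[ℝ] ℝ) (K : Set (Vn n)) (hK : IsCompact K) (hKc : Convex ℝ K)
    (hne : K.Nonempty) : Z (GK w K) = 0 := by
  have hw : Continuous w := w.continuous_of_finiteDimensional
  have hwc : ConvexOn ℝ Set.univ w := by
    refine ⟨convex_univ, fun x _ y _ a b ha hb hab => le_of_eq ?_⟩
    exact Convex.combo_affine_apply hab
  have key : ∀ k : ℕ, ∃ s : Finset (Vn n), s.Nonempty ∧ (s : Set (Vn n)) ⊆ K ∧
      ∀ x ∈ K, ∃ y ∈ s, dist x y < 1 / ((k : ℝ) + 1) := by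
    intro k
    have hp : (0 : ℝ) < 1 / ((k : ℝ) + 1) := by positivity
    obtain ⟨t, htK, htf, htc⟩ := hK.finite_cover_balls hp
    have hcov : ∀ x ∈ K, ∃ y ∈ htf.toFinset, dist x y < 1 / ((k : ℝ) + 1) := by
      intro x hx
      have := htc hx
      simp only [Set.mem_iUnion, Metric.mem_ball] at this
      obtain ⟨y, hy, hd⟩ := this
      exact ⟨y, by simpa using hy, hd⟩
    refine ⟨htf.toFinset, ?_, by simpa using htK, hcov⟩
    obtain ⟨x, hx⟩ := hne
    obtain ⟨y, hy, _⟩ := hcov x hx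
    exact ⟨y, hy⟩
  choose s hsne hsK hs using key
  have hPK : ∀ k, convexHull ℝ (s k : Set (Vn n)) ⊆ K := fun k => convexHull_min (hsK k) hKc
  have hz : ∀ k, Z (GK w (convexHull ℝ (s k : Set (Vn n)))) = 0 := by
    intro k
    rw [← h0 w _ ⟨s k, hsne k, rfl⟩]
    congr 1
    funext x
    by_cases hx : x ∈ convexHull ℝ (s k : Set (Vn n))
    · simp [GK, indE, hx]
    · simp [GK, indE, hx]
  have hlim := hcont (fun k => GK w (convexHull ℝ (s k : Set (Vn n)))) (GK w K)
    (fun k => GK_mem_ConvSc hw hwc ((s k).finite_toSet.isCompact_convexHull ℝ)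
      (convex_convexHull ℝ _) (by
        obtain ⟨y, hy⟩ := hsne k
        exact ⟨y, subset_convexHull ℝ _ hy⟩))
    (GK_mem_ConvSc hw hwc hK hKc hne) (by
      intro x
      refine ⟨?_, ?_⟩
      · intro xk hxk
        have hwe : Continuous (fun x => (w x : EReal)) := continuous_coe_real_ereal.comp hw
        by_cases hx : x ∈ K
        · rw [GK_mem hx, ← ((hwe.tendsto x).comp hxk).liminf_eq]
          exact liminf_le_liminf (Eventually.of_forall fun k => le_GK _ _ _)
        · have hev : ∀ᶠ k in atTop, (⊤ : EReal) ≤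
              GK w (convexHull ℝ (s k : Set (Vn n))) (xk k) := by
            filter_upwards [hxk.eventually (hK.isClosed.isOpen_compl.mem_nhds hx)] with k hk
            rw [GK_not_mem (fun h => hk (hPK k h))]
          exact le_trans le_top (le_liminf_of_le (by isBoundedDefault) hev)
      · by_cases hx : x ∈ K
        · have := fun k => hs k x hx
          choose y hy hd using this
          have hyx : Tendsto y atTop (𝓝 x) := by
            rw [tendsto_iff_dist_tendsto_zero]
            refine squeeze_zero (fun _ => dist_nonneg) (fun k => ?_)
              tendsto_one_div_add_atTop_nhds_zero_nat
            rw [dist_comm]; exact (hd k).le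
          refine ⟨y, hyx, ?_⟩
          have hwe : Continuous (fun x => (w x : EReal)) := continuous_coe_real_ereal.comp hw
          rw [GK_mem hx]
          refine ((hwe.tendsto x).comp hyx).congr (fun k => ?_)
          exact (GK_mem (f := w) (subset_convexHull ℝ _ (hy k))).symm
        · refine ⟨fun _ => x, tendsto_const_nhds, ?_⟩
          rw [GK_not_mem hx]
          refine tendsto_const_nhds.congr (fun k => ?_)
          exact (GK_not_mem (f := w) (fun h => hx (hPK k h))).symm)
  simp only [hz] at hlim
  exact tendsto_nhds_unique hlim tendsto_const_nhds

lemma sup_props {n : ℕ} (s : Finset (Vn n →ᵃ[ℝ] ℝ)) (hs : s.Nonempty) :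
    Continuous (fun x => s.sup' hs (fun w => w x)) ∧
    ConvexOn ℝ Set.univ (fun x => s.sup' hs (fun w => w x)) := by
  constructor
  · exact Continuous.finset_sup'_apply hs (fun w _ => w.continuous_of_finiteDimensional)
  · refine ⟨convex_univ, fun x _ y _ a b ha hb hab => ?_⟩
    refine Finset.sup'_le _ _ (fun w hw => ?_)
    rw [Convex.combo_affine_apply hab]
    simp only [smul_eq_mul]
    have h1 := Finset.le_sup' (fun w : Vn n →ᵃ[ℝ] ℝ => w x) hw
    have h2 := Finset.le_sup' (fun w : Vn n →ᵃ[ℝ] ℝ => w y) hw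
    exact add_le_add (mul_le_mul_of_nonneg_left h1 ha) (mul_le_mul_of_nonneg_left h2 hb)

open Classical in
lemma sup_erase {n : ℕ} (s : Finset (Vn n →ᵃ[ℝ] ℝ)) (hs : s.Nonempty) (a b : Vn n →ᵃ[ℝ] ℝ)
    (ha : a ∈ s) (hab : a ≠ b) (he : (s.erase b).Nonempty) (x : Vn n) (hx : b x ≤ a x) :
    s.sup' hs (fun w => w x) = (s.erase b).sup' he (fun w => w x) := by
  apply le_antisymm
  · refine Finset.sup'_le _ _ (fun w hw => ?_)
    by_cases hwb : w = b
    · subst hwb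
      exact hx.trans (Finset.le_sup' (fun w : Vn n →ᵃ[ℝ] ℝ => w x)
        (Finset.mem_erase.mpr ⟨hab, ha⟩))
    · exact Finset.le_sup' (fun w : Vn n →ᵃ[ℝ] ℝ => w x) (Finset.mem_erase.mpr ⟨hwb, hw⟩)
  · exact Finset.sup'_mono _ (Finset.erase_subset _ _) _

lemma pa_vanish {n : ℕ} (Z : (Vn n → EReal) → ℝ)
    (hval : IsValuation (ConvSc n) Z)
    (h1 : ∀ (w : Vn n →ᵃ[ℝ] ℝ) (K : Set (Vn n)), IsCompact K → Convex ℝ K → K.Nonempty →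
      Z (GK w K) = 0) (m : ℕ) :
    ∀ (s : Finset (Vn n →ᵃ[ℝ] ℝ)) (hs : s.Nonempty), s.card = m + 1 →
    ∀ K : Set (Vn n), IsCompact K → Convex ℝ K → K.Nonempty →
      Z (GK (fun x => s.sup' hs (fun w => w x)) K) = 0 := by
  classical
  induction m with
  | zero =>
    intro s hs hcard K hK hKc hne
    obtain ⟨w, rfl⟩ := Finset.card_eq_one.mp hcard
    simpa using h1 w K hK hKc hne
  | succ m ih =>
    intro s hs hcard K hK hKc hne
    obtain ⟨a, ha, b, hb, hab⟩ := Finset.one_lt_card.mp (by omega : 1 < s.card)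
    have hea : (s.erase a).Nonempty := ⟨b, Finset.mem_erase.mpr ⟨hab.symm, hb⟩⟩
    have heb : (s.erase b).Nonempty := ⟨a, Finset.mem_erase.mpr ⟨hab, ha⟩⟩
    have hca : (s.erase a).card = m + 1 := by rw [Finset.card_erase_of_mem ha]; omega
    have hcb : (s.erase b).card = m + 1 := by rw [Finset.card_erase_of_mem hb]; omega
    have hac : Continuous a := a.continuous_of_finiteDimensional
    have hbc : Continuous b := b.continuous_of_finiteDimensional
    obtain ⟨fcont, fconv⟩ := sup_props s hs
    set f : Vn n → ℝ := fun x => s.sup' hs (fun w => w x) with hf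
    -- a piece on which `b ≤ a`, resp. `a ≤ b`
    have pb : ∀ C : Set (Vn n), IsCompact C → Convex ℝ C → C.Nonempty →
        (∀ x ∈ C, b x ≤ a x) → Z (GK f C) = 0 := by
      intro C hC hCc hCn h
      rw [GK_congr (fun x hx => sup_erase s hs a b ha hab heb x (h x hx))]
      exact ih _ heb hcb C hC hCc hCn
    have pa : ∀ C : Set (Vn n), IsCompact C → Convex ℝ C → C.Nonempty →
        (∀ x ∈ C, a x ≤ b x) → Z (GK f C) = 0 := by
      intro C hC hCc hCn h
      rw [GK_congr (fun x hx => sup_erase s hs b a hb hab.symm hea x (h x hx))]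
      exact ih _ hea hca C hC hCc hCn
    have conv1 : ∀ c d : Vn n →ᵃ[ℝ] ℝ, Convex ℝ {x | c x ≤ d x} := by
      intro c d x hx y hy p q hp hq hpq
      simp only [Set.mem_setOf_eq] at *
      rw [Convex.combo_affine_apply hpq, Convex.combo_affine_apply hpq]
      simp only [smul_eq_mul]
      exact add_le_add (mul_le_mul_of_nonneg_left hx hp) (mul_le_mul_of_nonneg_left hy hq)
    by_cases hA : ∀ x ∈ K, b x ≤ a x
    · exact pb K hK hKc hne hA
    by_cases hB : ∀ x ∈ K, a x ≤ b x
    · exact pa K hK hKc hne hB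
    push Not at hA hB
    obtain ⟨x, hxK, hx⟩ := hA
    obtain ⟨y, hyK, hy⟩ := hB
    set Kp := K ∩ {x | b x ≤ a x} with hKp
    set Km := K ∩ {x | a x ≤ b x} with hKm
    have cKp : IsCompact Kp := hK.inter_right (isClosed_le hbc hac)
    have cKm : IsCompact Km := hK.inter_right (isClosed_le hac hbc)
    have vKp : Convex ℝ Kp := hKc.inter (conv1 b a)
    have vKm : Convex ℝ Km := hKc.inter (conv1 a b)
    have nKp : Kp.Nonempty := ⟨y, hyK, hy.le⟩
    have nKm : Km.Nonempty := ⟨x, hxK, hx.le⟩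
    have nKi : (Kp ∩ Km).Nonempty := by
      have hd : 0 < (b x - a x) + (a y - b y) := by linarith
      set D := (b x - a x) + (a y - b y) with hD
      have e1 : (a y - b y) / D + (b x - a x) / D = 1 := by
        rw [← add_div, hD, add_comm, div_self (hD ▸ hd.ne')]
      have heq : a (((a y - b y) / D) • x + ((b x - a x) / D) • y) =
          b (((a y - b y) / D) • x + ((b x - a x) / D) • y) := by
        rw [Convex.combo_affine_apply e1, Convex.combo_affine_apply e1]
        simp only [smul_eq_mul]
        field_simp
        ring
      have hm : ((a y - b y) / D) • x + ((b x - a x) / D) • y ∈ K :=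
        hKc hxK hyK (div_nonneg (by linarith) hd.le) (div_nonneg (by linarith) hd.le) e1
      exact ⟨_, ⟨hm, heq.ge⟩, ⟨hm, heq.le⟩⟩
    have esup : GK f Kp ⊔ GK f Km = GK f (Kp ∩ Km) := by
      funext z
      by_cases h1 : z ∈ Kp <;> by_cases h2 : z ∈ Km <;> simp [GK, h1, h2]
    have einf : GK f Kp ⊓ GK f Km = GK f K := by
      funext z
      by_cases hz : z ∈ K
      · rcases le_total (b z) (a z) with h | h
        · have h1 : z ∈ Kp := ⟨hz, h⟩
          by_cases h2 : z ∈ Km <;> simp [GK, h1, h2, hz]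
        · have h1 : z ∈ Km := ⟨hz, h⟩
          by_cases h2 : z ∈ Kp <;> simp [GK, h1, h2, hz]
      · have h1 : z ∉ Kp := fun h => hz h.1
        have h2 : z ∉ Km := fun h => hz h.1
        simp [GK, h1, h2, hz]
    have cKi : IsCompact (Kp ∩ Km) := cKp.inter cKm
    have vKi : Convex ℝ (Kp ∩ Km) := vKp.inter vKm
    have hv := hval (GK f Kp) (GK f Km) (GK_mem_ConvSc fcont fconv cKp vKp nKp)
      (GK_mem_ConvSc fcont fconv cKm vKm nKm)
      (by rw [esup]; exact GK_mem_ConvSc fcont fconv cKi vKi nKi)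
      (by rw [einf]; exact GK_mem_ConvSc fcont fconv hK hKc hne)
    rw [esup, einf, pb Kp cKp vKp nKp (fun x hx => hx.2), pa Km cKm vKm nKm (fun x hx => hx.2),
      pb (Kp ∩ Km) cKi vKi nKi (fun x hx => hx.1.2)] at hv
    linarith

lemma sep {n : ℕ} {u : Vn n → EReal} (hu : u ∈ ConvSet n) (x0 : Vn n) (r : ℝ)
    (hr : (r : EReal) < u x0) :
    ∃ (L : Vn n →ₗ[ℝ] ℝ) (c α : ℝ), 0 ≤ c ∧ L x0 + c * r < α ∧
      ∀ (x : Vn n) (s : ℝ), u x ≤ (s : EReal) → α < L x + c * s := by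
  obtain ⟨hc, hlsc, hbot, x1, hx1⟩ := hu
  have hcl : IsClosed {p : Vn n × ℝ | u p.1 ≤ (p.2 : EReal)} := by
    have h : IsClosed {p : Vn n × EReal | u p.1 ≤ p.2} := hlsc.isClosed_epigraph
    exact h.preimage (continuous_fst.prodMk (continuous_coe_real_ereal.comp continuous_snd))
  have hcv : Convex ℝ {p : Vn n × ℝ | u p.1 ≤ (p.2 : EReal)} := by
    rw [convex_iff_forall_pos]
    rintro ⟨x, s⟩ hx ⟨y, t⟩ hy a b ha hb hab
    simp only [Set.mem_setOf_eq] at *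
    obtain rfl : b = 1 - a := by linarith
    have h := hc x y a ha (by linarith)
    refine h.trans ?_
    simp only [Prod.smul_mk, Prod.mk_add_mk, smul_eq_mul, EReal.coe_add, EReal.coe_mul]
    exact add_le_add (mul_le_mul_of_nonneg_left hx (by exact_mod_cast ha.le))
      (mul_le_mul_of_nonneg_left hy (by exact_mod_cast hb.le))
  obtain ⟨f, α, hf1, hf2⟩ := geometric_hahn_banach_point_closed hcv hcl
    (x := (x0, r)) (by simpa using hr)
  have hdec : ∀ (x : Vn n) (s : ℝ), f (x, s) = f (x, 0) + f (0, 1) * s := by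
    intro x s
    have : ((x, s) : Vn n × ℝ) = (x, 0) + s • ((0 : Vn n), (1 : ℝ)) := by simp
    rw [this, map_add, map_smul, smul_eq_mul, mul_comm]
  have hf3 : ∀ (x : Vn n) (s : ℝ), u x ≤ (s : EReal) → α < f (x, 0) + f (0, 1) * s := by
    intro x s h
    rw [← hdec]
    exact hf2 (x, s) h
  refine ⟨(f : Vn n × ℝ →ₗ[ℝ] ℝ).comp (LinearMap.inl ℝ _ _), f (0, 1), α, ?_, ?_, hf3⟩
  · by_contra hneg
    push Not at hneg
    have e : u x1 = ((u x1).toReal : EReal) := (EReal.coe_toReal hx1 (hbot x1)).symm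
    set s1 := (u x1).toReal
    have g1 := hf3 x1 s1 e.le
    set c := f (0, 1)
    have ht : 0 ≤ (f (x1, 0) + c * s1 - α) / (-c) := div_nonneg (by linarith) (by linarith)
    have g2 := hf3 x1 (s1 + (f (x1, 0) + c * s1 - α) / (-c)) (by
      rw [e]; exact_mod_cast (by linarith))
    have : c * ((f (x1, 0) + c * s1 - α) / (-c)) = -(f (x1, 0) + c * s1 - α) := by
      have hc0 : c ≠ 0 := hneg.ne
      rw [div_neg, mul_neg, mul_div_cancel₀ _ hc0]
    rw [mul_add, this] at g2
    linarith
  · rw [hdec] at hf1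
    exact hf1

lemma minorant_of_pos {n : ℕ} {u : Vn n → EReal} (hu : u ∈ ConvSet n)
    (L : Vn n →ₗ[ℝ] ℝ) (c α : ℝ) (hc : 0 < c)
    (h : ∀ (x : Vn n) (s : ℝ), u x ≤ (s : EReal) → α < L x + c * s) :
    ∃ w : Vn n →ᵃ[ℝ] ℝ, (∀ x, (w x : EReal) ≤ u x) ∧ ∀ x, w x = (α - L x) / c := by
  refine ⟨((-c⁻¹) • L).toAffineMap + AffineMap.const ℝ (Vn n) (α / c), ?_, ?_⟩
  swap
  · intro x; simp; ring
  · intro x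
    by_cases hx : u x = ⊤
    · rw [hx]; exact le_top
    · have e : u x = ((u x).toReal : EReal) := (EReal.coe_toReal hx (hu.2.2.1 x)).symm
      have := h x _ e.le
      rw [e]
      refine EReal.coe_le_coe_iff.mpr ?_
      have e2 : (((-c⁻¹) • L).toAffineMap + AffineMap.const ℝ (Vn n) (α / c)) x
        = (α - L x) / c := by simp; ring
      rw [e2, div_le_iff₀ hc]
      linarith

lemma minorant {n : ℕ} {u : Vn n → EReal} (hu : u ∈ ConvSet n) (x0 : Vn n) (r : ℝ)
    (hr : (r : EReal) < u x0) :
    ∃ w : Vn n →ᵃ[ℝ] ℝ, (∀ x, (w x : EReal) ≤ u x) ∧ r < w x0 := by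
  obtain ⟨L, c, α, hc, h1, h2⟩ := sep hu x0 r hr
  rcases hc.lt_or_eq with hc | hc
  · obtain ⟨w, hw, hw'⟩ := minorant_of_pos hu L c α hc h2
    refine ⟨w, hw, ?_⟩
    rw [hw', lt_div_iff₀ hc]
    linarith
  · subst hc
    obtain ⟨x1, hx1⟩ := hu.2.2.2
    have e : u x1 = ((u x1).toReal : EReal) := (EReal.coe_toReal hx1 (hu.2.2.1 x1)).symm
    obtain ⟨L', c', α', hc', g1, g2⟩ := sep hu x1 ((u x1).toReal - 1) (by
      rw [e]; exact_mod_cast (by simp))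
    have g3 := g2 x1 _ e.le
    have hc'' : 0 < c' := by nlinarith
    obtain ⟨w, hw, hw'⟩ := minorant_of_pos hu L' c' α' hc'' g2
    have hd : 0 < α - L x0 := by linarith
    set N := (|r - w x0| + 1) / (α - L x0) with hN
    have hN0 : 0 ≤ N := by positivity
    have ew : ∀ x, (w + ((-N) • L).toAffineMap + AffineMap.const ℝ (Vn n) (N * α)) x
        = w x + N * (α - L x) := by intro x; simp; ring
    refine ⟨w + ((-N) • L).toAffineMap + AffineMap.const ℝ (Vn n) (N * α), ?_, ?_⟩
    · intro x
      rw [ew]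
      by_cases hx : u x = ⊤
      · rw [hx]; exact le_top
      · have e : u x = ((u x).toReal : EReal) := (EReal.coe_toReal hx (hu.2.2.1 x)).symm
        have k1 := h2 x _ e.le
        refine le_trans (EReal.coe_le_coe_iff.mpr ?_) (hw x)
        nlinarith
    · rw [ew]
      have : N * (α - L x0) = |r - w x0| + 1 := by rw [hN]; field_simp
      rw [this]
      have := le_abs_self (r - w x0)
      linarith

lemma seq_minorant {n : ℕ} {u : Vn n → EReal} (hu : u ∈ ConvSet n) :
    ∃ w : ℕ → (Vn n →ᵃ[ℝ] ℝ), (∀ i x, (w i x : EReal) ≤ u x) ∧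
      ∀ x (r : ℝ), (r : EReal) < u x → ∃ i, r < w i x := by
  let M := {w : Vn n →ᵃ[ℝ] ℝ // ∀ x, (w x : EReal) ≤ u x}
  let O : M → Set (Vn n × ℝ) := fun w => {p | p.2 < w.1 p.1}
  obtain ⟨T, hT, hTU⟩ := TopologicalSpace.isOpen_iUnion_countable O (fun w =>
    isOpen_lt continuous_snd (w.1.continuous_of_finiteDimensional.comp continuous_fst))
  have hcov : ∀ x (r : ℝ), (r : EReal) < u x → ∃ w ∈ T, r < w.1 x := by
    intro x r h
    obtain ⟨w, hw, hr⟩ := minorant hu x r h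
    have : (x, r) ∈ ⋃ i ∈ T, O i := by
      rw [hTU]
      exact Set.mem_iUnion.mpr ⟨⟨w, hw⟩, hr⟩
    simp only [Set.mem_iUnion] at this
    obtain ⟨i, hi, h⟩ := this
    exact ⟨i, hi, h⟩
  have hTn : T.Nonempty := by
    obtain ⟨r, _, hr⟩ := EReal.lt_iff_exists_real_btwn.mp (bot_lt_iff_ne_bot.mpr (hu.2.2.1 0))
    obtain ⟨w, hw, _⟩ := hcov 0 r hr
    exact ⟨w, hw⟩
  obtain ⟨g, rfl⟩ := hT.exists_eq_range hTn
  refine ⟨fun i => (g i).1, fun i => (g i).2, fun x r h => ?_⟩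
  obtain ⟨w, ⟨i, rfl⟩, h⟩ := hcov x r h
  exact ⟨i, h⟩

/-- **Vanishing lemma** (Lemma 3.4): if a continuous valuation `Z` on
`Conv_sc(ℝⁿ)` vanishes on all functions `w + I_P` with `w` affine and `P` a
polytope, then `Z` vanishes identically on `Conv_sc(ℝⁿ)`. -/
theorem null_lemma (n : ℕ) (Z : (Vn n → EReal) → ℝ)
    (hcont : ContinuousVal (ConvSc n) Z)
    (hval : IsValuation (ConvSc n) Z)
    (h0 : ∀ (w : Vn n →ᵃ[ℝ] ℝ) (P : Set (Vn n)), IsPolytope P →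
      Z (fun x => (w x : EReal) + indE P x) = 0) :
    ∀ u ∈ ConvSc n, Z u = 0 := by
  classical
  intro u hu
  obtain ⟨w, hwle, hwsup⟩ := seq_minorant hu.1
  let S : ℕ → Finset (Vn n →ᵃ[ℝ] ℝ) := fun k => (Finset.range (k + 1)).image w
  have hS : ∀ k, (S k).Nonempty := fun k => (Finset.nonempty_range_add_one).image w
  let f : ℕ → Vn n → ℝ := fun k x => (S k).sup' (hS k) (fun w => w x)
  have hfw : ∀ i k x, i ≤ k → w i x ≤ f k x := by
    intro i k x h
    exact Finset.le_sup' (fun w : Vn n →ᵃ[ℝ] ℝ => w x)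
      (Finset.mem_image_of_mem w (Finset.mem_range.mpr (by omega)))
  have hfu : ∀ k x, (f k x : EReal) ≤ u x := by
    intro k x
    obtain ⟨v, hv, e⟩ := Finset.exists_mem_eq_sup' (hS k) (fun w : Vn n →ᵃ[ℝ] ℝ => w x)
    obtain ⟨i, _, rfl⟩ := Finset.mem_image.mp hv
    change (((S k).sup' (hS k) (fun w => w x) : ℝ) : EReal) ≤ u x
    rw [e]
    exact hwle i x
  let B : ℕ → Set (Vn n) := fun k => Metric.closedBall 0 k
  have hBc : ∀ k, IsCompact (B k) := fun k => isCompact_closedBall _ _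
  have hBv : ∀ k, Convex ℝ (B k) := fun k => convex_closedBall _ _
  have hBn : ∀ k, (B k).Nonempty := fun k => ⟨0, by simp [B]⟩
  have hz : ∀ k, Z (GK (f k) (B k)) = 0 := fun k =>
    pa_vanish Z hval (fun w K h1 h2 h3 => compact_vanish Z hcont h0 w K h1 h2 h3)
      ((S k).card - 1) (S k) (hS k) (by have := (hS k).card_pos; omega) (B k)
      (hBc k) (hBv k) (hBn k)
  have hlow : ∀ (x : Vn n) (xk : ℕ → Vn n), Tendsto xk atTop (𝓝 x) → ∀ r : ℝ,
      (r : EReal) < u x → ∀ᶠ k in atTop, (r : EReal) < GK (f k) (B k) (xk k) := by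
    intro x xk hxk r hr
    obtain ⟨i, hi⟩ := hwsup x r hr
    have hc : Continuous (w i) := (w i).continuous_of_finiteDimensional
    filter_upwards [((hc.tendsto x).comp hxk).eventually (lt_mem_nhds hi),
      eventually_ge_atTop i] with k hk hik
    refine lt_of_lt_of_le ?_ (le_GK _ _ _)
    exact EReal.coe_lt_coe_iff.mpr (lt_of_lt_of_le hk (hfw i k _ hik))
  have hlim := hcont (fun k => GK (f k) (B k)) u
    (fun k => GK_mem_ConvSc (sup_props _ (hS k)).1 (sup_props _ (hS k)).2
      (hBc k) (hBv k) (hBn k)) hu (by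
      intro x
      refine ⟨fun xk hxk => ?_, fun _ => x, tendsto_const_nhds, ?_⟩
      · refine le_of_forall_lt (fun a ha => ?_)
        obtain ⟨r, h1, h2⟩ := EReal.lt_iff_exists_real_btwn.mp ha
        refine lt_of_lt_of_le h1 (le_liminf_of_le (by isBoundedDefault) ?_)
        filter_upwards [hlow x xk hxk r h2] with k hk
        exact hk.le
      · refine tendsto_order.mpr ⟨fun a ha => ?_, fun a ha => ?_⟩
        · obtain ⟨r, h1, h2⟩ := EReal.lt_iff_exists_real_btwn.mp ha
          filter_upwards [hlow x _ tendsto_const_nhds r h2] with k hk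
          exact h1.trans hk
        · obtain ⟨N, hN⟩ := exists_nat_ge ‖x‖
          filter_upwards [eventually_ge_atTop N] with k hk
          have hx : x ∈ B k := by
            simp only [B, mem_closedBall_zero_iff]
            exact hN.trans (by exact_mod_cast hk)
          rw [GK_mem hx]
          exact lt_of_le_of_lt (hfu k x) ha)
  simp only [hz] at hlim
  exact tendsto_nhds_unique hlim tendsto_const_nhds
end
end
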